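/- Let G be a 2-connected [5,3]-graph of order n ≥ 9 with minimum degree at least 3. If G contains a C~ℓ for some ℓ < n−1, then G contains a C~(ℓ+1) or a C~(ℓ+2). -/

import Mathlib

def edgesWithin {V : Type*} [DecidableEq V] (G : SimpleGraph V) [DecidableRel G.Adj]
    (A : Finset V) : ℕ := (A.sym2.filter (· ∈ G.edgeSet)).card

/-- `G` is an `[s,t]`-graph: every induced subgraph on `s` vertices has at least `t` edges. -/
def IsSTGraph {V : Type*} [DecidableEq V] (G : SimpleGraph V) [DecidableRel G.Adj]
    (s t : ℕ) : Prop := ∀ A : Finset V, A.card = s → t ≤ edgesWithin G A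
/-- `G` is 2-connected: at least 3 vertices and deleting any single vertex leaves it connected. -/
def TwoConnected {V : Type*} [Fintype V] (G : SimpleGraph V) : Prop :=
  3 ≤ Fintype.card V ∧ ∀ v : V, (G.induce {u : V | u ≠ v}).Connected
/-- `tildeC ℓ`: a cycle of length `ℓ` with an extra vertex adjacent to two consecutive
cycle vertices. -/
def tildeC (ℓ : ℕ) : SimpleGraph (Fin ℓ ⊕ Unit) :=
  SimpleGraph.fromRel (fun a b =>
    match a, b with
    | Sum.inl i, Sum.inl j => (SimpleGraph.cycleGraph ℓ).Adj i j
    | Sum.inl i, Sum.inr _ => (i : ℕ) = 0 ∨ (i : ℕ) = 1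
    | _, _ => False)

/-- `H` is contained in `G` as a not-necessarily-induced subgraph. -/
def ContainsCopy {α V : Type*} (H : SimpleGraph α) (G : SimpleGraph V) : Prop :=
  ∃ f : H →g G, Function.Injective f

namespace StmtFour

variable {V : Type*}

/-- `Pth G u l v`: the sequence `u, l, v` is a walk in `G`. -/
def Pth (G : SimpleGraph V) : V → List V → V → Prop
  | u, [], v => G.Adj u v
  | u, w :: l, v => G.Adj u w ∧ Pth G w l v

@[simp] theorem pth_nil (G : SimpleGraph V) (u v : V) : Pth G u [] v ↔ G.Adj u v := Iff.rfl

@[simp] theorem pth_cons (G : SimpleGraph V) (u v w : V) (l : List V) :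
    Pth G u (w :: l) v ↔ G.Adj u w ∧ Pth G w l v := Iff.rfl

@[simp] theorem pth_append (G : SimpleGraph V) (l m : List V) (u v w : V) :
    Pth G u (l ++ w :: m) v ↔ Pth G u l w ∧ Pth G w m v := by
  induction l generalizing u with
  | nil => simp
  | cons a l ih => simp [ih, and_assoc]

theorem pth_rev (G : SimpleGraph V) (l : List V) (u v : V) (h : Pth G u l v) :
    Pth G v l.reverse u := by
  induction l generalizing u with
  | nil => exact SimpleGraph.Adj.symm h
  | cons a l ih =>
    have h' := (pth_cons G u v a l).1 h
    rw [List.reverse_cons]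
    exact (pth_append G _ _ _ _ _).2 ⟨ih a h'.2, SimpleGraph.Adj.symm h'.1⟩

/-- there is a cycle with `q` vertices -/
def CycN (G : SimpleGraph V) (q : ℕ) : Prop :=
  ∃ c T, Pth G c T c ∧ (c :: T).Nodup ∧ T.length + 1 = q

/-- there is a cycle with `q` vertices and a chord between vertices at distance two -/
def GoodCyc (G : SimpleGraph V) (q : ℕ) : Prop :=
  ∃ a b c T, G.Adj a b ∧ G.Adj b c ∧ G.Adj a c ∧ Pth G c T a ∧ (a :: b :: c :: T).Nodup ∧
    T.length + 3 = q

theorem GoodCyc.down {G : SimpleGraph V} {q : ℕ} (h : GoodCyc G (q + 1)) : CycN G q := by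
  obtain ⟨a, b, c, T, h1, h2, h3, h4, h5, h6⟩ := h
  refine ⟨a, c :: T, ⟨h3, h4⟩, ?_, by simp; omega⟩
  exact h5.sublist (by simp [List.Sublist.cons])

open Classical in
/-- indicator of adjacency -/
noncomputable def ind (G : SimpleGraph V) (a b : V) : ℕ := if G.Adj a b then 1 else 0

/-- the `[5,3]` condition as an inequality -/
def FiveI (G : SimpleGraph V) : Prop := ∀ a b c d e : V, [a, b, c, d, e].Nodup →
  3 ≤ ind G a b + ind G a c + ind G a d + ind G a e + ind G b c + ind G b d + ind G b e
    + ind G c d + ind G c e + ind G d e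

theorem sum_key [DecidableEq V] (G : SimpleGraph V) [DecidableRel G.Adj] (s : Finset (Sym2 V)) (x y : V) :
    ∑ p ∈ insert s(x, y) s, (if p ∈ G.edgeSet then 1 else 0) ≤
      ind G x y + ∑ p ∈ s, (if p ∈ G.edgeSet then 1 else 0) := by
  by_cases hm : s(x, y) ∈ s
  · rw [Finset.insert_eq_of_mem hm]; omega
  · rw [Finset.sum_insert hm]
    unfold ind
    by_cases h : G.Adj x y
    · simp [h]
    · simp [h]

theorem fiveI_of [DecidableEq V] (G : SimpleGraph V) [DecidableRel G.Adj]
    (h : IsSTGraph G 5 3) : FiveI G := by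
  intro a b c d e hn
  have h0 := h {a, b, c, d, e} (by
    simpa using (List.toFinset_card_of_nodup hn))
  unfold edgesWithin at h0
  have hsub : (({a, b, c, d, e} : Finset V).sym2.filter (· ∈ G.edgeSet)) ⊆
      (({s(a, b), s(a, c), s(a, d), s(a, e), s(b, c), s(b, d), s(b, e), s(c, d), s(c, e), s(d, e)} :
        Finset (Sym2 V)).filter (· ∈ G.edgeSet)) := by
    intro p
    induction p using Sym2.ind with
    | _ x y =>
      intro hp
      simp only [Finset.mem_filter, Finset.mk_mem_sym2_iff, Finset.mem_insert,
        Finset.mem_singleton, SimpleGraph.mem_edgeSet] at hp ⊢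
      obtain ⟨⟨hx, hy⟩, hxy⟩ := hp
      refine ⟨?_, hxy⟩
      have hne := hxy.ne
      rcases hx with rfl | rfl | rfl | rfl | rfl <;> rcases hy with rfl | rfl | rfl | rfl | rfl <;>
        simp_all [Sym2.eq_swap]
  have h1 := h0.trans (Finset.card_le_card hsub)
  rw [Finset.card_filter] at h1
  have e1 := sum_key G {s(a, c), s(a, d), s(a, e), s(b, c), s(b, d), s(b, e), s(c, d), s(c, e), s(d, e)} a b
  have e2 := sum_key G {s(a, d), s(a, e), s(b, c), s(b, d), s(b, e), s(c, d), s(c, e), s(d, e)} a c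
  have e3 := sum_key G {s(a, e), s(b, c), s(b, d), s(b, e), s(c, d), s(c, e), s(d, e)} a d
  have e4 := sum_key G {s(b, c), s(b, d), s(b, e), s(c, d), s(c, e), s(d, e)} a e
  have e5 := sum_key G {s(b, d), s(b, e), s(c, d), s(c, e), s(d, e)} b c
  have e6 := sum_key G {s(b, e), s(c, d), s(c, e), s(d, e)} b d
  have e7 := sum_key G {s(c, d), s(c, e), s(d, e)} b e
  have e8 := sum_key G {s(c, e), s(d, e)} c d
  have e9 := sum_key G {s(d, e)} c e
  have e10 := sum_key G ∅ d e
  simp only [Finset.sum_empty, insert_empty_eq] at e10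
  omega

/-! ### certificate checker -/

/-- certificate trees: branch on an edge, five vertices spanning too few edges, a cycle -/
inductive CT where
  | b (k : ℕ) (t e : CT)
  | s (a b c d e : ℕ)
  | c (X Y : List ℕ)

def has (P i j : ℕ) : Bool := (Nat.blt i 10 && Nat.blt j 10) && (P.testBit (i * 10 + j) || P.testBit (j * 10 + i))

def ins (P k : ℕ) : ℕ := P ||| (1 <<< k)

def cnt (N i j : ℕ) : ℕ := if has N i j then 1 else 0

/-- evaluates its argument before passing it on -/
def force (P : ℕ) (f : ℕ → Bool) : Bool := Nat.rec (f 0) (fun k _ => f (k + 1)) P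

theorem force_eq (P : ℕ) (f : ℕ → Bool) : force P f = f P := by cases P <;> rfl

def check (n : ℕ) (lf : ℕ → List ℕ → List ℕ → Bool) : CT → ℕ → ℕ → Bool
  | .b k t e, P, N => force (ins P k) (fun P' => check n lf t P' N) &&
      force (ins N k) (fun N' => check n lf e P N')
  | .s a b c d e, _, N => (Nat.blt a b && Nat.blt b c && Nat.blt c d && Nat.blt d e && Nat.blt e n) &&
      Nat.ble 8 (cnt N a b + cnt N a c + cnt N a d + cnt N a e + cnt N b c + cnt N b d + cnt N b e
        + cnt N c d + cnt N c e + cnt N d e)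
  | .c X Y, P, _ => lf P X Y

/-- all edges coded in `P` satisfy `Q` -/
def Kn (Q : V → V → Prop) (f : ℕ → V) (P : ℕ) : Prop := ∀ k, P.testBit k = true → Q (f (k / 10)) (f (k % 10))

theorem Kn.zero (Q : V → V → Prop) (f : ℕ → V) : Kn Q f 0 := by
  intro k hk; simp at hk

theorem Kn.ins {Q : V → V → Prop} {f : ℕ → V} {P : ℕ} (h : Kn Q f P) (k : ℕ)
    (hk : Q (f (k / 10)) (f (k % 10))) : Kn Q f (ins P k) := by
  intro j hj
  unfold StmtFour.ins at hj
  rw [Nat.testBit_or, Bool.or_eq_true] at hj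
  rcases hj with hj | hj
  · exact h j hj
  · rw [Nat.one_shiftLeft, Nat.testBit_two_pow] at hj
    have : k = j := by simpa using hj
    subst this; exact hk

theorem Kn.has {Q : V → V → Prop} (hQ : ∀ x y, Q x y → Q y x) {f : ℕ → V} {P : ℕ} (h : Kn Q f P)
    {i j : ℕ} (hh : has P i j = true) : Q (f i) (f j) := by
  unfold StmtFour.has at hh
  simp only [Bool.and_eq_true, Bool.or_eq_true, Nat.blt_eq] at hh
  obtain ⟨⟨hi, hj⟩, h1 | h1⟩ := hh
  · have := h _ h1
    rwa [show (i * 10 + j) / 10 = i by omega, show (i * 10 + j) % 10 = j by omega] at this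
  · have := h _ h1
    rw [show (j * 10 + i) / 10 = j by omega, show (j * 10 + i) % 10 = i by omega] at this
    exact hQ _ _ this

theorem check_sound (G : SimpleGraph V) (h5 : FiveI G) (n : ℕ) (f : ℕ → V)
    (hf : ∀ i j, i < n → j < n → f i = f j → i = j) (lf : ℕ → List ℕ → List ℕ → Bool) (Goal : Prop)
    (hlf : ∀ P X Y, Kn G.Adj f P → lf P X Y = true → Goal) (t : CT) :
    ∀ P N, Kn G.Adj f P → Kn (fun x y => ¬ G.Adj x y) f N → check n lf t P N = true → Goal := by
  induction t with
  | b k t e iht ihe =>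
    intro P N hP hN hc
    simp only [check, force_eq, Bool.and_eq_true] at hc
    by_cases hk : G.Adj (f (k / 10)) (f (k % 10))
    · exact iht _ _ (hP.ins k hk) hN hc.1
    · exact ihe _ _ hP (hN.ins k hk) hc.2
  | s a b c d e =>
    intro P N hP hN hc
    simp only [check, Bool.and_eq_true, Nat.blt_eq, Nat.ble_eq] at hc
    obtain ⟨⟨⟨⟨⟨h1, h2⟩, h3⟩, h4⟩, h6⟩, hc⟩ := hc
    exfalso
    have hne : ∀ i j, i < j → j < n → f i ≠ f j := fun i j hij hj he => by
      have := hf i j (by omega) hj he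
      omega
    have hnd : [f a, f b, f c, f d, f e].Nodup := by
      simp only [List.nodup_cons, List.mem_cons, List.not_mem_nil, or_false, not_or,
        not_false_eq_true, List.nodup_nil, and_true]
      refine ⟨⟨?_, ?_, ?_, ?_⟩, ⟨?_, ?_, ?_⟩, ⟨?_, ?_⟩, ?_⟩ <;> apply hne <;> omega
    have := h5 _ _ _ _ _ hnd
    have hcnt : ∀ i j, cnt N i j + ind G (f i) (f j) ≤ 1 := by
      intro i j
      unfold cnt ind
      by_cases hh : has N i j = true
      · have := hN.has (fun x y h h' => h (SimpleGraph.Adj.symm h')) hh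
        simp [this]
        split <;> simp
      · simp [hh]
        split <;> simp
    have := hcnt a b; have := hcnt a c; have := hcnt a d; have := hcnt a e; have := hcnt b c
    have := hcnt b d; have := hcnt b e; have := hcnt c d; have := hcnt c e; have := hcnt d e
    omega
  | c X Y =>
    intro P N hP hN hc
    exact hlf P X Y hP hc

/-- boolean version of `Pth` -/
def pthb (P : ℕ) : ℕ → List ℕ → ℕ → Bool
  | u, [], v => has P u v
  | u, w :: l, v => has P u w && pthb P w l v

theorem pthb_sound {G : SimpleGraph V} {f : ℕ → V} {P : ℕ} (hP : Kn G.Adj f P) (l : List ℕ) :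
    ∀ u v, pthb P u l v = true → Pth G (f u) (l.map f) (f v) := by
  induction l with
  | nil => intro u v h; exact hP.has (fun _ _ h => SimpleGraph.Adj.symm h) h
  | cons w l ih =>
    intro u v h
    simp only [pthb, Bool.and_eq_true] at h
    exact ⟨hP.has (fun _ _ h => SimpleGraph.Adj.symm h) h.1, ih _ _ h.2⟩

/-- walk to the vertex 9 -/
def endb (P : ℕ) : ℕ → List ℕ → Bool
  | u, [] => Nat.beq u 9
  | u, w :: l => has P u w && endb P w l

theorem endb_sound {G : SimpleGraph V} {f : ℕ → V} {P : ℕ} (hP : Kn G.Adj f P) (rest : List V) (v : V)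
    (hr : Pth G (f 9) rest v) (l : List ℕ) :
    ∀ u, endb P u l = true → Pth G (f u) (l.map f ++ rest) v := by
  induction l with
  | nil =>
    intro u h
    have : u = 9 := by simpa [endb] using h
    subst this; simpa using hr
  | cons w l ih =>
    intro u h
    simp only [endb, Bool.and_eq_true] at h
    exact ⟨hP.has (fun _ _ h => SimpleGraph.Adj.symm h) h.1, ih _ h.2⟩

/-- distinct entries below `n` -/
def ndb (n : ℕ) : List ℕ → Bool
  | [] => true
  | a :: l => Nat.blt a n && l.all (fun b => !(Nat.beq a b)) && ndb n l

theorem ndb_sound (n : ℕ) (f : ℕ → V) (hf : ∀ i j, i < n → j < n → f i = f j → i = j) (l : List ℕ)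
    (h : ndb n l = true) : (l.map f).Nodup ∧ ∀ i ∈ l, i < n := by
  induction l with
  | nil => simp
  | cons a l ih =>
    simp only [ndb, Bool.and_eq_true, Nat.blt_eq, List.all_eq_true] at h
    obtain ⟨⟨h1, h2⟩, h3⟩ := h
    obtain ⟨i1, i2⟩ := ih h3
    refine ⟨?_, ?_⟩
    · rw [List.map_cons, List.nodup_cons]
      refine ⟨?_, i1⟩
      intro hm
      obtain ⟨b, hb, hab⟩ := List.mem_map.1 hm
      have := hf b a (i2 b hb) h1 hab
      subst this
      have := h2 b hb
      simp at this
    · intro i hi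
      rcases List.mem_cons.1 hi with rfl | hi
      · exact h1
      · exact i2 i hi

/-- leaf check for good cycles of length `q` -/
def lfc (q : ℕ) (P : ℕ) (X _Y : List ℕ) : Bool :=
  match X with
  | a :: b :: c :: T => has P a b && has P b c && has P a c && pthb P c T a &&
      ndb 9 (a :: b :: c :: T) && Nat.beq (T.length + 3) q
  | _ => false

theorem lfc_sound (G : SimpleGraph V) (f : ℕ → V) (hf : ∀ i j, i < 9 → j < 9 → f i = f j → i = j)
    (q : ℕ) (P : ℕ) (X Y : List ℕ) (hP : Kn G.Adj f P) (h : lfc q P X Y = true) : GoodCyc G q := by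
  have hs : ∀ x y, G.Adj x y → G.Adj y x := fun _ _ h => SimpleGraph.Adj.symm h
  unfold lfc at h
  split at h
  · rename_i a b c T
    simp only [Bool.and_eq_true] at h
    obtain ⟨⟨⟨⟨⟨h1, h2⟩, h3⟩, h4⟩, h5⟩, h6⟩ := h
    refine ⟨f a, f b, f c, T.map f, hP.has hs h1, hP.has hs h2, hP.has hs h3, pthb_sound hP _ _ _ h4,
      ?_, ?_⟩
    · simpa using (ndb_sound 9 f hf _ h5).1
    · simpa using h6
  · simp at h

/-- leaf check for windows of ten consecutive vertices -/
def lfw (P : ℕ) (X Y : List ℕ) : Bool :=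
  match X with
  | a :: b :: c :: T => has P a b && has P b c && has P a c && endb P c T &&
      ndb 10 (a :: b :: c :: T ++ Y) && Nat.beq (T.length + Y.length) 7 &&
      (match Y with
        | [] => Nat.beq a 0
        | y :: Y' => Nat.beq y 0 && pthb P 0 Y' a)
  | _ => false

theorem lfw_sound (G : SimpleGraph V) (f : ℕ → V) (hf : ∀ i j, i < 10 → j < 10 → f i = f j → i = j)
    (rest : List V) (hrest : Pth G (f 9) rest (f 0)) (hnr : rest.Nodup)
    (hd : ∀ i, i < 10 → f i ∉ rest) (P : ℕ) (X Y : List ℕ) (hP : Kn G.Adj f P)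
    (h : lfw P X Y = true) : GoodCyc G (rest.length + 10) := by
  have hs : ∀ x y, G.Adj x y → G.Adj y x := fun _ _ h => SimpleGraph.Adj.symm h
  unfold lfw at h
  split at h
  · rename_i a b c T
    simp only [Bool.and_eq_true] at h
    obtain ⟨⟨⟨⟨⟨⟨h1, h2⟩, h3⟩, h4⟩, h5⟩, h6⟩, h7⟩ := h
    obtain ⟨n1, n2⟩ := ndb_sound 10 f hf _ h5
    have hend := endb_sound hP rest (f 0) hrest T c h4
    have hlen : T.length + Y.length = 7 := by simpa using h6
    refine ⟨f a, f b, f c, T.map f ++ rest ++ Y.map f, hP.has hs h1, hP.has hs h2, hP.has hs h3, ?_,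
      ?_, ?_⟩
    · cases Y with
      | nil =>
        have : a = 0 := by simpa using h7
        subst this
        simpa using hend
      | cons y Y' =>
        simp only [Bool.and_eq_true] at h7
        have : y = 0 := by simpa using h7.1
        subst this
        rw [List.map_cons, pth_append]
        exact ⟨hend, pthb_sound hP _ _ _ h7.2⟩
    · have hp : (f a :: f b :: f c :: (T.map f ++ rest ++ Y.map f)).Perm
          ((a :: b :: c :: T ++ Y).map f ++ rest) := by
        simp only [List.cons_append, List.map_cons, List.map_append, List.append_assoc]
        refine ((((List.Perm.append_left _ List.perm_append_comm).cons _).cons _).cons _)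
      rw [hp.nodup_iff, List.nodup_append]
      refine ⟨n1, hnr, ?_⟩
      rintro x hx y hy rfl
      obtain ⟨i, hi, rfl⟩ := List.mem_map.1 hx
      exact hd i (n2 i hi) hy
    · simp; omega
  · simp at h

def cert_cyc5 : CT :=
  .b 2 (.b 14 (.c [1,0,2,3,4] []) (.b 17 (.c [1,2,0,8,7] []) (.b 4 (.c [0,1,2,3,4] []) (.b 27 (.c
  [2,1,0,8,7] []) (.b 38 (.c [0,1,2,3,8] []) (.b 5 (.b 6 (.c [6,5,0,8,7] []) (.b 58 (.c
  [8,0,5,6,7] []) (.b 57 (.c [5,6,7,8,0] []) (.b 7 (.c [0,8,7,6,5] []) (.b 68 (.c [6,7,8,0,5] [])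
  (.b 3 (.c [3,2,0,5,4] []) (.b 16 (.c [1,2,0,5,6] []) (.b 35 (.c [5,4,3,2,0] []) (.b 24 (.c
  [2,3,4,5,0] []) (.b 26 (.c [0,1,2,6,5] []) (.b 46 (.b 25 (.c [5,6,4,3,2] []) (.b 37 (.c
  [4,5,6,7,3] []) (.b 28 (.b 13 (.c [2,3,1,0,8] []) (.b 15 (.c [2,8,0,5,1] []) (.s 0 1 3 5 7)))
  (.s 2 3 5 7 8)))) (.b 47 (.b 48 (.c [7,8,4,5,6] []) (.b 37 (.c [4,3,7,6,5] []) (.b 18 (.b 28 (.b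
  13 (.c [2,3,1,0,8] []) (.b 15 (.c [8,2,1,5,0] []) (.s 0 1 3 5 7))) (.s 0 2 4 6 8)) (.s 0 1 4 6
  8)))) (.s 0 1 4 6 7))))))))))))) (.b 37 (.b 47 (.c [4,3,7,6,5] []) (.b 57 (.c [7,6,5,4,3] [])
  (.b 7 (.c [0,1,2,3,7] []) (.b 15 (.b 25 (.c [2,1,5,4,3] []) (.b 24 (.c [2,3,4,5,1] []) (.s 0 2 4
  5 7))) (.s 0 1 4 5 7))))) (.b 18 (.b 3 (.c [0,8,1,2,3] []) (.b 6 (.c [0,1,8,7,6] []) (.b 16 (.c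
  [1,0,8,7,6] []) (.b 7 (.c [8,7,0,2,1] []) (.b 13 (.c [0,8,1,3,2] []) (.b 47 (.b 36 (.b 57 (.c
  [6,7,5,4,3] []) (.b 35 (.c [4,3,5,6,7] []) (.s 0 1 3 5 7))) (.s 0 1 3 6 7)) (.s 0 1 3 4 7)))))))
  (.b 15 (.b 35 (.c [5,4,3,2,1] []) (.b 13 (.c [1,2,3,4,5] []) (.b 58 (.c [1,2,0,8,5] []) (.b 57
  (.b 36 (.c [6,7,5,4,3] []) (.b 48 (.c [5,6,7,8,4] []) (.b 47 (.b 68 (.c [7,8,6,5,4] []) (.b 16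
  (.c [7,4,5,1,6] []) (.s 1 3 4 6 8))) (.s 1 3 4 7 8)))) (.s 1 3 5 7 8))))) (.b 24 (.b 36 (.c
  [3,2,4,5,6] []) (.b 3 (.c [3,4,2,1,0] []) (.b 13 (.c [1,0,2,4,3] []) (.b 48 (.c [2,1,0,8,4] [])
  (.b 47 (.b 68 (.c [7,8,6,5,4] []) (.b 35 (.c [4,3,5,6,7] []) (.b 58 (.b 46 (.c [5,4,6,7,8] [])
  (.s 1 3 4 6 8)) (.s 0 1 3 5 8)))) (.s 1 3 4 7 8)))))) (.b 25 (.b 26 (.c [5,6,2,3,4] []) (.b 46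
  (.c [5,6,4,3,2] []) (.b 13 (.c [2,1,3,4,5] []) (.b 3 (.c [3,0,2,5,4] []) (.b 16 (.c [1,0,2,5,6]
  []) (.b 58 (.c [2,1,0,8,5] []) (.b 35 (.b 47 (.c [4,3,5,6,7] []) (.s 1 2 4 6 7)) (.s 0 1 3 5
  8)))))))) (.b 47 (.b 48 (.c [7,8,4,5,6] []) (.b 68 (.c [7,8,6,5,4] []) (.b 35 (.c [4,3,5,6,7]
  []) (.b 13 (.b 28 (.c [2,3,1,0,8] []) (.b 58 (.b 46 (.c [5,4,6,7,8] []) (.b 16 (.b 26 (.b 6 (.c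
  [0,1,6,7,8] []) (.b 36 (.c [3,2,6,5,4] []) (.b 3 (.c [0,3,2,6,1] []) (.s 0 3 4 6 8)))) (.s 1 2 4
  6 8)) (.s 1 2 4 6 8))) (.s 1 2 4 5 8))) (.b 57 (.b 58 (.b 46 (.c [5,4,6,7,8] []) (.b 36 (.c
  [6,7,5,4,3] []) (.s 1 3 4 6 8))) (.s 1 3 4 5 8)) (.s 1 2 3 5 7)))))) (.b 57 (.b 48 (.c
  [5,6,7,8,4] []) (.b 28 (.b 13 (.c [2,3,1,0,8] []) (.s 1 3 4 7 8)) (.s 1 2 4 7 8))) (.s 1 2 4 5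
  7)))))))))))))) (.b 5 (.b 6 (.c [6,5,0,8,7] []) (.b 58 (.c [8,0,5,6,7] []) (.b 57 (.c
  [5,6,7,8,0] []) (.b 7 (.c [0,8,7,6,5] []) (.b 68 (.c [6,7,8,0,5] []) (.b 25 (.b 26 (.c
  [5,6,2,3,4] []) (.b 46 (.c [5,6,4,3,2] []) (.b 4 (.c [5,4,0,1,2] []) (.b 24 (.c [5,4,2,1,0] [])
  (.b 27 (.b 28 (.c [8,7,2,1,0] []) (.s 0 2 4 6 8)) (.s 0 2 4 6 7)))))) (.b 15 (.b 14 (.c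
  [4,5,1,2,3] []) (.b 35 (.c [5,4,3,2,1] []) (.b 24 (.c [2,3,4,5,1] []) (.b 3 (.c [0,1,5,4,3] [])
  (.b 26 (.c [1,0,5,6,2] []) (.b 48 (.c [0,1,5,4,8] []) (.b 4 (.b 16 (.c [5,4,0,1,6] []) (.b 46
  (.c [5,6,4,0,1] []) (.b 18 (.c [0,8,1,5,4] []) (.s 1 2 4 6 8)))) (.b 28 (.b 46 (.b 27 (.c
  [8,7,2,1,0] []) (.b 37 (.c [4,5,6,7,3] []) (.s 0 2 3 5 7))) (.s 0 2 4 6 8)) (.s 0 2 4 6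
  8))))))))) (.b 4 (.b 14 (.c [1,0,4,3,2] []) (.b 3 (.c [3,4,0,1,2] []) (.b 24 (.c [4,3,2,1,0] [])
  (.b 13 (.c [1,2,3,4,0] []) (.b 47 (.c [4,5,0,8,7] []) (.b 16 (.c [5,4,0,1,6] []) (.b 38 (.c
  [4,5,0,8,3] []) (.b 18 (.b 27 (.c [8,0,1,2,7] []) (.b 48 (.c [0,1,8,4,5] []) (.b 17 (.b 28 (.b
  26 (.c [7,8,1,2,6] []) (.b 37 (.c [2,1,8,7,3] []) (.b 36 (.b 46 (.c [6,3,4,0,5] []) (.s 0 2 4 6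
  7)) (.s 0 2 3 6 7)))) (.s 2 4 5 7 8)) (.s 1 2 4 5 7)))) (.b 36 (.b 35 (.c [3,6,5,0,4] []) (.s 1
  3 5 6 8)) (.s 0 1 3 6 8)))))))))) (.b 35 (.b 14 (.c [4,5,3,2,1] []) (.b 47 (.c [4,3,5,6,7] [])
  (.b 37 (.c [3,4,5,6,7] []) (.b 26 (.c [5,4,3,2,6] []) (.b 13 (.c [3,2,1,0,5] []) (.b 3 (.b 24
  (.c [3,4,2,1,0] []) (.b 46 (.c [5,6,4,3,0] []) (.b 16 (.c [0,3,5,6,1] []) (.s 0 1 2 4 6)))) (.b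
  17 (.b 27 (.c [1,2,7,8,0] []) (.b 24 (.b 36 (.c [3,2,4,5,6] []) (.s 0 2 3 6 7)) (.s 0 2 3 4 7)))
  (.s 0 1 3 4 7)))))))) (.b 3 (.b 38 (.c [0,8,3,2,1] []) (.b 18 (.c [0,8,1,2,3] []) (.b 13 (.c
  [0,1,3,4,5] []) (.b 16 (.b 17 (.c [7,6,1,0,8] []) (.s 1 3 5 7 8)) (.s 1 3 5 6 8))))) (.b 27 (.b
  28 (.c [8,7,2,1,0] []) (.b 17 (.c [1,2,7,8,0] []) (.b 18 (.c [8,0,1,2,7] []) (.b 13 (.b 38 (.c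
  [3,2,1,0,8] []) (.b 36 (.c [2,1,3,6,7] []) (.b 16 (.c [2,3,1,6,7] []) (.s 1 3 5 6 8)))) (.b 37
  (.b 38 (.b 36 (.c [6,7,3,4,5] []) (.b 46 (.c [4,5,6,7,3] []) (.b 26 (.c [7,6,2,3,8] []) (.b 24
  (.c [3,4,2,7,8] []) (.s 0 2 3 4 6))))) (.s 1 2 3 5 8)) (.s 0 1 3 5 7)))))) (.b 37 (.b 47 (.c
  [4,3,7,6,5] []) (.b 46 (.c [4,5,6,7,3] []) (.b 24 (.b 26 (.c [2,3,4,5,6] []) (.s 0 2 4 6 7)) (.s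
  0 2 4 5 7)))) (.s 0 2 3 5 7))))))))))))) (.b 13 (.b 25 (.c [2,1,3,4,5] []) (.b 28 (.c
  [2,3,1,0,8] []) (.b 15 (.c [1,2,3,4,5] []) (.b 38 (.c [3,2,1,0,8] []) (.b 4 (.c [1,2,3,4,0] [])
  (.b 24 (.b 36 (.c [3,2,4,5,6] []) (.b 3 (.c [3,4,2,1,0] []) (.b 26 (.c [2,3,4,5,6] []) (.b 35
  (.c [4,5,3,1,2] []) (.b 6 (.b 58 (.b 57 (.c [6,5,7,8,0] []) (.b 7 (.c [8,0,7,6,5] []) (.b 27 (.b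
  37 (.b 17 (.c [1,2,7,8,0] []) (.b 47 (.c [4,3,7,6,5] []) (.b 14 (.c [1,4,3,7,2] []) (.s 0 1 4 5
  7)))) (.s 0 2 3 5 7)) (.s 0 2 3 5 7)))) (.s 0 2 3 5 8)) (.s 0 2 3 5 6)))))) (.b 48 (.b 47 (.c
  [7,8,4,5,6] []) (.b 57 (.c [5,6,7,8,4] []) (.b 7 (.b 27 (.c [7,8,0,1,2] []) (.s 0 2 4 5 7)) (.s
  0 2 4 5 7)))) (.b 58 (.b 46 (.c [5,4,6,7,8] []) (.b 7 (.c [8,0,7,6,5] []) (.b 6 (.b 57 (.c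
  [6,5,7,8,0] []) (.b 26 (.c [2,3,1,0,6] []) (.b 47 (.b 68 (.c [7,8,6,5,4] []) (.s 0 2 4 6 8)) (.s
  0 2 4 5 7)))) (.b 26 (.b 68 (.b 47 (.c [7,8,6,5,4] []) (.b 27 (.c [8,5,6,2,7] []) (.s 0 2 4 5
  7))) (.s 0 2 4 6 8)) (.s 0 2 4 5 6))))) (.s 0 2 4 5 8))))))))) (.b 16 (.b 17 (.c [7,6,1,0,8] [])
  (.b 6 (.c [0,1,6,7,8] []) (.b 68 (.c [6,7,8,0,1] []) (.b 18 (.c [1,0,8,7,6] []) (.b 7 (.c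
  [7,8,0,1,6] []) (.b 14 (.b 15 (.c [4,5,1,2,3] []) (.b 4 (.c [1,0,4,3,2] []) (.b 35 (.c
  [4,5,3,2,1] []) (.b 24 (.c [1,2,4,5,6] []) (.b 57 (.c [6,7,5,4,1] []) (.b 3 (.b 37 (.b 47 (.c
  [4,3,7,6,5] []) (.b 27 (.c [3,2,7,8,0] []) (.s 0 2 4 5 7))) (.s 0 1 3 5 7)) (.s 0 1 3 5 7)))))))
  (.b 15 (.b 25 (.c [2,1,5,4,3] []) (.b 24 (.c [2,3,4,5,1] []) (.b 27 (.c [6,5,1,2,7] []) (.b 4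
  (.c [5,6,1,0,4] []) (.b 47 (.b 57 (.c [7,4,5,1,6] []) (.s 0 2 4 5 7)) (.s 0 1 2 4 7)))))) (.b 24
  (.b 36 (.c [3,2,4,5,6] []) (.b 3 (.c [3,4,2,1,0] []) (.b 26 (.c [2,3,4,5,6] []) (.b 4 (.c
  [4,3,2,1,0] []) (.b 25 (.c [5,4,2,1,6] []) (.b 35 (.b 47 (.c [4,3,5,6,7] []) (.b 37 (.c
  [3,4,5,6,7] []) (.s 0 1 3 4 7))) (.s 0 2 3 5 6))))))) (.b 25 (.b 35 (.c [2,3,5,6,1] []) (.b 57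
  (.c [6,7,5,2,1] []) (.b 3 (.b 37 (.b 47 (.c [4,3,7,6,5] []) (.b 4 (.c [3,4,0,1,2] []) (.b 27 (.c
  [3,2,7,8,0] []) (.s 0 1 2 4 7)))) (.s 0 1 3 5 7)) (.s 0 1 3 5 7)))) (.b 27 (.b 37 (.c
  [2,3,7,6,1] []) (.b 57 (.c [6,5,7,2,1] []) (.b 3 (.b 35 (.b 4 (.c [3,4,0,1,2] []) (.b 47 (.c
  [4,3,5,6,7] []) (.s 0 1 4 5 7))) (.s 0 1 3 5 7)) (.s 0 1 3 5 7)))) (.b 57 (.b 36 (.c [6,7,5,4,3]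
  []) (.b 37 (.c [7,6,5,4,3] []) (.b 48 (.c [5,6,7,8,4] []) (.b 3 (.b 38 (.c [0,8,3,2,1] []) (.b 4
  (.c [3,4,0,1,2] []) (.b 47 (.b 46 (.b 58 (.c [5,4,6,7,8] []) (.b 35 (.c [4,3,5,6,7] []) (.s 1 3
  4 5 8))) (.s 1 3 4 6 8)) (.s 0 1 2 4 7)))) (.b 35 (.b 26 (.c [5,4,3,2,6] []) (.s 0 2 3 6 7)) (.s
  0 1 3 5 7)))))) (.s 0 1 2 5 7)))))))))))) (.b 24 (.b 36 (.c [3,2,4,5,6] []) (.b 3 (.c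
  [3,4,2,1,0] []) (.b 26 (.c [2,3,4,5,6] []) (.b 4 (.c [4,3,2,1,0] []) (.b 15 (.c [2,3,4,5,1] [])
  (.b 35 (.b 14 (.c [4,5,3,2,1] []) (.b 47 (.c [4,3,5,6,7] []) (.b 37 (.c [3,4,5,6,7] []) (.b 46
  (.c [5,6,4,2,3] []) (.b 6 (.b 17 (.b 68 (.c [7,6,8,0,1] []) (.b 18 (.c [0,1,8,7,6] []) (.b 38
  (.b 48 (.b 58 (.c [5,4,8,7,6] []) (.b 28 (.c [2,3,8,0,1] []) (.b 25 (.c [5,2,3,8,4] []) (.s 1 2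
  5 6 8)))) (.s 1 3 4 6 8)) (.s 1 3 4 6 8)))) (.s 1 3 4 6 7)) (.s 0 1 3 4 6)))))) (.b 6 (.b 57 (.c
  [6,5,7,8,0] []) (.b 18 (.c [0,1,8,7,6] []) (.b 7 (.b 58 (.c [8,0,7,6,5] []) (.b 38 (.b 68 (.b 17
  (.c [7,6,8,0,1] []) (.b 37 (.c [6,0,8,3,7] []) (.s 0 1 3 5 7))) (.s 1 3 5 6 8)) (.s 0 1 3 5 8)))
  (.b 17 (.b 37 (.c [3,4,2,1,7] []) (.s 0 1 3 5 7)) (.s 0 1 3 5 7))))) (.s 0 1 3 5 6)))))))) (.b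
  35 (.b 14 (.c [4,5,3,2,1] []) (.b 47 (.c [4,3,5,6,7] []) (.b 15 (.c [5,4,3,2,1] []) (.b 37 (.c
  [3,4,5,6,7] []) (.b 26 (.c [5,4,3,2,6] []) (.b 3 (.b 38 (.c [0,8,3,2,1] []) (.b 4 (.c
  [3,4,0,1,2] []) (.b 18 (.c [0,8,1,2,3] []) (.b 25 (.c [2,5,3,0,1] []) (.b 48 (.c [4,5,3,0,8] [])
  (.b 6 (.c [3,4,5,6,0] []) (.b 46 (.b 17 (.b 27 (.c [1,2,7,8,0] []) (.b 7 (.c [1,7,0,3,2] []) (.b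
  57 (.c [6,7,5,3,4] []) (.s 0 2 4 5 7)))) (.s 1 3 4 7 8)) (.s 0 1 2 4 6)))))))) (.b 27 (.b 17 (.c
  [1,2,7,8,0] []) (.b 7 (.c [7,8,0,1,2] []) (.b 57 (.c [5,4,3,2,7] []) (.s 0 1 3 5 7)))) (.b 7 (.b
  28 (.c [8,7,0,1,2] []) (.b 46 (.b 25 (.c [5,6,4,3,2] []) (.b 57 (.c [6,7,5,3,4] []) (.b 4 (.c
  [4,5,6,7,0] []) (.s 0 2 4 5 7)))) (.b 17 (.b 68 (.c [7,6,8,0,1] []) (.b 18 (.b 48 (.b 6 (.c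
  [0,1,8,7,6] []) (.b 4 (.c [7,1,0,4,8] []) (.s 0 1 2 4 6))) (.s 1 2 4 6 8)) (.s 1 2 4 6 8))) (.s
  1 2 4 6 7)))) (.b 4 (.b 6 (.c [4,3,5,6,0] []) (.b 36 (.b 46 (.b 25 (.c [5,6,4,3,2] []) (.b 57
  (.c [6,7,5,4,3] []) (.s 0 2 3 5 7))) (.s 0 2 4 6 7)) (.s 0 2 3 6 7))) (.s 0 2 3 4 7))))))))))
  (.b 46 (.b 58 (.c [5,4,6,7,8] []) (.b 25 (.c [5,6,4,3,2] []) (.b 48 (.c [4,5,6,7,8] []) (.b 37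
  (.c [4,5,6,7,3] []) (.b 4 (.b 3 (.c [3,4,0,1,2] []) (.b 15 (.c [5,6,4,0,1] []) (.b 7 (.c
  [4,5,6,7,0] []) (.b 17 (.b 27 (.c [1,2,7,8,0] []) (.s 0 2 3 5 7)) (.s 0 1 3 5 7))))) (.b 28 (.b
  27 (.c [8,7,2,1,0] []) (.b 38 (.c [2,3,8,0,1] []) (.b 7 (.c [8,7,0,1,2] []) (.b 3 (.b 57 (.b 47
  (.b 36 (.c [6,7,5,4,3] []) (.b 68 (.c [7,8,6,5,4] []) (.b 18 (.c [0,8,1,2,3] []) (.s 1 3 5 6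
  8)))) (.s 0 2 4 5 7)) (.s 0 2 3 5 7)) (.s 0 2 3 5 7))))) (.s 0 2 4 5 8))))))) (.b 18 (.b 3 (.c
  [0,8,1,2,3] []) (.b 6 (.c [0,1,8,7,6] []) (.b 27 (.c [8,0,1,2,7] []) (.b 15 (.b 14 (.c
  [4,5,1,2,3] []) (.b 25 (.c [2,1,5,4,3] []) (.b 4 (.c [0,8,1,5,4] []) (.b 57 (.c [5,6,7,8,1] [])
  (.b 36 (.b 37 (.c [6,7,3,4,5] []) (.s 0 2 3 5 7)) (.s 0 1 3 4 6)))))) (.b 36 (.b 37 (.c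
  [6,7,3,4,5] []) (.b 26 (.c [3,2,6,5,4] []) (.b 57 (.c [6,7,5,4,3] []) (.b 7 (.b 17 (.b 68 (.c
  [7,6,8,0,1] []) (.b 28 (.c [8,7,0,1,2] []) (.b 4 (.b 48 (.c [7,1,0,4,8] []) (.s 0 2 4 6 8)) (.s
  0 2 4 6 8)))) (.s 0 1 3 5 7)) (.s 0 1 3 5 7))))) (.s 0 1 3 5 6)))))) (.b 48 (.b 58 (.c
  [5,4,8,7,6] []) (.b 47 (.c [7,8,4,5,6] []) (.b 68 (.c [8,7,6,5,4] []) (.b 57 (.c [5,6,7,8,4] [])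
  (.b 15 (.b 25 (.c [2,1,5,4,3] []) (.b 4 (.c [0,8,4,5,1] []) (.b 7 (.b 27 (.c [7,8,0,1,2] []) (.s
  0 2 4 5 7)) (.s 0 2 4 5 7)))) (.b 36 (.b 38 (.c [3,4,8,7,6] []) (.s 1 3 5 6 8)) (.s 1 3 5 6
  8))))))) (.b 7 (.b 28 (.c [8,7,0,1,2] []) (.b 58 (.c [8,0,7,6,5] []) (.b 27 (.c [7,8,0,1,2] [])
  (.b 4 (.b 14 (.c [1,0,4,3,2] []) (.b 3 (.c [3,4,0,1,2] []) (.b 57 (.c [7,6,5,4,0] []) (.b 37 (.c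
  [7,8,0,4,3] []) (.b 25 (.b 26 (.c [5,6,2,3,4] []) (.s 1 2 4 6 8)) (.s 0 2 3 5 7)))))) (.b 25 (.b
  26 (.c [5,6,2,3,4] []) (.b 15 (.c [2,1,5,4,3] []) (.b 6 (.b 68 (.b 57 (.c [6,5,7,8,0] []) (.b 17
  (.c [7,6,8,0,1] []) (.b 37 (.b 38 (.c [6,0,8,3,7] []) (.s 1 3 5 7 8)) (.s 1 3 5 7 8)))) (.s 0 2
  4 6 8)) (.s 0 2 4 6 8)))) (.s 0 2 4 5 8)))))) (.b 36 (.b 37 (.c [6,7,3,4,5] []) (.b 26 (.c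
  [3,2,6,5,4] []) (.b 57 (.c [6,7,5,4,3] []) (.b 3 (.b 4 (.c [3,4,0,1,2] []) (.b 6 (.c [6,3,0,8,7]
  []) (.b 68 (.c [6,7,8,0,3] []) (.s 0 2 4 6 8)))) (.b 15 (.b 25 (.c [2,1,5,4,3] []) (.s 0 2 3 5
  7)) (.s 0 1 3 5 7)))))) (.b 14 (.b 15 (.c [4,5,1,2,3] []) (.b 4 (.c [1,0,4,3,2] []) (.b 3 (.b 38
  (.c [0,8,3,2,1] []) (.b 68 (.b 58 (.b 17 (.c [7,6,8,0,1] []) (.b 47 (.c [7,8,6,5,4] []) (.b 37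
  (.c [7,6,8,0,3] []) (.b 57 (.b 6 (.c [6,5,7,8,0] []) (.b 26 (.b 27 (.c [5,8,7,2,6] []) (.s 0 2 4
  6 7)) (.s 0 2 4 6 7))) (.s 0 1 3 5 7))))) (.s 1 3 5 6 8)) (.s 1 3 4 6 8))) (.b 6 (.b 57 (.c
  [6,5,7,8,0] []) (.b 17 (.b 37 (.b 27 (.c [1,2,7,8,0] []) (.b 47 (.c [4,3,7,6,5] []) (.s 0 2 4 5
  7))) (.s 0 1 3 5 7)) (.s 0 1 3 5 7))) (.s 0 1 3 5 6))))) (.b 38 (.b 68 (.b 17 (.c [7,6,8,0,1]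
  []) (.b 47 (.c [7,8,6,5,4] []) (.b 27 (.c [7,6,8,3,2] []) (.b 26 (.c [6,7,8,3,2] []) (.s 1 2 4 6
  7))))) (.s 1 3 4 6 8)) (.s 1 3 4 6 8)))))))))))))

def cert_cyc7 : CT :=
  .b 2 (.b 6 (.c [0,1,2,3,4,5,6] []) (.b 25 (.c [2,1,0,8,7,6,5] []) (.b 16 (.c [1,0,2,3,4,5,6] [])
  (.b 15 (.c [1,2,0,8,7,6,5] []) (.b 36 (.c [0,1,2,3,6,7,8] []) (.b 58 (.c [2,1,0,8,5,4,3] []) (.b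
  47 (.c [0,1,2,3,4,7,8] []) (.b 3 (.b 38 (.c [8,0,3,4,5,6,7] []) (.b 4 (.c [4,3,0,8,7,6,5] [])
  (.b 35 (.c [3,4,5,6,7,8,0] []) (.b 7 (.c [0,8,7,6,5,4,3] []) (.b 68 (.c [6,7,8,0,3,4,5] []) (.b
  57 (.c [5,6,7,8,0,3,4] []) (.b 13 (.b 18 (.b 17 (.c [1,2,3,4,5,6,7] []) (.b 14 (.c
  [1,0,8,7,6,5,4] []) (.b 5 (.c [0,8,1,2,3,4,5] []) (.s 0 1 4 5 7)))) (.s 1 3 5 6 8)) (.s 1 3 5 6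
  8)))))))) (.b 4 (.b 14 (.c [0,1,4,5,6,7,8] []) (.b 35 (.c [4,3,5,6,7,8,0] []) (.b 18 (.c
  [0,1,8,7,6,5,4] []) (.b 28 (.c [0,2,8,7,6,5,4] []) (.b 24 (.c [0,2,4,5,6,7,8] []) (.b 48 (.b 26
  (.c [4,8,0,1,2,6,5] []) (.b 68 (.b 27 (.c [7,8,6,5,4,3,2] []) (.b 46 (.c [6,5,4,3,2,0,8] []) (.b
  17 (.b 13 (.c [1,2,3,4,5,6,7] []) (.b 5 (.b 38 (.c [4,8,3,2,1,0,5] []) (.s 1 2 3 5 8)) (.s 0 1 3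
  5 6))) (.s 1 2 4 6 7)))) (.s 1 2 5 6 8))) (.s 1 2 4 5 8))))))) (.b 7 (.b 14 (.c [7,8,0,1,4,5,6]
  []) (.b 57 (.c [0,1,2,3,4,5,7] []) (.b 24 (.c [0,8,7,6,5,4,2] []) (.b 46 (.c [0,1,2,3,4,6,7] [])
  (.b 27 (.c [2,0,7,6,5,4,3] []) (.b 13 (.b 17 (.c [1,2,3,4,5,6,7] []) (.s 1 2 4 5 7)) (.s 0 1 3 4
  6))))))) (.b 46 (.b 14 (.c [4,5,6,7,8,0,1] []) (.b 5 (.c [5,6,4,3,2,1,0] []) (.b 17 (.c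
  [4,5,6,7,1,2,3] []) (.b 28 (.c [4,5,6,7,8,2,3] []) (.b 68 (.c [6,5,4,3,2,0,8] []) (.b 57 (.b 26
  (.c [6,5,7,8,0,1,2] []) (.b 35 (.c [5,6,7,8,0,2,3] []) (.b 13 (.b 18 (.c [1,2,3,4,5,7,8] []) (.s
  1 2 5 6 8)) (.s 0 1 3 5 6)))) (.s 0 1 4 5 7))))))) (.b 37 (.b 68 (.c [7,6,8,0,1,2,3] []) (.b 24
  (.c [3,4,2,1,0,8,7] []) (.b 13 (.b 26 (.c [2,3,1,0,8,7,6] []) (.b 27 (.c [2,1,3,4,5,6,7] []) (.s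
  0 2 4 6 7))) (.b 14 (.b 18 (.c [1,0,8,7,6,5,4] []) (.b 38 (.b 35 (.b 28 (.c [3,2,8,7,6,5,4] [])
  (.b 48 (.c [4,5,3,2,1,0,8] []) (.b 26 (.c [7,3,8,0,1,2,6] []) (.s 0 2 4 6 8)))) (.s 1 3 5 6 8))
  (.s 0 1 3 6 8))) (.s 0 1 3 4 6))))) (.s 0 3 4 6 7))))))))))))) (.b 3 (.b 38 (.c [8,0,3,4,5,6,7]
  []) (.b 4 (.c [4,3,0,8,7,6,5] []) (.b 35 (.c [3,4,5,6,7,8,0] []) (.b 7 (.c [0,8,7,6,5,4,3] [])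
  (.b 46 (.c [6,5,4,3,0,8,7] []) (.b 68 (.c [6,7,8,0,3,4,5] []) (.b 57 (.c [5,6,7,8,0,3,4] []) (.b
  13 (.b 26 (.c [2,3,1,0,8,7,6] []) (.b 27 (.c [2,1,3,4,5,6,7] []) (.b 47 (.c [1,2,3,4,7,8,0] [])
  (.b 6 (.c [3,2,1,0,6,5,4] []) (.s 0 2 4 6 7))))) (.b 18 (.b 14 (.c [1,0,8,7,6,5,4] []) (.b 5 (.c
  [0,8,1,2,3,4,5] []) (.b 25 (.c [8,0,1,2,5,6,7] []) (.b 47 (.c [1,0,8,7,4,3,2] []) (.b 24 (.b 27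
  (.b 17 (.c [2,1,7,6,5,4,3] []) (.b 37 (.c [3,4,2,1,0,8,7] []) (.b 6 (.c [2,3,4,5,6,0,1] []) (.b
  15 (.b 16 (.c [6,1,5,4,3,2,7] []) (.s 0 1 4 6 7)) (.s 0 1 3 5 7))))) (.s 0 2 4 5 7)) (.s 0 2 4 5
  7)))))) (.b 24 (.b 37 (.c [3,4,2,1,0,8,7] []) (.b 58 (.c [2,3,4,5,8,0,1] []) (.b 17 (.c
  [4,3,2,1,7,6,5] []) (.s 1 3 5 7 8)))) (.b 5 (.b 6 (.c [5,6,0,1,2,3,4] []) (.b 58 (.c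
  [0,8,5,4,3,2,1] []) (.b 15 (.b 48 (.c [0,5,1,2,3,4,8] []) (.b 26 (.c [1,5,0,8,7,6,2] []) (.s 0 2
  4 6 8))) (.b 36 (.b 37 (.c [7,6,3,2,1,0,8] []) (.s 1 3 5 7 8)) (.s 1 3 5 6 8))))) (.b 25 (.b 26
  (.c [6,5,2,1,0,8,7] []) (.b 15 (.c [1,2,5,6,7,8,0] []) (.b 6 (.b 16 (.c [1,0,6,5,4,3,2] []) (.b
  36 (.c [3,6,0,1,2,5,4] []) (.s 1 3 5 6 8))) (.b 47 (.b 48 (.c [8,7,4,3,2,1,0] []) (.s 0 2 4 6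
  8)) (.s 0 2 4 6 7))))) (.b 27 (.b 47 (.b 37 (.c [3,4,7,8,0,1,2] []) (.b 48 (.c [8,7,4,3,2,1,0]
  []) (.b 28 (.c [7,8,2,3,4,5,6] []) (.b 17 (.c [2,1,7,6,5,4,3] []) (.b 15 (.b 26 (.c
  [6,2,7,8,0,1,5] []) (.s 0 2 4 6 8)) (.s 0 1 3 5 7)))))) (.s 0 2 4 5 7)) (.s 0 2 4 5
  7)))))))))))))) (.b 13 (.b 36 (.c [3,2,1,0,8,7,6] []) (.b 17 (.c [1,2,3,4,5,6,7] []) (.b 26 (.c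
  [2,3,1,0,8,7,6] []) (.b 27 (.c [2,1,3,4,5,6,7] []) (.b 47 (.c [1,2,3,4,7,8,0] []) (.b 6 (.c
  [3,2,1,0,6,5,4] []) (.b 58 (.c [1,2,3,4,5,8,0] []) (.b 7 (.b 48 (.c [8,7,0,1,2,3,4] []) (.b 38
  (.c [8,0,7,6,5,4,3] []) (.b 14 (.c [7,8,0,1,4,5,6] []) (.b 25 (.c [7,8,0,1,2,5,6] []) (.b 35 (.c
  [3,4,5,6,7,0,1] []) (.b 57 (.c [7,6,5,4,3,1,0] []) (.b 46 (.c [0,8,7,6,4,3,1] []) (.b 5 (.b 18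
  (.c [0,8,1,2,3,4,5] []) (.b 15 (.b 37 (.c [5,0,1,2,3,7,6] []) (.b 28 (.b 24 (.c [2,3,4,5,6,7,8]
  []) (.b 4 (.b 16 (.c [5,0,4,3,2,1,6] []) (.s 1 2 4 6 7)) (.s 0 2 3 4 6))) (.s 2 3 5 7 8))) (.s 1
  4 5 7 8))) (.s 0 2 3 5 6))))))))) (.b 37 (.b 68 (.c [7,6,8,0,1,2,3] []) (.b 24 (.c
  [3,4,2,1,0,8,7] []) (.b 4 (.b 46 (.b 28 (.c [4,5,6,7,8,2,3] []) (.b 38 (.c [8,3,7,6,5,4,0] [])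
  (.s 0 2 3 6 8))) (.s 0 2 4 6 7)) (.s 0 2 4 6 7)))) (.s 0 2 3 6 7)))))))))) (.b 14 (.b 4 (.c
  [0,1,4,5,6,7,8] []) (.b 15 (.c [5,4,1,0,8,7,6] []) (.b 46 (.c [4,5,6,7,8,0,1] []) (.b 57 (.c
  [7,6,5,4,1,0,8] []) (.b 7 (.c [7,8,0,1,4,5,6] []) (.b 68 (.c [6,7,8,0,1,4,5] []) (.b 6 (.b 5 (.c
  [5,6,0,1,2,3,4] []) (.b 35 (.c [3,4,5,6,0,1,2] []) (.b 24 (.c [2,3,4,5,6,0,1] []) (.b 17 (.b 37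
  (.b 47 (.c [3,4,7,8,0,1,2] []) (.b 27 (.c [2,1,7,6,5,4,3] []) (.s 0 2 4 5 7))) (.s 0 1 3 5 7))
  (.s 0 1 3 5 7))))) (.b 17 (.b 27 (.c [2,1,7,6,5,4,3] []) (.b 24 (.c [4,3,2,1,7,6,5] []) (.b 35
  (.c [5,4,3,2,1,7,6] []) (.b 26 (.b 47 (.b 37 (.c [3,4,7,8,0,1,2] []) (.b 25 (.c [6,5,2,1,0,8,7]
  []) (.s 0 2 3 5 7))) (.s 0 2 4 6 7)) (.s 0 2 4 6 7))))) (.b 35 (.b 48 (.c [4,5,3,2,1,0,8] [])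
  (.b 28 (.c [5,4,3,2,8,7,6] []) (.b 24 (.b 26 (.c [2,4,1,0,8,7,6] []) (.s 0 2 4 6 8)) (.s 0 2 4 6
  8)))) (.b 5 (.b 37 (.b 47 (.c [3,4,7,8,0,1,2] []) (.b 24 (.c [3,4,2,1,0,8,7] []) (.b 27 (.c
  [7,2,3,4,5,0,8] []) (.s 0 2 4 6 7)))) (.s 0 1 3 5 7)) (.s 0 1 3 5 7))))))))))) (.b 24 (.b 47 (.c
  [4,3,2,1,0,8,7] []) (.b 28 (.c [2,3,4,5,6,7,8] []) (.b 37 (.c [3,4,2,1,0,8,7] []) (.b 38 (.c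
  [3,2,4,5,6,7,8] []) (.b 58 (.c [2,3,4,5,8,0,1] []) (.b 17 (.c [4,3,2,1,7,6,5] []) (.b 6 (.c
  [2,3,4,5,6,0,1] []) (.b 4 (.b 35 (.c [4,3,5,6,7,8,0] []) (.b 18 (.c [0,1,8,7,6,5,4] []) (.b 25
  (.c [4,2,5,6,7,8,0] []) (.b 15 (.b 48 (.c [0,4,8,7,6,5,1] []) (.s 1 3 4 7 8)) (.s 1 2 3 5 8)))))
  (.b 7 (.b 48 (.c [8,7,0,1,2,3,4] []) (.b 36 (.c [0,8,7,6,3,2,1] []) (.b 46 (.c [4,3,2,1,0,7,6]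
  []) (.b 68 (.b 18 (.c [8,7,6,5,4,2,1] []) (.s 1 3 4 7 8)) (.s 0 3 4 6 8))))) (.s 0 1 3 4
  7)))))))))) (.b 18 (.b 58 (.c [8,0,1,2,3,4,5] []) (.b 5 (.c [0,8,1,2,3,4,5] []) (.b 4 (.c
  [0,1,8,7,6,5,4] []) (.b 25 (.c [8,0,1,2,5,6,7] []) (.b 47 (.c [1,0,8,7,4,3,2] []) (.b 7 (.b 48
  (.c [8,7,0,1,2,3,4] []) (.b 28 (.b 27 (.c [7,8,2,3,4,5,6] []) (.b 57 (.c [5,6,7,8,2,3,4] []) (.s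
  0 2 4 5 7))) (.s 0 2 4 5 8))) (.b 27 (.b 28 (.c [7,8,2,3,4,5,6] []) (.b 17 (.c [2,1,7,6,5,4,3]
  []) (.b 37 (.b 48 (.c [3,7,2,1,0,8,4] []) (.s 0 2 4 5 8)) (.s 0 1 3 4 7)))) (.s 0 2 4 5
  7)))))))) (.b 28 (.b 27 (.c [7,8,2,3,4,5,6] []) (.b 38 (.c [3,2,8,7,6,5,4] []) (.b 68 (.c
  [8,7,6,5,4,3,2] []) (.b 35 (.c [5,4,3,2,8,7,6] []) (.b 57 (.c [5,6,7,8,2,3,4] []) (.b 46 (.c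
  [4,5,6,7,8,2,3] []) (.b 36 (.b 37 (.c [7,6,3,2,1,0,8] []) (.b 7 (.c [0,8,7,6,3,2,1] []) (.b 5
  (.b 25 (.b 58 (.c [0,8,5,4,3,2,1] []) (.b 15 (.c [1,2,5,6,7,8,0] []) (.s 1 3 5 7 8))) (.s 0 2 3
  5 7)) (.s 0 2 3 5 7)))) (.b 16 (.b 48 (.b 47 (.c [8,7,4,3,2,1,0] []) (.b 6 (.c [1,0,6,5,4,3,2]
  []) (.b 7 (.c [8,7,0,1,2,3,4] []) (.b 26 (.c [6,1,2,3,4,8,7] []) (.s 0 2 4 6 7))))) (.s 1 3 4 6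
  8)) (.s 1 3 4 6 8))))))))) (.b 7 (.b 47 (.c [7,8,0,1,2,3,4] []) (.b 48 (.c [8,7,0,1,2,3,4] [])
  (.b 38 (.c [8,0,7,6,5,4,3] []) (.b 36 (.c [0,8,7,6,3,2,1] []) (.b 16 (.b 17 (.c [6,7,1,2,3,4,5]
  []) (.b 27 (.b 37 (.c [2,7,3,4,5,6,1] []) (.s 1 3 4 7 8)) (.s 1 2 4 7 8))) (.b 46 (.b 68 (.b 27
  (.c [7,8,6,5,4,3,2] []) (.b 17 (.c [4,5,6,7,1,2,3] []) (.s 1 2 4 7 8))) (.s 1 3 4 6 8)) (.s 1 3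
  4 6 8))))))) (.b 17 (.b 16 (.c [6,7,1,2,3,4,5] []) (.b 27 (.c [2,1,7,6,5,4,3] []) (.b 57 (.c
  [7,6,5,4,3,2,1] []) (.b 46 (.c [4,5,6,7,1,2,3] []) (.b 35 (.c [5,4,3,2,1,7,6] []) (.b 25 (.b 26
  (.c [6,5,2,1,0,8,7] []) (.b 68 (.c [8,7,6,5,2,1,0] []) (.s 1 2 4 6 8))) (.b 5 (.b 37 (.b 36 (.c
  [7,6,3,2,1,0,8] []) (.b 58 (.c [0,8,5,4,3,2,1] []) (.b 68 (.c [7,6,8,0,1,2,3] []) (.b 15 (.c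
  [5,0,1,2,3,7,6] []) (.s 1 3 5 6 8))))) (.s 0 2 3 5 7)) (.s 0 2 3 5 7)))))))) (.b 6 (.b 5 (.c
  [5,6,0,1,2,3,4] []) (.b 16 (.c [1,0,6,5,4,3,2] []) (.b 46 (.c [6,5,4,3,2,1,0] []) (.b 35 (.c
  [3,4,5,6,0,1,2] []) (.b 26 (.b 25 (.c [6,5,2,1,0,8,7] []) (.b 57 (.c [6,5,7,8,0,1,2] []) (.b 15
  (.b 27 (.c [6,2,7,8,0,1,5] []) (.s 0 2 3 5 7)) (.s 0 1 3 5 7)))) (.b 48 (.b 68 (.c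
  [8,6,0,1,2,3,4] []) (.s 1 2 4 6 8)) (.s 1 2 4 6 8))))))) (.b 68 (.b 36 (.c [6,7,8,0,1,2,3] [])
  (.b 37 (.c [7,6,8,0,1,2,3] []) (.b 27 (.c [7,8,6,5,4,3,2] []) (.b 25 (.c [8,7,6,5,2,1,0] []) (.b
  16 (.b 26 (.b 57 (.c [6,7,5,4,3,2,1] []) (.b 5 (.c [1,6,2,3,4,5,0] []) (.s 0 2 3 5 7))) (.s 0 2
  3 6 7)) (.s 0 1 3 6 7)))))) (.b 35 (.b 48 (.c [4,5,3,2,1,0,8] []) (.b 4 (.c [4,3,5,6,7,8,0] [])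
  (.b 26 (.b 46 (.b 5 (.c [5,6,4,3,2,1,0] []) (.b 15 (.c [5,4,6,7,8,0,1] []) (.b 57 (.c
  [6,5,7,8,0,1,2] []) (.b 47 (.c [6,4,7,8,0,1,2] []) (.s 0 1 4 5 7))))) (.s 0 2 4 6 8)) (.s 0 2 4
  6 8)))) (.b 25 (.b 26 (.c [6,5,2,1,0,8,7] []) (.b 15 (.c [1,2,5,6,7,8,0] []) (.b 57 (.c
  [5,6,7,8,0,1,2] []) (.b 5 (.b 37 (.b 47 (.c [3,4,7,8,0,1,2] []) (.b 46 (.c [5,6,4,3,2,1,0] [])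
  (.b 27 (.c [7,2,3,4,5,0,8] []) (.s 0 2 4 6 7)))) (.s 0 1 3 5 7)) (.s 0 1 3 5 7))))) (.b 46 (.b 5
  (.c [5,6,4,3,2,1,0] []) (.b 15 (.c [5,4,6,7,8,0,1] []) (.b 37 (.b 57 (.b 36 (.c [7,6,3,2,1,0,8]
  []) (.b 16 (.c [6,7,5,4,3,2,1] []) (.s 0 1 3 5 6))) (.s 0 1 3 5 7)) (.s 0 1 3 5 7)))) (.b 26 (.b
  36 (.c [2,3,6,7,8,0,1] []) (.b 57 (.c [6,5,7,8,0,1,2] []) (.b 4 (.b 27 (.c [2,6,7,8,0,4,3] [])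
  (.b 48 (.c [4,8,0,1,2,6,5] []) (.b 37 (.b 47 (.c [3,4,7,8,0,1,2] []) (.s 1 2 4 7 8)) (.s 0 2 3 5
  7)))) (.b 16 (.b 48 (.c [6,1,2,3,4,8,7] []) (.s 0 2 4 6 8)) (.s 0 1 3 4 6))))) (.b 4 (.b 48 (.b
  16 (.b 57 (.c [6,7,5,4,3,2,1] []) (.b 15 (.c [0,4,8,7,6,5,1] []) (.b 5 (.c [5,0,4,3,2,1,6] [])
  (.b 37 (.c [8,4,0,1,2,3,7] []) (.s 0 1 3 5 7))))) (.s 1 2 4 6 8)) (.s 0 2 4 6 8)) (.s 0 2 4 6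
  8))))))))))))))))

def cert_cyc9 : CT :=
  .b 13 (.c [3,2,1,0,8,7,6,5,4] []) (.b 68 (.c [6,7,8,0,1,2,3,4,5] []) (.b 24 (.c
  [4,3,2,1,0,8,7,6,5] []) (.b 7 (.c [7,8,0,1,2,3,4,5,6] []) (.b 35 (.c [5,4,3,2,1,0,8,7,6] []) (.b
  18 (.c [8,0,1,2,3,4,5,6,7] []) (.b 46 (.c [6,5,4,3,2,1,0,8,7] []) (.b 2 (.c [0,1,2,3,4,5,6,7,8]
  []) (.b 57 (.c [7,6,5,4,3,2,1,0,8] []) (.b 3 (.b 4 (.b 15 (.c [3,4,0,8,7,6,5,1,2] []) (.b 28 (.c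
  [0,3,4,5,6,7,8,2,1] []) (.b 5 (.b 16 (.c [0,5,4,3,2,1,6,7,8] []) (.b 38 (.c [0,4,5,6,7,8,3,2,1]
  []) (.b 36 (.b 58 (.b 14 (.c [4,0,1,2,3,6,7,8,5] []) (.b 48 (.c [5,4,8,7,6,3,2,1,0] []) (.s 1 2
  4 6 8))) (.s 1 3 5 6 8)) (.s 1 3 5 6 8)))) (.b 17 (.b 58 (.c [0,4,3,2,1,7,6,5,8] []) (.b 38 (.c
  [0,8,3,2,1,7,6,5,4] []) (.b 25 (.b 36 (.b 37 (.c [3,6,7,8,0,1,2,5,4] []) (.s 1 3 5 7 8)) (.s 1 3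
  5 6 8)) (.s 1 2 3 5 8)))) (.b 37 (.b 38 (.c [3,8,7,6,5,4,0,1,2] []) (.b 48 (.c
  [4,8,0,1,2,3,7,6,5] []) (.b 58 (.b 6 (.b 16 (.c [6,0,1,2,3,4,5,8,7] []) (.b 14 (.b 36 (.c
  [4,0,1,2,3,6,7,8,5] []) (.s 1 3 4 6 8)) (.s 1 2 4 6 8))) (.b 26 (.b 16 (.c [6,2,1,0,8,7,3,4,5]
  []) (.b 36 (.c [6,7,3,4,5,8,0,1,2] []) (.s 1 3 4 6 8))) (.s 0 2 4 6 8))) (.s 1 3 5 7 8)))) (.s 0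
  1 3 5 7)))))) (.b 14 (.b 15 (.c [1,4,5,6,7,8,0,3,2] []) (.b 38 (.c [3,0,8,7,6,5,4,1,2] []) (.b
  58 (.b 5 (.b 16 (.c [8,0,5,4,3,2,1,6,7] []) (.b 36 (.c [5,0,8,7,6,3,2,1,4] []) (.s 1 3 5 6 8)))
  (.b 17 (.b 47 (.c [7,4,1,2,3,0,8,5,6] []) (.b 25 (.b 27 (.b 26 (.c [2,5,6,7,8,0,1,4,3] []) (.b 6
  (.c [7,1,2,3,4,5,6,0,8] []) (.s 0 2 4 6 7))) (.s 0 2 4 5 7)) (.s 0 2 4 5 7))) (.b 37 (.b 48 (.c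
  [5,4,8,0,1,2,3,7,6] []) (.b 47 (.c [7,4,3,2,1,0,8,5,6] []) (.b 25 (.b 27 (.b 26 (.c
  [5,6,2,1,0,8,7,3,4] []) (.b 28 (.c [2,8,7,6,5,4,3,0,1] []) (.s 0 2 4 6 8))) (.s 0 2 4 5 7)) (.s
  0 2 4 5 7)))) (.s 0 1 3 5 7)))) (.b 16 (.b 36 (.b 17 (.b 37 (.b 5 (.c [7,6,1,2,3,4,5,0,8] [])
  (.b 25 (.c [3,6,7,8,0,1,2,5,4] []) (.b 27 (.c [7,2,3,4,5,6,1,0,8] []) (.s 0 2 4 5 7)))) (.s 1 3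
  5 7 8)) (.s 1 3 5 7 8)) (.s 1 3 5 6 8)) (.s 1 3 5 6 8))))) (.b 27 (.b 38 (.c [0,8,3,4,5,6,7,2,1]
  []) (.b 28 (.c [2,8,7,6,5,4,3,0,1] []) (.b 6 (.b 16 (.c [0,1,6,5,4,3,2,7,8] []) (.b 17 (.c
  [7,1,2,3,4,5,6,0,8] []) (.b 26 (.b 48 (.b 36 (.b 5 (.c [6,5,0,1,2,3,4,8,7] []) (.b 37 (.c
  [6,7,3,2,1,0,8,4,5] []) (.b 15 (.c [3,2,6,7,8,0,1,5,4] []) (.s 0 1 3 5 7)))) (.s 1 3 4 6 8)) (.s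
  1 2 4 6 8)) (.s 1 2 4 6 8)))) (.b 26 (.b 48 (.b 15 (.c [2,6,7,8,0,1,5,4,3] []) (.b 37 (.c
  [7,3,2,1,0,8,4,5,6] []) (.b 17 (.c [2,1,7,8,0,3,4,5,6] []) (.s 1 3 5 7 8)))) (.s 0 2 4 6 8)) (.s
  0 2 4 6 8))))) (.b 5 (.b 6 (.b 48 (.c [6,5,0,1,2,3,4,8,7] []) (.b 17 (.c [0,6,5,4,3,2,1,7,8] [])
  (.b 47 (.b 58 (.c [5,8,0,1,2,3,4,7,6] []) (.b 16 (.c [6,5,0,8,7,4,3,2,1] []) (.b 15 (.c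
  [5,6,0,8,7,4,3,2,1] []) (.s 1 4 5 6 8)))) (.s 0 1 2 4 7)))) (.b 26 (.b 47 (.b 48 (.c
  [7,8,4,3,2,1,0,5,6] []) (.b 16 (.c [6,1,2,3,4,5,0,8,7] []) (.s 0 1 4 6 8))) (.s 0 2 4 6 7)) (.s
  0 2 4 6 7))) (.b 25 (.b 47 (.b 38 (.c [3,8,0,1,2,5,6,7,4] []) (.b 48 (.c [4,8,7,6,5,2,1,0,3] [])
  (.b 16 (.b 36 (.b 37 (.c [3,6,7,8,0,1,2,5,4] []) (.b 15 (.c [5,2,1,0,8,7,6,3,4] []) (.b 17 (.c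
  [1,6,7,8,0,3,4,5,2] []) (.s 0 1 3 5 7)))) (.s 1 3 4 6 8)) (.s 1 3 4 6 8)))) (.s 0 2 4 5 7)) (.s
  0 2 4 5 7)))))) (.b 4 (.b 16 (.b 5 (.c [0,5,4,3,2,1,6,7,8] []) (.b 15 (.c [1,5,6,7,8,0,4,3,2]
  []) (.b 17 (.b 37 (.b 28 (.c [1,7,6,5,4,3,2,8,0] []) (.b 38 (.c [3,8,7,6,5,4,0,1,2] []) (.b 48
  (.c [4,8,0,1,2,3,7,6,5] []) (.b 26 (.c [6,2,1,0,8,7,3,4,5] []) (.b 27 (.c [7,2,3,4,5,6,1,0,8]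
  []) (.b 25 (.b 36 (.c [3,6,7,8,0,1,2,5,4] []) (.s 2 3 4 6 8)) (.s 0 2 3 5 7))))))) (.s 0 1 3 5
  7)) (.s 0 1 3 5 7)))) (.b 37 (.b 38 (.c [3,8,7,6,5,4,0,1,2] []) (.b 48 (.c [4,8,0,1,2,3,7,6,5]
  []) (.b 14 (.b 36 (.b 25 (.c [3,6,7,8,0,1,2,5,4] []) (.b 28 (.c [3,7,6,5,4,1,0,8,2] []) (.b 58
  (.c [4,0,1,2,3,6,7,8,5] []) (.b 15 (.c [4,5,1,2,3,6,7,8,0] []) (.s 1 2 3 5 8))))) (.s 1 3 4 6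
  8)) (.s 1 3 4 6 8)))) (.b 15 (.b 25 (.c [2,1,5,6,7,8,0,4,3] []) (.b 48 (.c [4,0,8,7,6,5,1,2,3]
  []) (.b 5 (.b 27 (.b 38 (.c [0,4,5,6,7,8,3,2,1] []) (.b 26 (.c [2,6,7,8,0,1,5,4,3] []) (.b 14
  (.b 28 (.b 36 (.c [2,7,8,0,1,4,5,6,3] []) (.s 1 3 4 6 8)) (.s 1 2 4 6 8)) (.s 1 2 4 6 8)))) (.s
  0 2 3 5 7)) (.s 0 2 3 5 7)))) (.b 5 (.b 17 (.b 38 (.c [0,4,5,6,7,8,3,2,1] []) (.b 58 (.c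
  [0,8,5,6,7,1,2,3,4] []) (.s 1 3 5 6 8))) (.s 0 1 3 5 7)) (.s 0 1 3 5 7))))) (.b 5 (.b 15 (.b 26
  (.c [5,1,0,8,7,6,2,3,4] []) (.b 48 (.c [5,0,1,2,3,4,8,7,6] []) (.b 6 (.b 28 (.b 14 (.c
  [0,5,6,7,8,2,3,4,1] []) (.b 16 (.c [0,1,6,7,8,2,3,4,5] []) (.s 1 2 4 6 8))) (.s 0 2 4 6 8)) (.s
  0 2 4 6 8)))) (.b 16 (.b 17 (.c [7,6,1,2,3,4,5,0,8] []) (.b 58 (.c [8,0,5,4,3,2,1,6,7] []) (.b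
  26 (.c [6,1,2,3,4,5,0,8,7] []) (.b 37 (.b 38 (.b 27 (.c [7,2,3,4,5,6,1,0,8] []) (.b 48 (.c
  [8,4,3,2,1,0,5,6,7] []) (.b 6 (.b 47 (.b 28 (.c [7,3,4,5,6,0,1,2,8] []) (.s 0 2 4 6 8)) (.s 0 2
  4 6 7)) (.s 0 2 4 6 7)))) (.s 1 3 5 7 8)) (.s 0 1 3 5 7))))) (.b 38 (.b 48 (.c
  [8,4,3,2,1,0,5,6,7] []) (.b 6 (.b 17 (.c [0,6,5,4,3,2,1,7,8] []) (.b 37 (.b 26 (.c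
  [3,7,8,0,1,2,6,5,4] []) (.b 28 (.b 14 (.c [0,5,6,7,8,2,3,4,1] []) (.s 1 2 4 6 8)) (.s 0 2 4 6
  8))) (.s 0 1 3 5 7))) (.b 26 (.b 28 (.b 17 (.c [8,2,3,4,5,6,7,1,0] []) (.b 37 (.c
  [3,7,8,0,1,2,6,5,4] []) (.s 0 1 3 5 7))) (.s 0 2 4 6 8)) (.s 0 2 4 6 8)))) (.b 36 (.b 58 (.b 14
  (.c [5,0,8,7,6,3,2,1,4] []) (.b 48 (.c [5,4,8,7,6,3,2,1,0] []) (.s 1 3 4 6 8))) (.s 1 3 5 6 8))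
  (.s 1 3 5 6 8))))) (.b 25 (.b 37 (.b 26 (.c [5,6,2,1,0,8,7,3,4] []) (.b 36 (.c
  [3,6,7,8,0,1,2,5,4] []) (.b 6 (.b 15 (.b 47 (.c [5,1,2,3,4,7,8,0,6] []) (.b 27 (.b 48 (.c
  [7,3,2,1,0,8,4,5,6] []) (.b 28 (.c [7,8,2,1,0,6,5,4,3] []) (.s 0 2 4 6 8))) (.s 0 2 4 5 7))) (.b
  17 (.b 27 (.c [7,1,2,3,4,5,6,0,8] []) (.b 47 (.b 58 (.c [7,4,3,2,1,0,8,5,6] []) (.b 38 (.c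
  [3,4,7,6,5,2,1,0,8] []) (.s 0 1 3 5 8))) (.s 0 2 4 5 7))) (.s 0 1 3 5 7))) (.s 0 2 3 4 6)))) (.b
  15 (.b 17 (.b 27 (.b 38 (.c [1,2,7,6,5,4,3,8,0] []) (.b 36 (.c [5,2,1,0,8,7,6,3,4] []) (.b 6 (.c
  [7,1,2,3,4,5,6,0,8] []) (.b 16 (.c [1,6,5,4,3,2,7,8,0] []) (.s 0 1 3 6 8))))) (.s 0 2 3 5 7))
  (.s 0 1 3 5 7)) (.s 0 1 3 5 7))) (.b 27 (.b 37 (.b 47 (.b 26 (.c [4,3,7,8,0,1,2,6,5] []) (.b 58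
  (.c [7,4,3,2,1,0,8,5,6] []) (.b 48 (.c [7,3,2,1,0,8,4,5,6] []) (.b 6 (.b 28 (.c
  [7,3,4,5,6,0,1,2,8] []) (.s 0 2 4 5 8)) (.s 0 2 4 5 6))))) (.s 0 2 4 5 7)) (.s 0 2 3 5 7)) (.s 0
  2 3 5 7))))))))))))))

def cert_win10 : CT :=
  .b 2 (.c [0,1,2,3,4,5,6,7,8,9] []) (.b 79 (.c [7,8,9] [0,1,2,3,4,5,6]) (.b 13 (.c
  [1,2,3,4,5,6,7,8,9] [0]) (.b 68 (.c [6,7,8,9] [0,1,2,3,4,5]) (.b 24 (.c [2,3,4,5,6,7,8,9] [0,1])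
  (.b 57 (.c [5,6,7,8,9] [0,1,2,3,4]) (.b 35 (.c [3,4,5,6,7,8,9] [0,1,2]) (.b 46 (.c [4,5,6,7,8,9]
  [0,1,2,3]) (.b 3 (.b 4 (.b 15 (.c [0,4,3,2,1,5,6,7,8,9] []) (.b 28 (.b 19 (.c
  [0,3,4,5,6,7,8,2,1,9] []) (.b 17 (.c [0,3,4,5,6,7,1,2,8,9] []) (.b 37 (.b 39 (.b 59 (.b 49 (.c
  [4,3,9] [0,1,2,8,7,6,5]) (.b 14 (.c [0,1,4,3,2,8,7,6,5,9] []) (.b 69 (.c [5,6,9]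
  [0,1,2,8,7,3,4]) (.b 18 (.c [0,4,3,2,1,8,7,6,5,9] []) (.b 47 (.b 48 (.c [4,8,7,6,5,9] [0,1,2,3])
  (.s 1 4 6 8 9)) (.s 1 4 5 7 9)))))) (.s 1 3 5 7 9)) (.s 1 3 5 7 9)) (.s 1 3 5 7 9)))) (.b 16 (.b
  5 (.c [0,5,4,3,2,1,6,7,8,9] []) (.b 25 (.c [0,3,4,5,2,1,6,7,8,9] []) (.b 27 (.c
  [0,3,4,5,6,1,2,7,8,9] []) (.b 58 (.b 59 (.c [0,4,3,2,1,6,7,8,5,9] []) (.b 7 (.b 29 (.b 17 (.b 26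
  (.c [0,3,4,5,6,2,1,7,8,9] []) (.b 48 (.c [5,4,8,9] [0,3,2,1,7,6]) (.b 8 (.c
  [0,8,7,1,6,5,4,3,2,9] []) (.s 0 2 4 6 8)))) (.b 37 (.b 19 (.b 8 (.c [0,8,7,6,5,4,3,2,1,9] [])
  (.b 48 (.c [5,4,8,9] [0,1,2,3,7,6]) (.b 26 (.c [1,2,6,5,4,3,7,8,9] [0]) (.s 0 2 4 6 8)))) (.s 1
  2 5 7 9)) (.s 1 2 3 5 7))) (.s 0 2 5 7 9)) (.s 0 2 5 7 9))) (.b 7 (.b 8 (.b 19 (.c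
  [0,8,7,6,5,4,3,2,1,9] []) (.b 59 (.c [0,8,7,6,1,2,3,4,5,9] []) (.b 29 (.b 17 (.c
  [0,8,7,1,6,5,4,3,2,9] []) (.s 1 2 5 7 9)) (.s 0 2 5 7 9)))) (.s 0 2 5 7 8)) (.s 0 2 5 7 8))))))
  (.b 18 (.b 29 (.c [0,3,4,5,6,7,8,1,2,9] []) (.b 59 (.c [0,4,3,2,1,8,7,6,5,9] []) (.b 17 (.b 39
  (.c [7,8,1,2,3,9] [0,4,5,6]) (.b 25 (.c [0,4,3,2,5,6,7,1,8,9] []) (.b 19 (.b 37 (.c [1,8,9]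
  [0,4,5,6,7,3,2]) (.s 1 3 5 7 9)) (.s 1 2 3 5 9)))) (.b 19 (.b 37 (.c [1,8,9] [0,4,5,6,7,3,2])
  (.s 1 3 5 7 9)) (.s 1 3 5 7 9))))) (.b 26 (.b 17 (.c [0,3,4,5,6,2,1,7,8,9] []) (.b 37 (.b 38 (.c
  [3,7,8,9] [0,1,2,6,5,4]) (.b 25 (.c [2,6,5,4,3,7,8,9] [0,1]) (.b 14 (.c [0,1,4,5,6,2,3,7,8,9]
  []) (.b 58 (.b 48 (.c [5,4,8,9] [0,1,2,3,7,6]) (.s 1 2 4 6 8)) (.s 1 2 3 5 8))))) (.b 38 (.b 19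
  (.b 39 (.b 27 (.c [3,8,9] [0,1,2,7,6,5,4]) (.b 25 (.c [6,5,2,1,9] [0,4,3,8,7]) (.s 1 2 3 5 7)))
  (.s 1 3 5 7 9)) (.s 1 3 5 7 9)) (.s 1 3 5 7 8)))) (.b 14 (.b 48 (.b 25 (.c [0,1,4,3,2,5,6,7,8,9]
  []) (.b 58 (.b 37 (.c [5,4,8,9] [0,1,2,3,7,6]) (.b 17 (.c [5,4,8,9] [0,3,2,1,7,6]) (.b 27 (.c
  [0,1,4,3,2,7,6,5,8,9] []) (.s 1 2 3 5 7)))) (.s 1 2 5 6 8))) (.s 1 2 4 6 8)) (.s 1 2 4 6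
  8))))))) (.b 5 (.b 6 (.b 17 (.c [0,6,5,4,3,2,1,7,8,9] []) (.b 15 (.b 26 (.c
  [0,1,5,4,3,2,6,7,8,9] []) (.b 47 (.c [0,6,5,1,2,3,4,7,8,9] []) (.b 7 (.b 48 (.c
  [0,7,6,5,1,2,3,4,8,9] []) (.b 8 (.b 28 (.b 19 (.c [0,8,7,6,5,4,3,2,1,9] []) (.b 37 (.c
  [0,6,7,3,4,5,1,2,8,9] []) (.b 39 (.c [0,6,7,8,2,1,5,4,3,9] []) (.s 1 3 5 7 9)))) (.s 0 2 4 6 8))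
  (.s 0 2 4 6 8))) (.b 27 (.b 16 (.c [0,1,6,5,4,3,2,7,8,9] []) (.b 14 (.c [5,1,4,3,2,7,8,9] [0,6])
  (.b 18 (.b 19 (.c [1,8,9] [0,3,4,5,6,7,2]) (.b 49 (.c [0,5,6,7,8,1,2,3,4,9] []) (.s 0 1 4 7 9)))
  (.b 28 (.b 49 (.c [7,8,2,3,4,9] [0,1,5,6]) (.b 19 (.c [7,8,2,3,4,5,1,9] [0,6]) (.s 0 1 4 7 9)))
  (.s 1 2 4 6 8))))) (.s 0 2 4 6 7))))) (.b 19 (.b 18 (.b 7 (.c [1,8,9] [0,7,6,5,4,3,2]) (.b 27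
  (.c [1,8,9] [0,3,4,5,6,7,2]) (.b 47 (.c [1,8,9] [0,5,6,7,4,3,2]) (.b 26 (.c [8,1,9]
  [0,5,4,3,2,6,7]) (.s 0 2 4 6 7))))) (.b 37 (.b 14 (.b 38 (.c [3,7,8,9] [0,6,5,4,1,2]) (.b 36 (.c
  [3,6,7,8,9] [0,5,4,1,2]) (.b 28 (.c [0,5,6,7,8,2,3,4,1,9] []) (.b 16 (.b 58 (.b 48 (.c [5,4,8,9]
  [0,1,2,3,7,6]) (.b 26 (.c [1,2,6,5,4,3,7,8,9] [0]) (.s 0 2 4 6 8))) (.s 1 3 5 6 8)) (.s 1 3 5 6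
  8))))) (.b 58 (.b 48 (.c [5,4,8,9] [0,1,2,3,7,6]) (.b 47 (.c [3,4,7,6,5,8,9] [0,1,2]) (.b 16 (.b
  26 (.c [1,2,6,5,4,3,7,8,9] [0]) (.b 27 (.c [0,1,6,5,4,3,2,7,8,9] []) (.b 7 (.b 8 (.c
  [0,8,7,6,5,4,3,2,1,9] []) (.s 0 2 4 6 8)) (.s 0 1 2 4 7)))) (.s 1 4 6 7 8)))) (.b 38 (.b 26 (.c
  [3,7,8,9] [0,1,2,6,5,4]) (.b 28 (.b 29 (.c [2,1,9] [0,3,4,5,6,7,8]) (.b 69 (.c [8,7,3,4,5,6,9]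
  [0,1,2]) (.b 49 (.b 39 (.c [4,3,9] [0,1,2,8,7,6,5]) (.b 59 (.c [5,4,9] [0,1,2,3,8,7,6]) (.s 1 3
  5 7 9))) (.s 0 2 4 6 9)))) (.b 8 (.b 48 (.b 16 (.b 7 (.c [0,8,7,6,5,4,3,2,1,9] []) (.b 27 (.c
  [0,1,6,5,4,3,2,7,8,9] []) (.b 47 (.c [7,8,4,3,2,1,9] [0,5,6]) (.s 0 1 2 4 7)))) (.s 1 2 4 6 8))
  (.s 0 2 4 6 8)) (.s 0 2 4 6 8)))) (.s 1 3 5 7 8)))) (.b 38 (.b 58 (.b 39 (.b 59 (.b 49 (.c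
  [5,4,9] [0,1,2,3,8,7,6]) (.b 47 (.c [5,8,9] [0,1,2,3,4,7,6]) (.b 27 (.c [3,8,9] [0,1,2,7,6,5,4])
  (.b 7 (.b 25 (.c [0,6,7,8,3,4,5,2,1,9] []) (.s 1 2 3 5 7)) (.s 0 2 4 7 9))))) (.s 1 3 5 7 9))
  (.s 1 3 5 7 9)) (.s 1 3 5 7 8)) (.s 1 3 5 7 8)))) (.b 37 (.b 39 (.b 59 (.b 14 (.b 38 (.c
  [3,7,8,9] [0,6,5,4,1,2]) (.b 36 (.c [3,6,7,8,9] [0,5,4,1,2]) (.b 58 (.c [5,8,9] [0,6,7,3,2,1,4])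
  (.b 16 (.b 18 (.b 26 (.c [1,2,6,5,4,3,7,8,9] [0]) (.b 28 (.c [0,1,6,7,8,2,3,4,5,9] []) (.b 48
  (.c [8,4,1,2,3,9] [0,5,6,7]) (.s 0 2 4 6 8)))) (.s 1 3 5 6 8)) (.s 1 3 5 6 8))))) (.b 47 (.b 48
  (.c [4,8,7,6,5,9] [0,1,2,3]) (.b 26 (.c [4,3,7,8,9] [0,1,2,6,5]) (.b 28 (.b 16 (.c
  [0,1,6,7,8,2,3,4,5,9] []) (.b 18 (.c [8,1,2,3,4,5,9] [0,6,7]) (.s 1 2 4 6 8))) (.s 0 2 4 6 8))))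
  (.b 49 (.b 28 (.c [4,3,9] [0,1,2,8,7,6,5]) (.b 48 (.c [4,8,9] [0,1,2,3,7,6,5]) (.b 18 (.c
  [5,4,9] [0,3,2,1,8,7,6]) (.b 26 (.b 16 (.c [1,2,6,5,4,3,7,8,9] [0]) (.s 1 2 4 6 8)) (.s 0 2 4 6
  8))))) (.s 1 4 5 7 9)))) (.s 1 3 5 7 9)) (.s 1 3 5 7 9)) (.s 1 3 5 7 9))))) (.b 15 (.b 26 (.c
  [0,1,5,4,3,2,6,7,8,9] []) (.b 28 (.b 48 (.b 69 (.c [0,1,5,4,3,2,8,7,6,9] []) (.b 29 (.b 49 (.b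
  27 (.c [7,8,2,3,4,9] [0,1,5,6]) (.b 47 (.c [7,8,4,3,2,9] [0,1,5,6]) (.s 0 2 4 6 7))) (.s 0 2 4 6
  9)) (.s 0 2 4 6 9))) (.s 0 2 4 6 8)) (.s 0 2 4 6 8))) (.b 8 (.b 19 (.b 7 (.c
  [0,8,7,6,5,4,3,2,1,9] []) (.b 29 (.c [2,1,9] [0,8,7,6,5,4,3]) (.b 47 (.b 18 (.c [1,8,9]
  [0,5,6,7,4,3,2]) (.b 48 (.c [7,8,4,3,2,1,9] [0,5,6]) (.b 58 (.c [0,8,5,6,7,4,3,2,1,9] []) (.b 26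
  (.b 36 (.c [2,3,6,5,4,7,8,9] [0,1]) (.b 37 (.c [4,3,7,8,9] [0,1,2,6,5]) (.b 16 (.b 17 (.c
  [6,2,1,7,8,9] [0,3,4,5]) (.s 1 3 5 7 8)) (.s 1 3 5 6 8)))) (.s 0 2 4 6 8))))) (.b 26 (.b 27 (.b
  49 (.b 38 (.c [2,7,6,5,4,3,8,9] [0,1]) (.b 18 (.c [1,8,9] [0,3,4,5,6,7,2]) (.b 16 (.b 37 (.c
  [1,2,6,5,4,3,7,8,9] [0]) (.b 17 (.c [6,2,1,7,8,9] [0,3,4,5]) (.b 58 (.c [2,1,6,7,8,5,4,9] [0,3])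
  (.s 1 3 5 7 8)))) (.b 36 (.b 58 (.c [2,3,6,7,8,5,4,9] [0,1]) (.s 1 3 5 6 8)) (.s 1 3 5 6 8)))))
  (.s 0 2 4 7 9)) (.s 0 2 4 6 7)) (.s 0 2 4 6 7))))) (.b 37 (.b 26 (.b 16 (.c [1,2,6,5,4,3,7,8,9]
  [0]) (.b 38 (.c [3,7,8,9] [0,1,2,6,5,4]) (.b 17 (.b 36 (.c [3,6,2,1,7,8,9] [0,5,4]) (.b 18 (.b
  58 (.b 29 (.c [0,1,8,7,6,5,4,3,2,9] []) (.b 49 (.c [0,8,1,2,3,7,6,5,4,9] []) (.b 69 (.c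
  [0,8,5,4,3,2,1,7,6,9] []) (.s 0 2 4 6 9)))) (.s 1 3 5 6 8)) (.s 1 3 5 6 8))) (.b 59 (.b 18 (.c
  [0,1,8,7,6,2,3,4,5,9] []) (.b 58 (.c [5,8,9] [0,1,2,6,7,3,4]) (.s 1 3 5 6 8))) (.s 1 3 5 7
  9))))) (.b 28 (.b 48 (.b 49 (.c [4,8,9] [0,1,2,3,7,6,5]) (.b 27 (.c [2,3,7,6,5,4,8,9] [0,1]) (.b
  47 (.b 69 (.c [7,3,4,5,6,9] [0,1,2,8]) (.s 0 2 4 6 9)) (.s 0 2 4 6 7)))) (.s 0 2 4 6 8)) (.s 0 2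
  4 6 8))) (.b 17 (.b 39 (.b 59 (.b 69 (.c [5,6,9] [0,8,7,1,2,3,4]) (.b 26 (.b 18 (.c
  [0,1,8,7,6,2,3,4,5,9] []) (.b 16 (.c [6,2,1,7,8,9] [0,3,4,5]) (.b 36 (.c [3,6,2,1,7,8,9]
  [0,5,4]) (.b 58 (.b 14 (.c [8,5,9] [0,1,4,3,2,6,7]) (.b 48 (.c [5,4,8,9] [0,3,2,1,7,6]) (.s 0 1
  4 6 8))) (.s 1 3 5 6 8))))) (.b 28 (.b 49 (.c [4,3,9] [0,1,2,8,7,6,5]) (.s 0 2 4 6 9)) (.s 0 2 4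
  6 8)))) (.s 1 3 5 7 9)) (.s 1 3 5 7 9)) (.s 1 3 5 7 9)))) (.b 26 (.b 28 (.b 48 (.b 16 (.b 37 (.c
  [1,2,6,5,4,3,7,8,9] [0]) (.b 17 (.c [1,7,6,5,4,8,9] [0,3,2]) (.b 19 (.b 39 (.b 59 (.b 49 (.c
  [4,3,9] [0,1,2,8,7,6,5]) (.b 69 (.c [6,5,9] [0,1,2,3,4,8,7]) (.b 29 (.c [2,1,9] [0,3,4,5,6,7,8])
  (.s 0 2 4 6 9)))) (.s 1 3 5 7 9)) (.s 1 3 5 7 9)) (.s 1 3 5 7 9)))) (.b 18 (.b 19 (.c [8,1,9]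
  [0,5,4,3,2,6,7]) (.b 17 (.b 7 (.c [0,1,7,6,5,4,3,2,8,9] []) (.b 29 (.c [2,8,9] [0,1,7,6,5,4,3])
  (.b 49 (.c [4,8,9] [0,3,2,1,7,6,5]) (.b 27 (.c [7,1,2,3,4,8,9] [0,5,6]) (.s 0 2 4 7 9))))) (.b
  39 (.b 59 (.b 49 (.c [4,3,9] [0,1,2,8,7,6,5]) (.b 69 (.c [6,5,9] [0,1,2,3,4,8,7]) (.b 14 (.c
  [8,4,1,2,3,9] [0,5,6,7]) (.s 0 1 4 6 9)))) (.s 1 3 5 7 9)) (.s 1 3 5 7 9)))) (.b 14 (.b 25 (.c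
  [2,5,6,7,8,9] [0,1,4,3]) (.b 36 (.c [2,3,6,7,8,9] [0,5,4,1]) (.b 38 (.b 58 (.b 37 (.c [5,4,8,9]
  [0,1,2,3,7,6]) (.b 27 (.c [2,7,6,5,4,3,8,9] [0,1]) (.b 17 (.c [5,4,8,9] [0,3,2,1,7,6]) (.s 1 2 3
  5 7)))) (.s 1 3 5 6 8)) (.s 0 1 3 6 8)))) (.s 0 1 4 6 8)))) (.s 0 2 4 6 8)) (.s 0 2 4 6 8)) (.s
  0 2 4 6 8))))) (.b 6 (.b 16 (.b 27 (.c [0,1,6,5,4,3,2,7,8,9] []) (.b 17 (.b 48 (.c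
  [1,7,6,5,4,8,9] [0,3,2]) (.b 25 (.c [1,6,7,8,9] [0,3,4,5,2]) (.b 26 (.c [6,2,1,7,8,9] [0,3,4,5])
  (.b 7 (.b 28 (.c [0,1,7,6,5,4,3,2,8,9] []) (.s 0 2 4 6 8)) (.s 0 2 4 5 7))))) (.b 26 (.b 37 (.c
  [1,2,6,5,4,3,7,8,9] [0]) (.b 15 (.c [1,2,6,7,8,9] [0,3,4,5]) (.b 7 (.b 25 (.b 19 (.b 39 (.b 59
  (.b 8 (.c [0,8,7,6,5,4,3,2,1,9] []) (.b 18 (.c [1,8,9] [0,7,6,5,4,3,2]) (.b 14 (.c [2,5,6,7,8,9]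
  [0,1,4,3]) (.b 28 (.c [0,1,6,7,8,2,3,4,5,9] []) (.b 48 (.c [2,5,6,7,8,4,3,9] [0,1]) (.s 0 1 2 4
  8)))))) (.s 1 3 5 7 9)) (.s 1 3 5 7 9)) (.s 1 3 5 7 9)) (.s 1 2 3 5 7)) (.s 0 1 3 5 7)))) (.b 28
  (.b 59 (.c [0,1,6,7,8,2,3,4,5,9] []) (.b 19 (.b 29 (.c [2,1,9] [0,3,4,5,6,7,8]) (.b 7 (.b 25 (.b
  8 (.c [0,8,7,6,5,4,3,2,1,9] []) (.b 18 (.c [1,8,9] [0,7,6,5,4,3,2]) (.b 15 (.c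
  [0,6,7,8,2,3,4,5,1,9] []) (.b 38 (.c [0,7,6,1,2,5,4,3,8,9] []) (.b 58 (.b 48 (.b 37 (.c
  [5,4,8,9] [0,1,2,3,7,6]) (.s 1 3 5 7 8)) (.s 0 2 4 6 8)) (.s 0 1 3 5 8)))))) (.s 0 2 5 7 9)) (.s
  0 2 5 7 9))) (.b 15 (.b 37 (.b 47 (.c [3,4,7,8,9] [0,6,5,1,2]) (.b 7 (.c [0,6,7,3,4,5,1,2,8,9]
  []) (.s 0 2 4 5 7))) (.s 1 3 5 7 9)) (.s 1 3 5 7 9)))) (.b 8 (.b 48 (.b 47 (.c [4,7,8,9]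
  [0,3,2,1,6,5]) (.b 7 (.b 19 (.c [0,8,7,6,5,4,3,2,1,9] []) (.b 59 (.c [0,8,7,6,1,2,3,4,5,9] [])
  (.b 15 (.c [0,7,6,5,1,2,3,4,8,9] []) (.s 1 3 5 7 9)))) (.s 0 2 4 5 7))) (.s 0 2 4 6 8)) (.s 0 2
  4 6 8)))))) (.b 7 (.b 18 (.b 19 (.c [1,8,9] [0,7,6,5,4,3,2]) (.b 59 (.c [0,6,7,8,1,2,3,4,5,9]
  []) (.b 17 (.b 28 (.c [0,1,7,6,5,4,3,2,8,9] []) (.b 48 (.b 49 (.c [4,8,9] [0,3,2,1,7,6,5]) (.b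
  15 (.c [0,7,6,5,1,2,3,4,8,9] []) (.b 37 (.b 39 (.b 29 (.c [2,3,9] [0,7,6,5,4,8,1]) (.b 25 (.b 26
  (.c [2,6,5,4,3,7,8,9] [0,1]) (.b 8 (.b 69 (.c [0,8,7,1,2,3,4,5,6,9] []) (.s 0 2 4 6 9)) (.s 0 2
  4 6 8))) (.s 0 2 4 5 9))) (.s 1 3 5 7 9)) (.s 1 3 5 7 9)))) (.b 8 (.b 26 (.b 29 (.c
  [0,1,8,7,6,5,4,3,2,9] []) (.b 25 (.c [5,6,2,1,7,8,9] [0,3,4]) (.b 58 (.b 49 (.b 27 (.c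
  [0,1,8,5,6,7,2,3,4,9] []) (.s 0 2 5 7 9)) (.s 0 2 4 5 9)) (.s 0 2 4 5 8)))) (.s 0 2 4 6 8)) (.s
  0 2 4 6 8)))) (.b 15 (.b 37 (.b 48 (.c [0,7,6,5,1,2,3,4,8,9] []) (.b 47 (.c [3,4,7,8,9]
  [0,6,5,1,2]) (.b 28 (.c [0,6,7,3,4,5,1,2,8,9] []) (.b 26 (.b 27 (.c [2,6,7,8,9] [0,1,5,4,3]) (.b
  25 (.c [2,6,5,4,3,7,8,9] [0,1]) (.s 0 2 4 5 7))) (.s 0 2 4 6 8))))) (.s 1 3 5 7 9)) (.s 1 3 5 7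
  9))))) (.b 8 (.b 19 (.c [0,8,7,6,5,4,3,2,1,9] []) (.b 17 (.b 28 (.c [0,1,7,6,5,4,3,2,8,9] [])
  (.b 69 (.c [0,8,7,1,2,3,4,5,6,9] []) (.b 48 (.b 49 (.c [4,8,9] [0,3,2,1,7,6,5]) (.b 58 (.c
  [5,4,8,9] [0,3,2,1,7,6]) (.b 15 (.c [0,7,6,5,1,2,3,4,8,9] []) (.b 36 (.b 14 (.b 59 (.c
  [0,8,7,6,3,2,1,4,5,9] []) (.s 1 5 6 8 9)) (.s 1 4 6 8 9)) (.s 1 3 5 6 8))))) (.b 26 (.b 14 (.b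
  49 (.b 15 (.c [1,5,4,3,2,6,7,8,9] [0]) (.b 36 (.c [2,3,6,5,4,9] [0,8,7,1]) (.b 59 (.c
  [0,8,7,1,4,3,2,6,5,9] []) (.s 1 3 5 6 9)))) (.s 1 4 6 8 9)) (.s 1 2 4 6 8)) (.s 0 2 4 6 8)))))
  (.b 37 (.b 15 (.b 48 (.c [0,7,6,5,1,2,3,4,8,9] []) (.b 28 (.c [0,6,7,3,4,5,1,2,8,9] []) (.b 26
  (.b 14 (.c [1,5,4,3,2,6,7,8,9] [0]) (.s 1 2 4 6 8)) (.s 0 2 4 6 8)))) (.b 59 (.b 38 (.b 49 (.c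
  [5,4,9] [0,1,2,3,8,7,6]) (.b 26 (.c [3,7,8,9] [0,1,2,6,5,4]) (.b 14 (.c [3,7,8,9] [0,6,5,4,1,2])
  (.b 48 (.b 69 (.c [6,5,9] [0,1,2,3,4,8,7]) (.s 1 2 4 6 9)) (.s 1 2 4 6 8))))) (.b 36 (.b 58 (.b
  48 (.c [5,4,8,9] [0,1,2,3,7,6]) (.b 26 (.c [5,8,9] [0,1,2,6,7,3,4]) (.b 14 (.c
  [0,8,7,6,3,2,1,4,5,9] []) (.s 1 2 4 6 8)))) (.s 1 3 5 6 8)) (.s 1 3 5 6 8))) (.s 1 3 5 7 9)))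
  (.b 15 (.b 39 (.b 48 (.c [0,7,6,5,1,2,3,4,8,9] []) (.b 28 (.c [0,6,7,8,2,1,5,4,3,9] []) (.b 26
  (.b 14 (.c [1,5,4,3,2,6,7,8,9] [0]) (.s 1 2 4 6 8)) (.s 0 2 4 6 8)))) (.s 1 3 5 7 9)) (.s 1 3 5
  7 9))))) (.b 48 (.b 15 (.c [0,7,6,5,1,2,3,4,8,9] []) (.b 58 (.b 37 (.c [5,4,8,9] [0,1,2,3,7,6])
  (.b 17 (.c [5,4,8,9] [0,3,2,1,7,6]) (.b 38 (.b 19 (.b 39 (.b 59 (.b 47 (.c [5,8,9]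
  [0,1,2,3,4,7,6]) (.b 27 (.c [3,8,9] [0,1,2,7,6,5,4]) (.b 25 (.c [0,6,7,8,3,4,5,2,1,9] []) (.s 0
  2 4 5 7)))) (.s 1 3 5 7 9)) (.s 1 3 5 7 9)) (.s 1 3 5 7 9)) (.s 1 3 5 7 8)))) (.b 36 (.b 47 (.c
  [4,7,8,9] [0,1,2,3,6,5]) (.b 17 (.b 28 (.c [0,1,7,6,5,4,3,2,8,9] []) (.b 25 (.c
  [0,6,3,4,5,2,1,7,8,9] []) (.s 0 1 2 5 8))) (.b 37 (.b 27 (.c [2,3,7,6,5,4,8,9] [0,1]) (.b 25 (.c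
  [3,6,7,8,9] [0,1,2,5,4]) (.s 0 2 4 5 7))) (.s 1 3 5 7 8)))) (.s 1 3 5 6 8)))) (.b 14 (.b 26 (.b
  28 (.b 17 (.c [0,1,7,6,5,4,3,2,8,9] []) (.b 15 (.c [1,5,4,3,2,6,7,8,9] [0]) (.b 25 (.c
  [2,5,6,7,8,9] [0,1,4,3]) (.b 58 (.b 59 (.c [8,5,9] [0,1,4,3,2,6,7]) (.b 19 (.b 37 (.b 47 (.c
  [3,4,7,6,5,8,9] [0,1,2]) (.b 27 (.c [8,7,2,3,4,1,9] [0,6,5]) (.s 0 2 4 5 7))) (.s 1 3 5 7 9))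
  (.s 1 3 5 7 9))) (.s 0 2 4 5 8))))) (.s 0 2 4 6 8)) (.s 0 2 4 6 8)) (.s 0 1 4 6 8))))) (.b 25
  (.b 36 (.b 15 (.c [1,2,5,4,3,6,7,8,9] [0]) (.b 37 (.c [3,6,7,8,9] [0,1,2,5,4]) (.b 17 (.c
  [0,6,3,4,5,2,1,7,8,9] []) (.s 0 1 3 5 7)))) (.b 26 (.b 14 (.c [2,5,6,7,8,9] [0,1,4,3]) (.b 37
  (.c [2,6,5,4,3,7,8,9] [0,1]) (.b 17 (.c [5,6,2,1,7,8,9] [0,3,4]) (.b 15 (.b 47 (.b 27 (.c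
  [2,6,7,8,9] [0,1,5,4,3]) (.b 29 (.b 48 (.c [7,8,4,3,2,9] [0,1,5,6]) (.b 18 (.b 38 (.b 8 (.c
  [0,1,8,7,6,5,4,3,2,9] []) (.b 69 (.c [1,2,5,4,3,8,7,6,9] [0]) (.b 28 (.b 19 (.c [2,1,9]
  [0,3,4,5,6,7,8]) (.s 1 3 6 7 9)) (.s 0 2 4 6 8)))) (.s 1 3 4 6 8)) (.s 1 3 4 6 8))) (.b 49 (.b
  59 (.b 48 (.c [4,8,7,6,5,9] [0,1,2,3]) (.b 18 (.c [5,4,9] [0,3,2,1,8,7,6]) (.b 8 (.c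
  [5,1,2,3,4,9] [0,8,7,6]) (.s 0 1 4 6 8)))) (.s 0 2 5 7 9)) (.s 0 2 4 7 9)))) (.s 1 3 4 6 7)) (.s
  0 1 3 5 7))))) (.b 8 (.b 18 (.b 29 (.c [0,1,8,7,6,5,4,3,2,9] []) (.b 49 (.c
  [0,1,8,7,6,5,2,3,4,9] []) (.b 69 (.b 27 (.c [0,1,8,7,2,3,4,5,6,9] []) (.s 0 2 4 7 9)) (.s 0 2 4
  6 9)))) (.b 38 (.b 15 (.b 49 (.c [5,1,2,3,4,9] [0,8,7,6]) (.b 69 (.c [1,2,5,4,3,8,7,6,9] [0])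
  (.b 29 (.b 19 (.c [2,1,9] [0,8,7,6,5,4,3]) (.b 39 (.b 48 (.c [3,2,9] [0,1,5,6,7,8,4]) (.s 1 4 6
  8 9)) (.s 1 3 4 6 9))) (.s 0 2 4 6 9)))) (.b 58 (.b 14 (.b 37 (.c [3,7,8,9] [0,6,5,4,1,2]) (.b
  17 (.b 27 (.c [1,2,7,6,5,8,9] [0,3,4]) (.b 47 (.c [1,4,7,6,5,8,9] [0,3,2]) (.s 0 2 4 5 7))) (.s
  0 1 3 5 7))) (.b 48 (.b 37 (.c [5,4,8,9] [0,1,2,3,7,6]) (.b 17 (.c [5,4,8,9] [0,3,2,1,7,6]) (.s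
  0 1 3 5 7))) (.s 1 2 4 6 8))) (.s 1 3 5 6 8))) (.b 48 (.b 58 (.b 37 (.c [5,4,8,9] [0,1,2,3,7,6])
  (.b 17 (.c [5,4,8,9] [0,3,2,1,7,6]) (.s 1 3 6 7 8))) (.s 1 3 5 6 8)) (.s 1 3 4 6 8)))) (.b 28
  (.b 48 (.b 27 (.b 37 (.c [2,3,7,6,5,4,8,9] [0,1]) (.b 15 (.b 49 (.c [7,8,2,3,4,9] [0,1,5,6]) (.b
  14 (.c [5,1,4,3,2,7,8,9] [0,6]) (.b 19 (.c [7,8,2,3,4,5,1,9] [0,6]) (.b 17 (.c [1,5,2,3,4,8,9]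
  [0,6,7]) (.b 69 (.b 59 (.c [6,5,9] [0,1,2,3,4,8,7]) (.s 1 3 5 7 9)) (.s 1 2 4 6 9)))))) (.b 17
  (.b 29 (.c [2,8,9] [0,1,7,6,5,4,3]) (.b 49 (.c [4,8,9] [0,3,2,1,7,6,5]) (.b 58 (.c [5,4,8,9]
  [0,3,2,1,7,6]) (.b 69 (.b 47 (.b 38 (.c [2,3,8,7,4,5,6,9] [0,1]) (.s 0 3 5 7 8)) (.s 0 2 4 7 9))
  (.s 0 2 4 6 9))))) (.s 0 1 3 5 7)))) (.b 47 (.b 59 (.c [4,8,7,6,5,9] [0,1,2,3]) (.b 29 (.b 17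
  (.c [2,8,9] [0,1,7,6,5,4,3]) (.b 19 (.c [2,1,9] [0,3,4,5,6,7,8]) (.b 15 (.c [7,8,4,3,2,9]
  [0,1,5,6]) (.s 0 1 5 7 9)))) (.s 0 2 5 7 9))) (.s 0 2 4 5 7))) (.s 0 2 4 6 8)) (.s 0 2 4 6
  8))))) (.b 27 (.b 47 (.b 59 (.b 58 (.c [5,8,9] [0,1,2,3,4,7,6]) (.b 48 (.c [4,8,7,6,5,9]
  [0,1,2,3]) (.b 28 (.b 14 (.c [2,8,7,6,5,9] [0,1,4,3]) (.b 18 (.c [8,1,2,3,4,5,9] [0,6,7]) (.b 26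
  (.b 38 (.c [2,7,6,5,4,3,8,9] [0,1]) (.s 1 3 4 6 8)) (.s 1 2 4 6 8)))) (.s 0 2 4 5 8)))) (.b 29
  (.b 37 (.b 48 (.c [2,3,7,6,5,4,8,9] [0,1]) (.b 58 (.c [3,4,7,6,5,8,9] [0,1,2]) (.b 15 (.c
  [3,4,7,8,9] [0,6,5,1,2]) (.b 8 (.b 28 (.b 19 (.c [2,1,9] [0,8,7,6,5,4,3]) (.b 17 (.c [2,8,9]
  [0,1,7,6,5,4,3]) (.s 0 1 5 7 9))) (.s 0 2 4 5 8)) (.s 0 2 4 5 8))))) (.b 39 (.b 38 (.c [3,8,9]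
  [0,1,2,7,6,5,4]) (.b 8 (.b 19 (.c [2,1,9] [0,8,7,6,5,4,3]) (.b 15 (.b 17 (.b 28 (.c [2,8,9]
  [0,1,7,6,5,4,3]) (.b 26 (.c [2,6,7,8,9] [0,1,5,4,3]) (.b 48 (.c [3,2,9] [0,1,5,6,7,8,4]) (.s 0 2
  4 6 8)))) (.s 1 3 5 7 9)) (.s 1 3 5 7 9))) (.b 58 (.b 48 (.c [5,8,4,3,9] [0,1,2,7,6]) (.b 28 (.b
  26 (.b 17 (.c [2,8,9] [0,1,7,6,5,4,3]) (.b 15 (.c [2,6,7,8,9] [0,1,5,4,3]) (.s 0 1 3 5 7))) (.s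
  0 2 4 6 8)) (.s 0 2 4 5 8))) (.s 0 3 5 7 8)))) (.s 0 3 5 7 9))) (.s 0 2 5 7 9))) (.s 0 2 4 5 7))
  (.s 0 2 4 5 7))))) (.b 26 (.b 16 (.b 37 (.c [1,2,6,5,4,3,7,8,9] [0]) (.b 15 (.c [1,2,6,7,8,9]
  [0,3,4,5]) (.b 17 (.c [6,2,1,7,8,9] [0,3,4,5]) (.b 7 (.b 19 (.b 39 (.b 59 (.b 8 (.c
  [0,8,7,6,5,4,3,2,1,9] []) (.b 18 (.c [1,8,9] [0,7,6,5,4,3,2]) (.b 58 (.c [1,2,6,7,8,5,4,3,9]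
  [0]) (.b 38 (.c [1,2,6,7,8,3,4,5,9] [0]) (.s 0 1 3 5 8))))) (.s 1 3 5 7 9)) (.s 1 3 5 7 9)) (.s
  1 3 5 7 9)) (.s 0 1 3 5 7))))) (.b 37 (.b 25 (.c [2,6,5,4,3,7,8,9] [0,1]) (.b 47 (.c [4,3,7,8,9]
  [0,1,2,6,5]) (.b 7 (.b 27 (.b 15 (.c [2,6,7,8,9] [0,1,5,4,3]) (.b 48 (.c [2,3,7,6,5,4,8,9]
  [0,1]) (.b 8 (.b 28 (.b 19 (.c [0,8,7,6,5,4,3,2,1,9] []) (.b 17 (.c [0,1,7,6,5,4,3,2,8,9] [])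
  (.b 59 (.b 18 (.c [0,1,8,7,6,2,3,4,5,9] []) (.b 14 (.c [2,8,7,6,5,9] [0,1,4,3]) (.s 0 1 4 6 8)))
  (.s 1 3 5 7 9)))) (.s 0 2 4 6 8)) (.s 0 2 4 6 8)))) (.s 0 2 4 5 7)) (.s 0 2 4 5 7)))) (.b 8 (.b
  14 (.b 15 (.c [1,5,4,3,2,6,7,8,9] [0]) (.b 25 (.c [2,5,6,7,8,9] [0,1,4,3]) (.b 7 (.b 19 (.c
  [0,8,7,6,5,4,3,2,1,9] []) (.b 17 (.b 59 (.c [0,8,7,1,4,3,2,6,5,9] []) (.s 1 3 5 7 9)) (.s 1 3 5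
  7 9))) (.b 17 (.b 47 (.c [4,1,7,8,9] [0,3,2,6,5]) (.s 0 2 4 5 7)) (.s 0 1 3 5 7))))) (.b 18 (.b
  29 (.c [0,1,8,7,6,5,4,3,2,9] []) (.b 59 (.c [0,1,8,7,6,2,3,4,5,9] []) (.b 7 (.b 19 (.c
  [0,8,7,6,5,4,3,2,1,9] []) (.b 15 (.b 17 (.b 27 (.c [2,6,7,8,9] [0,1,5,4,3]) (.b 25 (.c
  [5,6,2,1,7,8,9] [0,3,4]) (.s 0 2 5 7 9))) (.s 1 3 5 7 9)) (.s 1 3 5 7 9))) (.b 27 (.b 39 (.c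
  [0,8,1,2,7,6,5,4,3,9] []) (.s 0 3 5 7 9)) (.s 0 2 5 7 9))))) (.b 48 (.b 25 (.b 39 (.c
  [2,5,6,7,8,4,3,9] [0,1]) (.b 17 (.c [6,5,2,3,4,8,9] [0,1,7]) (.b 15 (.b 19 (.b 59 (.c [1,5,9]
  [0,3,4,8,7,6,2]) (.s 1 3 5 7 9)) (.s 1 3 5 7 9)) (.s 1 3 5 7 9)))) (.b 27 (.b 38 (.c
  [2,7,6,5,4,3,8,9] [0,1]) (.b 15 (.c [2,6,7,8,9] [0,1,5,4,3]) (.b 58 (.b 17 (.c [5,4,8,9]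
  [0,3,2,1,7,6]) (.s 1 3 5 7 8)) (.s 1 3 5 6 8)))) (.b 7 (.b 47 (.b 19 (.c [0,8,7,6,5,4,3,2,1,9]
  []) (.b 59 (.c [4,8,7,6,5,9] [0,1,2,3]) (.b 29 (.b 15 (.b 39 (.c [3,2,9] [0,1,5,6,7,8,4]) (.s 1
  3 5 7 9)) (.s 1 3 5 7 9)) (.s 0 2 5 7 9)))) (.s 0 2 4 5 7)) (.s 0 2 3 5 7)))) (.s 0 1 4 6 8))))
  (.b 28 (.b 48 (.b 17 (.b 29 (.c [2,8,9] [0,1,7,6,5,4,3]) (.b 49 (.c [4,8,9] [0,3,2,1,7,6,5]) (.b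
  25 (.c [6,5,2,3,4,8,9] [0,1,7]) (.b 59 (.b 69 (.c [6,5,9] [0,1,2,3,4,8,7]) (.s 0 2 4 6 9)) (.s 0
  2 4 5 9))))) (.b 15 (.b 14 (.c [1,5,4,3,2,6,7,8,9] [0]) (.b 27 (.c [2,6,7,8,9] [0,1,5,4,3]) (.b
  18 (.b 7 (.b 19 (.c [1,8,9] [0,7,6,5,4,3,2]) (.b 25 (.c [5,1,2,3,4,8,9] [0,7,6]) (.b 47 (.b 59
  (.c [4,8,7,6,5,9] [0,1,2,3]) (.s 1 3 5 7 9)) (.s 0 2 4 5 7)))) (.b 47 (.b 59 (.c [4,8,7,6,5,9]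
  [0,1,2,3]) (.b 29 (.c [7,8,4,3,2,9] [0,1,5,6]) (.s 0 2 5 7 9))) (.s 0 1 2 4 7))) (.s 0 1 4 6
  8)))) (.b 19 (.b 39 (.b 59 (.b 49 (.c [4,3,9] [0,1,2,8,7,6,5]) (.b 69 (.c [6,5,9]
  [0,1,2,3,4,8,7]) (.b 29 (.c [2,1,9] [0,3,4,5,6,7,8]) (.s 0 2 4 6 9)))) (.s 1 3 5 7 9)) (.s 1 3 5
  7 9)) (.s 1 3 5 7 9)))) (.s 0 2 4 6 8)) (.s 0 2 4 6 8))))) (.b 25 (.b 8 (.b 28 (.b 48 (.b 7 (.b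
  19 (.c [0,8,7,6,5,4,3,2,1,9] []) (.b 17 (.c [0,1,7,6,5,4,3,2,8,9] []) (.b 15 (.c [5,1,2,3,4,8,9]
  [0,7,6]) (.b 37 (.b 59 (.b 27 (.c [2,3,7,6,5,4,8,9] [0,1]) (.b 47 (.c [4,8,7,6,5,9] [0,1,2,3])
  (.s 0 2 4 6 7))) (.s 1 3 5 7 9)) (.s 1 3 5 7 9))))) (.b 27 (.b 47 (.b 37 (.c [2,3,7,6,5,4,8,9]
  [0,1]) (.b 59 (.c [4,8,7,6,5,9] [0,1,2,3]) (.b 39 (.b 17 (.c [7,1,2,3,9] [0,8,4,5,6]) (.b 15 (.c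
  [7,4,8,2,3,9] [0,1,5,6]) (.s 0 1 3 5 7))) (.s 0 3 5 7 9)))) (.s 0 2 4 6 7)) (.s 0 2 4 6 7))) (.s
  0 2 4 6 8)) (.s 0 2 4 6 8)) (.s 0 2 4 6 8)) (.s 0 2 4 5 6)))))) (.b 4 (.b 25 (.b 14 (.c
  [0,1,4,3,2,5,6,7,8,9] []) (.b 15 (.c [2,1,5,6,7,8,9] [0,4,3]) (.b 37 (.b 36 (.c [3,6,7,8,9]
  [0,1,2,5,4]) (.b 26 (.c [2,6,5,4,3,7,8,9] [0,1]) (.b 27 (.b 16 (.c [3,2,7,8,9] [0,1,6,5,4]) (.b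
  48 (.c [2,3,7,6,5,4,8,9] [0,1]) (.b 18 (.b 28 (.b 38 (.b 39 (.c [3,8,9] [0,1,2,7,6,5,4]) (.b 19
  (.c [1,8,9] [0,4,5,6,7,3,2]) (.b 69 (.c [8,7,3,4,5,6,9] [0,1,2]) (.s 1 3 4 6 9)))) (.s 1 3 4 6
  8)) (.s 1 2 4 6 8)) (.s 1 2 4 6 8)))) (.b 58 (.b 48 (.c [5,4,8,9] [0,1,2,3,7,6]) (.b 47 (.c
  [3,4,7,6,5,8,9] [0,1,2]) (.b 28 (.b 69 (.c [2,8,5,4,3,7,6,9] [0,1]) (.b 49 (.c [2,8,5,6,7,3,4,9]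
  [0,1]) (.s 2 4 6 7 9))) (.s 2 4 6 7 8)))) (.b 16 (.b 5 (.c [0,5,4,3,2,1,6,7,8,9] []) (.b 38 (.c
  [3,7,8,9] [0,4,5,6,1,2]) (.b 8 (.b 18 (.b 29 (.c [0,1,8,7,6,5,4,3,2,9] []) (.b 19 (.c [1,8,9]
  [0,4,5,6,7,3,2]) (.b 49 (.c [0,1,8,7,6,5,2,3,4,9] []) (.b 69 (.b 17 (.b 59 (.c [5,6,9]
  [0,8,7,1,2,3,4]) (.b 39 (.c [7,8,1,2,3,9] [0,4,5,6]) (.s 0 1 3 5 9))) (.s 1 2 4 7 9)) (.s 1 2 4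
  6 9))))) (.s 0 1 3 5 8)) (.s 0 1 3 5 8)))) (.b 18 (.b 38 (.b 19 (.c [1,8,9] [0,4,5,6,7,3,2]) (.b
  17 (.b 39 (.c [3,8,9] [0,4,5,6,7,1,2]) (.b 49 (.b 59 (.c [5,4,9] [0,1,2,3,8,7,6]) (.s 1 3 5 6
  9)) (.s 1 3 4 6 9))) (.b 47 (.b 39 (.b 59 (.b 49 (.c [5,4,9] [0,1,2,3,8,7,6]) (.b 29 (.c [2,3,9]
  [0,4,5,6,7,8,1]) (.b 69 (.c [5,6,9] [0,1,2,3,8,7,4]) (.s 1 2 4 6 9)))) (.s 1 3 5 7 9)) (.s 1 3 5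
  7 9)) (.s 1 2 4 6 7)))) (.s 1 3 5 6 8)) (.s 1 3 5 6 8))))))) (.b 17 (.b 18 (.b 39 (.c
  [7,8,1,2,3,9] [0,4,5,6]) (.b 19 (.b 59 (.b 7 (.c [1,8,9] [0,7,6,5,4,3,2]) (.b 69 (.c [6,5,9]
  [0,4,3,2,1,8,7]) (.b 5 (.b 6 (.c [0,6,5,4,3,2,1,7,8,9] []) (.b 36 (.c [0,4,5,6,3,2,1,7,8,9] [])
  (.s 0 3 6 7 9))) (.s 0 1 3 5 7)))) (.s 1 3 5 7 9)) (.s 1 3 5 7 9))) (.b 5 (.b 6 (.c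
  [0,6,5,4,3,2,1,7,8,9] []) (.b 16 (.c [0,5,4,3,2,1,6,7,8,9] []) (.b 36 (.c [0,4,5,6,3,2,1,7,8,9]
  []) (.b 8 (.b 38 (.b 58 (.b 39 (.c [3,8,9] [0,4,5,6,7,1,2]) (.b 49 (.c [0,8,5,6,7,1,2,3,4,9] [])
  (.b 69 (.c [0,8,5,4,3,2,1,7,6,9] []) (.s 1 3 4 6 9)))) (.s 1 3 5 6 8)) (.s 0 1 3 6 8)) (.s 0 1 3
  6 8))))) (.b 7 (.b 8 (.b 19 (.c [0,8,7,6,5,4,3,2,1,9] []) (.b 39 (.b 59 (.b 58 (.c [5,8,9]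
  [0,4,3,2,1,7,6]) (.b 38 (.c [3,8,9] [0,4,5,6,7,1,2]) (.s 0 1 3 5 8))) (.s 1 3 5 7 9)) (.s 1 3 5
  7 9))) (.b 38 (.b 58 (.b 59 (.c [5,8,9] [0,4,3,2,1,7,6]) (.b 39 (.c [3,8,9] [0,4,5,6,7,1,2]) (.s
  0 3 5 7 9))) (.s 0 1 3 5 8)) (.s 0 1 3 5 8))) (.s 0 1 3 5 7)))) (.b 7 (.b 47 (.b 19 (.b 59 (.b
  18 (.c [1,8,9] [0,7,6,5,4,3,2]) (.b 58 (.c [5,8,9] [0,1,2,3,4,7,6]) (.s 1 3 5 7 8))) (.s 1 3 5 7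
  9)) (.s 1 3 5 7 9)) (.s 1 3 4 5 7)) (.s 0 1 3 5 7)))))) (.b 5 (.b 16 (.c [0,5,4,3,2,1,6,7,8,9]
  []) (.b 36 (.b 14 (.c [0,5,4,1,2,3,6,7,8,9] []) (.b 17 (.c [0,4,5,6,3,2,1,7,8,9] []) (.b 15 (.c
  [0,4,5,1,2,3,6,7,8,9] []) (.b 47 (.b 48 (.c [4,7,8,9] [0,1,2,3,6,5]) (.b 26 (.c
  [2,3,6,5,4,7,8,9] [0,1]) (.b 18 (.b 69 (.c [0,5,4,3,2,1,8,7,6,9] []) (.b 19 (.c [1,8,9]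
  [0,5,6,7,4,3,2]) (.b 29 (.c [0,5,4,3,6,7,8,1,2,9] []) (.s 1 2 4 6 9)))) (.s 1 2 4 6 8)))) (.b 27
  (.b 37 (.b 48 (.c [2,3,7,6,5,4,8,9] [0,1]) (.b 18 (.c [3,6,7,2,1,8,9] [0,5,4]) (.s 1 4 6 7 8)))
  (.s 1 3 4 5 7)) (.s 1 2 4 5 7)))))) (.b 6 (.b 17 (.c [0,6,5,4,3,2,1,7,8,9] []) (.b 26 (.b 15 (.c
  [0,1,5,4,3,2,6,7,8,9] []) (.b 37 (.b 38 (.c [3,7,8,9] [0,1,2,6,5,4]) (.b 14 (.c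
  [0,1,4,5,6,2,3,7,8,9] []) (.b 48 (.b 58 (.c [5,4,8,9] [0,1,2,3,7,6]) (.s 1 3 5 6 8)) (.s 1 3 4 6
  8)))) (.s 1 3 5 6 7))) (.b 37 (.b 14 (.b 58 (.c [0,4,1,2,3,7,6,5,8,9] []) (.b 38 (.c [3,7,8,9]
  [0,6,5,4,1,2]) (.b 15 (.b 18 (.b 28 (.b 47 (.c [0,6,5,1,2,3,4,7,8,9] []) (.b 27 (.c
  [5,1,4,3,2,7,8,9] [0,6]) (.b 49 (.c [0,5,6,7,8,1,2,3,4,9] []) (.b 29 (.c [0,5,6,7,8,1,4,3,2,9]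
  []) (.b 7 (.c [0,6,7,3,4,5,1,2,8,9] []) (.s 0 2 4 7 9)))))) (.s 2 3 5 6 8)) (.s 1 3 5 6 8)) (.s
  1 3 5 6 8)))) (.b 18 (.b 69 (.c [0,5,4,3,2,1,8,7,6,9] []) (.b 19 (.c [1,8,9] [0,4,5,6,7,3,2])
  (.b 49 (.c [0,5,6,7,8,1,2,3,4,9] []) (.s 1 2 4 6 9)))) (.b 48 (.b 58 (.c [5,4,8,9]
  [0,1,2,3,7,6]) (.b 27 (.c [2,3,7,6,5,4,8,9] [0,1]) (.b 47 (.b 15 (.c [0,6,5,1,2,3,4,7,8,9] [])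
  (.s 1 3 5 6 8)) (.s 1 2 4 6 7)))) (.s 1 2 4 6 8)))) (.b 15 (.b 47 (.c [0,6,5,1,2,3,4,7,8,9] [])
  (.b 14 (.b 27 (.c [5,1,4,3,2,7,8,9] [0,6]) (.b 7 (.b 48 (.c [0,7,6,5,1,2,3,4,8,9] []) (.b 28 (.b
  69 (.c [0,1,5,4,3,2,8,7,6,9] []) (.b 59 (.c [0,1,4,3,2,8,7,6,5,9] []) (.b 19 (.c
  [0,6,7,8,2,3,4,5,1,9] []) (.b 39 (.c [0,6,7,8,2,1,5,4,3,9] []) (.s 1 3 5 6 9))))) (.s 2 4 6 7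
  8))) (.s 0 2 3 5 7))) (.s 1 3 4 6 7))) (.s 1 3 5 6 7))))) (.b 18 (.b 69 (.c
  [0,5,4,3,2,1,8,7,6,9] []) (.b 19 (.b 7 (.c [1,8,9] [0,7,6,5,4,3,2]) (.b 37 (.c [1,8,9]
  [0,4,5,6,7,3,2]) (.b 17 (.b 39 (.c [7,8,1,2,3,9] [0,4,5,6]) (.s 0 3 6 7 9)) (.s 0 1 3 6 7))))
  (.b 39 (.b 29 (.c [2,3,9] [0,4,5,6,7,8,1]) (.b 17 (.c [7,8,1,2,3,9] [0,4,5,6]) (.b 49 (.c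
  [3,4,9] [0,5,6,7,8,1,2]) (.b 26 (.b 37 (.b 47 (.c [4,3,7,8,9] [0,1,2,6,5]) (.s 1 4 6 7 9)) (.s 1
  3 6 7 9)) (.s 0 2 4 6 9))))) (.s 0 1 3 6 9)))) (.b 8 (.b 38 (.b 26 (.b 15 (.c
  [0,1,5,4,3,2,6,7,8,9] []) (.b 37 (.c [3,7,8,9] [0,1,2,6,5,4]) (.b 27 (.c [2,7,6,5,4,3,8,9]
  [0,1]) (.b 7 (.b 17 (.b 19 (.c [0,8,7,6,5,4,3,2,1,9] []) (.b 69 (.c [0,8,7,1,2,3,4,5,6,9] [])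
  (.b 39 (.c [3,8,9] [0,4,5,6,7,1,2]) (.s 0 1 3 6 9)))) (.s 1 2 3 5 7)) (.s 0 2 3 5 7))))) (.b 48
  (.b 15 (.b 29 (.c [4,3,8,7,6,5,1,2,9] [0]) (.b 39 (.c [0,4,8,7,6,5,1,2,3,9] []) (.b 69 (.b 59
  (.c [6,5,9] [0,1,2,3,4,8,7]) (.b 37 (.c [3,7,8,4,5,6,9] [0,1,2]) (.b 7 (.c [0,7,8,4,3,2,1,5,6,9]
  []) (.s 0 3 5 7 9)))) (.s 0 2 3 6 9)))) (.b 58 (.b 37 (.c [5,4,8,9] [0,1,2,3,7,6]) (.b 17 (.b 59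
  (.c [5,8,9] [0,4,3,2,1,7,6]) (.b 39 (.c [3,8,9] [0,4,5,6,7,1,2]) (.b 69 (.c
  [0,8,5,4,3,2,1,7,6,9] []) (.s 1 3 5 6 9)))) (.s 1 3 5 6 7))) (.s 1 3 5 6 8))) (.b 28 (.b 14 (.b
  59 (.c [0,1,4,3,2,8,7,6,5,9] []) (.b 58 (.b 37 (.c [0,4,1,2,3,7,6,5,8,9] []) (.b 27 (.c
  [0,1,4,3,2,7,6,5,8,9] []) (.b 7 (.b 29 (.b 17 (.c [0,1,7,6,5,4,3,2,8,9] []) (.b 15 (.c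
  [0,8,7,6,5,1,4,3,2,9] []) (.s 1 2 3 5 7))) (.s 2 3 5 7 9)) (.s 0 2 3 5 7)))) (.b 15 (.b 69 (.c
  [0,1,5,4,3,2,8,7,6,9] []) (.b 19 (.b 29 (.c [2,1,9] [0,8,7,6,5,4,3]) (.b 49 (.c [4,1,9]
  [0,5,6,7,8,2,3]) (.s 0 2 4 6 9))) (.b 39 (.b 49 (.c [4,3,9] [0,1,2,8,7,6,5]) (.s 1 4 6 8 9)) (.s
  0 1 3 6 9)))) (.s 1 3 5 6 8)))) (.s 1 2 4 6 8)) (.s 0 2 4 6 8)))) (.s 0 1 3 6 8)) (.s 0 1 3 6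
  8)))))) (.b 7 (.b 19 (.b 8 (.c [0,8,7,6,5,4,3,2,1,9] []) (.b 18 (.c [1,8,9] [0,7,6,5,4,3,2]) (.b
  17 (.b 28 (.c [0,1,7,6,5,4,3,2,8,9] []) (.b 38 (.b 58 (.b 29 (.c [2,1,9] [0,4,5,6,7,8,3]) (.b 59
  (.c [5,8,9] [0,4,3,2,1,7,6]) (.b 39 (.c [3,8,9] [0,4,5,6,7,1,2]) (.s 0 2 3 5 9)))) (.s 0 2 3 5
  8)) (.s 0 2 3 5 8))) (.b 15 (.b 6 (.b 48 (.c [0,7,6,5,1,2,3,4,8,9] []) (.b 28 (.c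
  [0,6,7,8,2,3,4,5,1,9] []) (.b 38 (.b 26 (.c [0,7,6,2,1,5,4,3,8,9] []) (.s 0 2 4 6 8)) (.s 0 2 3
  5 8)))) (.b 26 (.b 27 (.c [2,6,7,8,9] [0,1,5,4,3]) (.b 37 (.b 16 (.c [1,2,6,5,4,3,7,8,9] [0])
  (.b 38 (.c [3,7,8,9] [0,1,2,6,5,4]) (.s 0 1 3 6 8))) (.s 0 2 3 5 7))) (.b 36 (.b 28 (.b 48 (.b
  58 (.b 47 (.c [4,7,8,9] [0,1,2,3,6,5]) (.b 37 (.c [5,4,8,9] [0,1,2,3,7,6]) (.b 27 (.b 49 (.c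
  [7,8,2,3,4,9] [0,1,5,6]) (.b 14 (.c [0,1,4,3,2,7,6,5,8,9] []) (.b 39 (.c [5,8,4,3,9]
  [0,1,2,7,6]) (.s 1 3 4 7 9)))) (.s 0 2 3 5 7)))) (.s 0 2 5 6 8)) (.s 0 2 4 6 8)) (.s 0 2 4 6 8))
  (.s 0 2 3 5 6)))) (.b 37 (.b 38 (.b 58 (.b 48 (.c [5,4,8,9] [0,1,2,3,7,6]) (.b 26 (.c [3,7,8,9]
  [0,1,2,6,5,4]) (.b 14 (.c [0,4,1,2,3,7,6,5,8,9] []) (.b 16 (.c [3,7,8,9] [0,4,5,6,1,2]) (.s 1 2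
  4 6 8))))) (.s 0 1 3 5 8)) (.s 0 1 3 5 8)) (.s 0 1 3 5 7)))))) (.b 17 (.b 28 (.c
  [0,1,7,6,5,4,3,2,8,9] []) (.b 58 (.b 59 (.c [5,8,9] [0,4,3,2,1,7,6]) (.b 27 (.c [2,1,7,6,5,8,9]
  [0,4,3]) (.b 37 (.b 48 (.c [5,4,8,9] [0,1,2,3,7,6]) (.b 47 (.c [3,4,7,6,5,8,9] [0,1,2]) (.b 14
  (.c [0,4,1,2,3,7,6,5,8,9] []) (.b 49 (.b 26 (.b 16 (.c [1,2,6,5,4,3,7,8,9] [0]) (.b 38 (.c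
  [3,7,8,9] [0,1,2,6,5,4]) (.b 36 (.c [3,6,7,8,5,4,9] [0,1,2]) (.s 1 3 4 6 8)))) (.s 2 4 6 7 8))
  (.s 2 4 5 7 9))))) (.s 0 2 3 5 7)))) (.b 8 (.b 38 (.b 39 (.c [3,8,9] [0,4,5,6,7,1,2]) (.b 26 (.b
  37 (.c [3,7,8,9] [0,1,2,6,5,4]) (.b 27 (.c [2,7,6,5,4,3,8,9] [0,1]) (.s 0 2 3 5 7))) (.b 6 (.b
  48 (.b 15 (.c [0,7,6,5,1,2,3,4,8,9] []) (.b 59 (.b 37 (.b 18 (.c [0,6,7,8,1,2,3,4,5,9] []) (.b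
  16 (.c [0,8,7,6,1,2,3,4,5,9] []) (.b 14 (.c [3,7,8,9] [0,6,5,4,1,2]) (.s 1 2 4 6 8)))) (.s 1 3 5
  7 9)) (.s 0 1 3 5 9))) (.s 2 4 5 6 8)) (.s 0 2 5 6 8)))) (.s 0 2 3 5 8)) (.s 0 2 3 5 8)))) (.b
  37 (.b 26 (.b 16 (.c [1,2,6,5,4,3,7,8,9] [0]) (.b 38 (.c [3,7,8,9] [0,1,2,6,5,4]) (.b 47 (.c
  [4,3,7,8,9] [0,1,2,6,5]) (.b 14 (.c [0,1,4,5,6,2,3,7,8,9] []) (.b 49 (.b 48 (.c [4,8,9]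
  [0,1,2,3,7,6,5]) (.b 18 (.b 36 (.c [3,2,6,5,4,9] [0,1,8,7]) (.s 1 3 4 6 8)) (.s 1 3 4 6 8))) (.s
  1 4 6 7 9)))))) (.b 48 (.b 49 (.c [4,8,9] [0,1,2,3,7,6,5]) (.b 58 (.c [5,4,8,9] [0,1,2,3,7,6])
  (.b 27 (.c [2,3,7,6,5,4,8,9] [0,1]) (.b 6 (.b 15 (.c [0,7,6,5,1,2,3,4,8,9] []) (.b 29 (.b 59 (.b
  39 (.b 69 (.c [6,5,9] [0,1,2,3,4,8,7]) (.b 47 (.c [4,8,7,6,5,9] [0,1,2,3]) (.b 16 (.c [3,2,9]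
  [0,1,6,5,4,8,7]) (.s 1 4 6 7 9)))) (.s 1 3 5 7 9)) (.s 1 2 5 7 9)) (.s 1 2 5 7 9))) (.b 36 (.b
  28 (.b 47 (.c [4,7,8,9] [0,1,2,3,6,5]) (.b 14 (.c [6,7,3,2,8,9] [0,1,4,5]) (.s 1 2 4 7 9))) (.s
  0 2 5 6 8)) (.s 0 2 3 5 6)))))) (.b 8 (.b 14 (.b 58 (.c [0,4,1,2,3,7,6,5,8,9] []) (.b 28 (.b 59
  (.c [0,1,4,3,2,8,7,6,5,9] []) (.b 36 (.c [6,7,3,2,8,9] [0,1,4,5]) (.b 6 (.b 15 (.c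
  [0,6,7,3,4,5,1,2,8,9] []) (.s 1 3 5 7 9)) (.s 0 2 3 5 6)))) (.s 2 4 5 6 8))) (.b 16 (.b 27 (.c
  [3,2,7,8,9] [0,1,6,5,4]) (.b 59 (.c [0,8,7,6,1,2,3,4,5,9] []) (.b 29 (.b 15 (.c
  [0,8,7,6,1,5,4,3,2,9] []) (.s 1 2 5 7 9)) (.s 0 2 5 7 9)))) (.b 18 (.b 29 (.c
  [0,1,8,7,6,5,4,3,2,9] []) (.b 49 (.c [0,8,1,2,3,7,6,5,4,9] []) (.s 1 2 4 6 9))) (.s 1 2 4 6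
  8)))) (.b 6 (.b 28 (.b 15 (.c [0,6,7,3,4,5,1,2,8,9] []) (.b 59 (.b 18 (.c [0,6,7,8,1,2,3,4,5,9]
  []) (.b 14 (.c [0,1,4,3,2,8,7,6,5,9] []) (.b 16 (.c [0,1,6,7,8,2,3,4,5,9] []) (.s 1 2 4 6 8))))
  (.s 1 3 5 7 9))) (.s 0 2 4 6 8)) (.s 0 2 4 6 8))))) (.b 15 (.b 27 (.b 39 (.b 59 (.b 38 (.c
  [3,8,9] [0,1,2,7,6,5,4]) (.b 26 (.c [2,6,7,8,9] [0,1,5,4,3]) (.b 8 (.b 16 (.c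
  [0,8,7,6,1,2,3,4,5,9] []) (.b 18 (.c [0,8,1,2,7,6,5,4,3,9] []) (.b 48 (.c [0,4,8,7,6,5,1,2,3,9]
  []) (.b 14 (.b 28 (.c [0,1,4,3,2,8,7,6,5,9] []) (.s 1 2 4 6 8)) (.s 1 2 4 6 8))))) (.b 28 (.b 58
  (.b 48 (.c [5,8,4,3,9] [0,1,2,7,6]) (.b 6 (.c [0,6,7,8,2,1,5,4,3,9] []) (.s 0 2 4 6 8))) (.s 0 2
  3 5 8)) (.s 0 2 3 5 8))))) (.s 1 3 5 7 9)) (.s 1 3 5 7 9)) (.s 0 2 3 5 7)) (.s 0 1 3 5 7)))))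
  (.b 27 (.b 37 (.b 16 (.c [3,2,7,8,9] [0,1,6,5,4]) (.b 48 (.c [2,3,7,6,5,4,8,9] [0,1]) (.b 14 (.b
  58 (.c [0,4,1,2,3,7,6,5,8,9] []) (.b 26 (.c [0,1,4,5,6,2,3,7,8,9] []) (.b 28 (.b 59 (.c
  [0,1,4,3,2,8,7,6,5,9] []) (.b 36 (.c [6,7,3,2,8,9] [0,1,4,5]) (.b 6 (.b 29 (.b 17 (.c [2,8,9]
  [0,1,7,6,5,4,3]) (.b 15 (.c [5,1,4,3,2,7,8,9] [0,6]) (.s 0 1 3 5 7))) (.s 0 2 5 7 9)) (.s 0 2 3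
  5 6)))) (.s 2 4 5 6 8)))) (.b 15 (.b 26 (.c [2,6,7,8,9] [0,1,5,4,3]) (.b 18 (.b 28 (.b 19 (.c
  [1,8,9] [0,4,5,6,7,3,2]) (.b 49 (.c [7,8,2,3,4,9] [0,1,5,6]) (.b 47 (.c [7,4,3,2,8,9] [0,1,5,6])
  (.b 29 (.b 17 (.c [2,8,9] [0,1,7,6,5,4,3]) (.s 1 4 6 7 9)) (.s 1 2 4 6 9))))) (.s 1 2 4 6 8))
  (.s 1 2 4 6 8))) (.b 17 (.b 58 (.c [2,1,7,6,5,8,9] [0,4,3]) (.b 18 (.b 19 (.c [1,8,9]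
  [0,4,5,6,7,3,2]) (.b 39 (.c [7,8,1,2,3,9] [0,4,5,6]) (.b 59 (.b 69 (.c [6,5,9] [0,4,3,2,1,8,7])
  (.b 49 (.b 38 (.c [5,4,9] [0,1,2,3,8,7,6]) (.b 8 (.c [0,8,1,2,3,7,6,5,4,9] []) (.s 0 1 3 5 8)))
  (.s 1 3 4 6 9))) (.s 0 1 3 5 9)))) (.s 1 4 5 6 8))) (.s 0 1 3 5 7)))))) (.s 0 2 3 5 7)) (.s 0 2
  3 5 7))))) (.b 5 (.b 6 (.b 17 (.c [0,6,5,4,3,2,1,7,8,9] []) (.b 15 (.b 26 (.c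
  [0,1,5,4,3,2,6,7,8,9] []) (.b 47 (.c [0,6,5,1,2,3,4,7,8,9] []) (.b 7 (.b 48 (.c
  [0,7,6,5,1,2,3,4,8,9] []) (.b 8 (.b 28 (.b 19 (.c [0,8,7,6,5,4,3,2,1,9] []) (.b 37 (.c
  [0,6,7,3,4,5,1,2,8,9] []) (.b 39 (.c [0,6,7,8,2,1,5,4,3,9] []) (.s 1 3 5 7 9)))) (.s 0 2 4 6 8))
  (.s 0 2 4 6 8))) (.b 27 (.b 16 (.c [0,1,6,5,4,3,2,7,8,9] []) (.b 14 (.c [5,1,4,3,2,7,8,9] [0,6])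
  (.b 37 (.b 48 (.c [2,3,7,6,5,4,8,9] [0,1]) (.b 18 (.c [0,6,5,4,3,7,2,1,8,9] []) (.s 1 2 4 6 8)))
  (.s 0 1 3 4 7)))) (.s 0 2 4 6 7))))) (.b 37 (.b 26 (.b 16 (.c [1,2,6,5,4,3,7,8,9] [0]) (.b 38
  (.c [3,7,8,9] [0,1,2,6,5,4]) (.b 25 (.c [2,6,5,4,3,7,8,9] [0,1]) (.b 47 (.c [4,3,7,8,9]
  [0,1,2,6,5]) (.b 14 (.b 36 (.c [2,3,6,7,8,9] [0,5,4,1]) (.b 18 (.b 49 (.c [0,5,6,7,8,1,2,3,4,9]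
  []) (.b 29 (.c [0,5,6,7,8,1,4,3,2,9] []) (.b 27 (.c [0,6,5,4,3,7,2,1,8,9] []) (.s 0 2 4 7 9))))
  (.s 1 3 5 6 8))) (.b 27 (.b 48 (.c [2,3,7,6,5,4,8,9] [0,1]) (.b 18 (.c [0,6,5,4,3,7,2,1,8,9] [])
  (.s 1 3 4 6 8))) (.s 1 2 4 5 7))))))) (.b 27 (.b 16 (.c [0,1,6,5,4,3,2,7,8,9] []) (.b 48 (.c
  [2,3,7,6,5,4,8,9] [0,1]) (.b 18 (.c [0,6,5,4,3,7,2,1,8,9] []) (.b 28 (.b 14 (.b 38 (.c [3,7,8,9]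
  [0,6,5,4,1,2]) (.b 36 (.c [6,7,3,2,8,9] [0,1,4,5]) (.s 1 3 4 6 8))) (.s 1 2 4 6 8)) (.s 0 2 4 6
  8))))) (.b 36 (.b 25 (.c [3,6,7,8,9] [0,1,2,5,4]) (.b 14 (.c [3,6,7,8,9] [0,5,4,1,2]) (.b 47 (.b
  48 (.c [4,7,8,9] [0,1,2,3,6,5]) (.b 8 (.b 28 (.b 49 (.c [7,3,6,5,4,9] [0,1,2,8]) (.b 69 (.c
  [7,3,4,5,6,9] [0,1,2,8]) (.b 19 (.c [3,6,7,8,2,1,9] [0,5,4]) (.b 29 (.b 18 (.c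
  [0,1,8,7,6,5,4,3,2,9] []) (.s 1 4 6 8 9)) (.s 0 2 4 6 9))))) (.s 0 2 4 6 8)) (.s 0 2 4 6 8)))
  (.s 1 2 4 5 7)))) (.b 49 (.b 48 (.c [4,8,9] [0,1,2,3,7,6,5]) (.b 18 (.c [0,5,6,7,8,1,2,3,4,9]
  []) (.b 28 (.b 39 (.c [4,3,9] [0,1,2,8,7,6,5]) (.b 19 (.b 59 (.b 16 (.c [0,1,6,7,8,2,3,4,5,9]
  []) (.b 14 (.c [0,5,6,7,8,2,3,4,1,9] []) (.s 1 2 4 6 8))) (.s 1 3 5 7 9)) (.s 1 3 5 7 9))) (.s 0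
  2 4 6 8)))) (.b 29 (.b 19 (.b 8 (.c [2,1,9] [0,8,7,6,5,4,3]) (.b 28 (.b 48 (.b 47 (.c
  [7,8,4,3,2,1,9] [0,5,6]) (.b 14 (.c [0,5,6,7,8,2,3,4,1,9] []) (.b 59 (.b 69 (.c [6,5,9]
  [0,1,2,3,4,8,7]) (.s 2 4 6 7 9)) (.s 1 4 5 7 9)))) (.s 0 2 4 6 8)) (.s 0 2 4 6 8))) (.b 59 (.b
  14 (.b 38 (.c [3,7,8,9] [0,6,5,4,1,2]) (.b 18 (.c [0,5,6,7,8,1,4,3,2,9] []) (.b 58 (.c [5,8,9]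
  [0,6,7,3,2,1,4]) (.s 1 3 5 6 8)))) (.b 47 (.b 48 (.c [4,8,7,6,5,9] [0,1,2,3]) (.b 8 (.b 28 (.b
  18 (.c [0,1,8,7,6,5,4,3,2,9] []) (.b 16 (.c [0,1,6,7,8,2,3,4,5,9] []) (.s 1 2 4 6 8))) (.s 0 2 4
  6 8)) (.s 0 2 4 6 8))) (.s 1 2 4 7 9))) (.s 1 3 5 7 9))) (.b 69 (.b 7 (.b 47 (.b 28 (.c
  [7,3,4,5,6,9] [0,1,2,8]) (.b 8 (.b 48 (.b 19 (.c [0,8,7,6,5,4,3,2,1,9] []) (.b 59 (.c [6,5,9]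
  [0,1,2,3,4,8,7]) (.s 1 2 5 7 9))) (.s 0 2 4 6 8)) (.s 0 2 4 6 8))) (.s 0 2 4 7 9)) (.s 0 2 4 7
  9)) (.s 0 2 4 6 9))))))) (.b 7 (.b 19 (.b 39 (.b 18 (.c [1,8,9] [0,7,6,5,4,3,2]) (.b 38 (.b 27
  (.c [3,8,9] [0,1,2,7,6,5,4]) (.b 25 (.c [0,6,7,8,3,4,5,2,1,9] []) (.s 1 2 3 5 7))) (.s 1 3 5 7
  8))) (.s 1 3 5 7 9)) (.s 1 3 5 7 9)) (.s 0 1 3 5 7))))) (.b 26 (.b 15 (.c [0,1,5,4,3,2,6,7,8,9]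
  []) (.b 36 (.b 47 (.c [2,3,6,5,4,7,8,9] [0,1]) (.b 14 (.c [2,3,6,7,8,9] [0,5,4,1]) (.b 17 (.c
  [3,6,2,1,7,8,9] [0,5,4]) (.b 37 (.b 16 (.c [1,2,6,5,4,3,7,8,9] [0]) (.b 38 (.c [3,7,8,9]
  [0,1,2,6,5,4]) (.b 58 (.c [6,7,3,4,5,8,9] [0,1,2]) (.b 18 (.c [3,7,6,2,1,8,9] [0,5,4]) (.s 1 3 5
  6 8))))) (.s 1 3 4 5 7))))) (.b 27 (.b 38 (.c [2,7,6,5,4,3,8,9] [0,1]) (.b 8 (.b 48 (.b 37 (.c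
  [2,3,7,6,5,4,8,9] [0,1]) (.b 17 (.c [7,1,2,3,4,8,9] [0,5,6]) (.b 7 (.b 19 (.c
  [0,8,7,6,5,4,3,2,1,9] []) (.s 1 3 5 7 9)) (.s 0 1 3 5 7)))) (.s 0 3 4 6 8)) (.s 0 3 4 6 8))) (.b
  7 (.b 8 (.b 19 (.c [0,8,7,6,5,4,3,2,1,9] []) (.b 37 (.b 16 (.c [1,2,6,5,4,3,7,8,9] [0]) (.b 38
  (.c [3,7,8,9] [0,1,2,6,5,4]) (.b 48 (.b 58 (.c [5,4,8,9] [0,1,2,3,7,6]) (.s 1 3 5 6 8)) (.s 0 3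
  4 6 8)))) (.b 17 (.b 59 (.b 16 (.c [0,8,7,6,1,2,3,4,5,9] []) (.b 14 (.c [0,8,7,1,4,3,2,6,5,9]
  []) (.s 0 1 3 4 6))) (.s 1 3 5 7 9)) (.s 1 3 5 7 9)))) (.b 28 (.b 38 (.b 17 (.c
  [0,1,7,6,5,4,3,2,8,9] []) (.b 37 (.c [3,7,8,9] [0,1,2,6,5,4]) (.b 16 (.b 59 (.c
  [1,2,6,7,8,3,4,5,9] [0]) (.s 1 3 5 7 9)) (.s 1 3 5 6 7)))) (.s 0 3 4 6 8)) (.s 0 2 4 6 8))) (.b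
  47 (.b 37 (.c [4,3,7,8,9] [0,1,2,6,5]) (.b 17 (.b 25 (.b 48 (.c [6,5,2,3,4,8,9] [0,1,7]) (.b 28
  (.b 38 (.b 29 (.c [2,8,9] [0,1,7,6,5,4,3]) (.b 69 (.c [2,3,8,7,4,5,6,9] [0,1]) (.b 39 (.b 49 (.c
  [4,3,9] [0,1,2,8,7,6,5]) (.s 0 2 4 6 9)) (.s 0 2 3 7 9)))) (.s 0 3 4 6 8)) (.s 0 2 4 6 8))) (.s
  0 2 3 5 7)) (.s 0 1 3 5 7))) (.s 0 2 4 6 7)))))) (.b 36 (.b 8 (.b 28 (.b 48 (.b 47 (.c [4,7,8,9]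
  [0,1,2,3,6,5]) (.b 7 (.b 27 (.b 19 (.c [0,8,7,6,5,4,3,2,1,9] []) (.b 17 (.c
  [0,1,7,6,5,4,3,2,8,9] []) (.b 37 (.c [2,3,7,6,5,4,8,9] [0,1]) (.b 59 (.b 16 (.c
  [0,8,7,6,1,2,3,4,5,9] []) (.b 14 (.c [2,8,7,6,5,9] [0,1,4,3]) (.s 0 1 2 4 6))) (.s 1 3 5 7
  9))))) (.s 0 2 4 6 7)) (.s 0 2 4 6 7))) (.s 0 2 4 6 8)) (.s 0 2 4 6 8)) (.s 0 2 4 6 8)) (.s 0 2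
  3 4 6)))) (.b 6 (.b 16 (.b 27 (.c [0,1,6,5,4,3,2,7,8,9] []) (.b 7 (.b 59 (.b 18 (.c
  [0,6,7,8,1,2,3,4,5,9] []) (.b 8 (.c [0,8,7,6,1,2,3,4,5,9] []) (.b 28 (.c [0,1,6,7,8,2,3,4,5,9]
  []) (.b 26 (.b 48 (.b 38 (.c [1,2,6,7,8,3,4,5,9] [0]) (.b 15 (.c [0,7,6,5,1,2,3,4,8,9] []) (.s 0
  1 3 5 8))) (.s 0 2 4 6 8)) (.s 0 2 4 6 8))))) (.b 25 (.b 38 (.c [0,7,6,1,2,5,4,3,8,9] []) (.b 15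
  (.b 36 (.c [1,2,5,4,3,6,7,8,9] [0]) (.b 48 (.c [0,7,6,5,1,2,3,4,8,9] []) (.b 8 (.b 19 (.c
  [0,8,7,6,5,4,3,2,1,9] []) (.b 49 (.c [5,1,2,3,4,9] [0,8,7,6]) (.b 29 (.c [0,8,7,6,1,5,4,3,2,9]
  []) (.b 47 (.b 37 (.c [3,4,7,8,9] [0,6,5,1,2]) (.b 69 (.c [0,8,7,4,3,2,1,5,6,9] []) (.b 17 (.b
  28 (.c [0,1,7,6,5,4,3,2,8,9] []) (.s 2 4 6 8 9)) (.s 1 3 5 7 9)))) (.s 0 2 4 7 9))))) (.s 0 3 4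
  6 8)))) (.b 8 (.b 19 (.c [0,8,7,6,5,4,3,2,1,9] []) (.b 17 (.b 37 (.b 28 (.c
  [0,1,7,6,5,4,3,2,8,9] []) (.b 26 (.c [1,2,6,5,4,3,7,8,9] [0]) (.b 69 (.c [0,8,7,1,2,3,4,5,6,9]
  []) (.b 29 (.c [0,8,7,1,6,5,4,3,2,9] []) (.b 48 (.b 49 (.c [4,8,9] [0,1,2,3,7,6,5]) (.s 0 2 4 6
  9)) (.s 0 2 4 6 8)))))) (.s 1 3 5 7 9)) (.s 1 3 5 7 9))) (.b 18 (.b 58 (.b 19 (.c [1,8,9]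
  [0,7,6,5,4,3,2]) (.b 17 (.b 37 (.b 28 (.c [0,1,7,6,5,4,3,2,8,9] []) (.b 48 (.c [5,4,8,9]
  [0,1,2,3,7,6]) (.s 0 2 3 4 8))) (.s 1 3 5 7 9)) (.s 1 3 5 7 9))) (.s 0 1 3 5 8)) (.s 0 1 3 5
  8))))) (.b 37 (.b 47 (.b 29 (.b 58 (.c [3,4,7,6,5,8,9] [0,1,2]) (.b 15 (.c [3,4,7,8,9]
  [0,6,5,1,2]) (.b 8 (.c [7,3,4,5,6,1,2,9] [0,8]) (.b 18 (.b 48 (.b 19 (.c [1,8,9]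
  [0,7,6,5,4,3,2]) (.b 39 (.c [2,3,9] [0,7,6,5,4,8,1]) (.s 0 1 3 5 9))) (.s 0 2 4 5 8)) (.s 0 1 3
  5 8))))) (.s 0 2 5 7 9)) (.s 0 2 4 5 7)) (.s 0 2 3 5 7)))) (.b 37 (.b 47 (.b 26 (.c
  [1,2,6,5,4,3,7,8,9] [0]) (.b 58 (.c [3,4,7,6,5,8,9] [0,1,2]) (.b 15 (.c [3,4,7,8,9] [0,6,5,1,2])
  (.b 17 (.b 8 (.b 29 (.c [7,3,4,5,6,1,2,9] [0,8]) (.b 59 (.c [7,4,3,2,1,6,5,9] [0,8]) (.s 0 2 5 7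
  9))) (.b 38 (.b 28 (.b 48 (.b 29 (.c [2,8,9] [0,1,7,6,5,4,3]) (.b 49 (.c [4,8,9]
  [0,1,2,3,7,6,5]) (.b 69 (.c [3,7,8,4,5,6,9] [0,1,2]) (.s 0 2 4 6 9)))) (.s 0 2 4 6 8)) (.s 0 2 4
  6 8)) (.s 0 1 3 5 8))) (.s 0 1 3 5 7))))) (.s 0 2 4 5 7)) (.s 0 2 3 5 7)))) (.b 7 (.b 18 (.b 19
  (.c [1,8,9] [0,7,6,5,4,3,2]) (.b 59 (.c [0,6,7,8,1,2,3,4,5,9] []) (.b 17 (.b 28 (.c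
  [0,1,7,6,5,4,3,2,8,9] []) (.b 48 (.b 15 (.c [0,7,6,5,1,2,3,4,8,9] []) (.b 39 (.b 37 (.b 49 (.c
  [4,8,9] [0,1,2,3,7,6,5]) (.b 29 (.c [2,3,9] [0,7,6,5,4,8,1]) (.b 25 (.b 26 (.c [2,6,5,4,3,7,8,9]
  [0,1]) (.b 8 (.b 69 (.c [0,8,7,1,2,3,4,5,6,9] []) (.s 0 2 4 6 9)) (.s 0 2 4 6 8))) (.s 0 2 4 5
  9)))) (.s 1 3 5 7 9)) (.s 0 1 3 5 9))) (.b 8 (.b 26 (.b 29 (.c [0,1,8,7,6,5,4,3,2,9] []) (.b 69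
  (.c [0,8,7,1,2,3,4,5,6,9] []) (.b 49 (.b 25 (.c [0,1,8,7,6,5,2,3,4,9] []) (.b 37 (.c
  [0,8,1,2,3,7,6,5,4,9] []) (.b 36 (.c [2,3,6,5,4,9] [0,8,7,1]) (.b 27 (.b 15 (.c [2,6,7,8,9]
  [0,1,5,4,3]) (.s 1 3 5 6 9)) (.s 0 2 3 5 7))))) (.s 2 4 6 8 9)))) (.s 0 2 4 6 8)) (.s 0 2 4 6
  8)))) (.b 15 (.b 37 (.b 48 (.c [0,7,6,5,1,2,3,4,8,9] []) (.b 47 (.c [3,4,7,8,9] [0,6,5,1,2]) (.b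
  28 (.c [0,6,7,3,4,5,1,2,8,9] []) (.b 26 (.b 27 (.c [2,6,7,8,9] [0,1,5,4,3]) (.b 25 (.c
  [2,6,5,4,3,7,8,9] [0,1]) (.s 0 2 4 5 7))) (.s 0 2 4 6 8))))) (.s 1 3 5 7 9)) (.s 1 3 5 7 9)))))
  (.b 8 (.b 19 (.c [0,8,7,6,5,4,3,2,1,9] []) (.b 17 (.b 28 (.c [0,1,7,6,5,4,3,2,8,9] []) (.b 69
  (.c [0,8,7,1,2,3,4,5,6,9] []) (.b 48 (.b 15 (.c [0,7,6,5,1,2,3,4,8,9] []) (.b 36 (.b 47 (.c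
  [4,7,8,9] [0,1,2,3,6,5]) (.b 49 (.c [4,8,9] [0,7,1,2,3,6,5]) (.b 14 (.b 59 (.c
  [0,8,7,6,3,2,1,4,5,9] []) (.b 37 (.b 58 (.c [5,4,8,9] [0,1,2,3,7,6]) (.s 1 5 6 8 9)) (.s 1 3 5 7
  9))) (.s 1 4 6 7 9)))) (.b 38 (.b 58 (.b 39 (.b 59 (.b 49 (.c [5,4,9] [0,1,2,3,8,7,6]) (.b 47
  (.c [5,8,9] [0,1,2,3,4,7,6]) (.b 27 (.c [3,8,9] [0,1,2,7,6,5,4]) (.b 29 (.c [2,3,9]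
  [0,8,4,5,6,7,1]) (.s 0 2 4 7 9))))) (.s 1 3 5 6 9)) (.s 1 3 5 6 9)) (.s 1 3 5 6 8)) (.s 1 3 5 6
  8)))) (.b 26 (.b 14 (.b 49 (.b 15 (.c [1,5,4,3,2,6,7,8,9] [0]) (.b 36 (.c [2,3,6,5,4,9]
  [0,8,7,1]) (.b 59 (.c [0,8,7,1,4,3,2,6,5,9] []) (.s 1 3 5 6 9)))) (.s 1 4 6 8 9)) (.s 1 2 4 6
  8)) (.s 0 2 4 6 8))))) (.b 37 (.b 15 (.b 48 (.c [0,7,6,5,1,2,3,4,8,9] []) (.b 28 (.c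
  [0,6,7,3,4,5,1,2,8,9] []) (.b 26 (.b 14 (.c [1,5,4,3,2,6,7,8,9] [0]) (.s 1 2 4 6 8)) (.s 0 2 4 6
  8)))) (.b 59 (.b 38 (.b 49 (.c [5,4,9] [0,1,2,3,8,7,6]) (.b 26 (.c [3,7,8,9] [0,1,2,6,5,4]) (.b
  14 (.c [3,7,8,9] [0,6,5,4,1,2]) (.b 48 (.b 69 (.c [6,5,9] [0,1,2,3,4,8,7]) (.s 1 2 4 6 9)) (.s 1
  2 4 6 8))))) (.b 58 (.b 36 (.b 48 (.c [5,4,8,9] [0,1,2,3,7,6]) (.b 26 (.c [5,8,9]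
  [0,1,2,6,7,3,4]) (.b 14 (.c [0,8,7,6,3,2,1,4,5,9] []) (.s 1 2 4 6 8)))) (.s 1 3 5 6 8)) (.s 0 1
  3 5 8))) (.s 1 3 5 7 9))) (.b 15 (.b 39 (.b 48 (.c [0,7,6,5,1,2,3,4,8,9] []) (.b 28 (.c
  [0,6,7,8,2,1,5,4,3,9] []) (.b 26 (.b 14 (.c [1,5,4,3,2,6,7,8,9] [0]) (.s 1 2 4 6 8)) (.s 0 2 4 6
  8)))) (.s 1 3 5 7 9)) (.s 0 1 3 5 7))))) (.b 48 (.b 15 (.c [0,7,6,5,1,2,3,4,8,9] []) (.b 38 (.b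
  58 (.b 37 (.c [5,4,8,9] [0,1,2,3,7,6]) (.b 17 (.b 28 (.c [0,1,7,6,5,4,3,2,8,9] []) (.b 26 (.b 27
  (.c [2,7,6,5,4,3,8,9] [0,1]) (.b 25 (.c [6,5,2,3,4,8,9] [0,1,7]) (.s 0 2 3 5 7))) (.s 0 2 4 6
  8))) (.s 0 1 3 5 7))) (.s 0 1 3 5 8)) (.s 0 1 3 5 8))) (.b 14 (.b 26 (.b 28 (.b 17 (.c
  [0,1,7,6,5,4,3,2,8,9] []) (.b 15 (.c [1,5,4,3,2,6,7,8,9] [0]) (.b 37 (.b 38 (.c [3,7,8,9]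
  [0,1,2,6,5,4]) (.s 0 1 3 5 8)) (.s 0 1 3 5 7)))) (.s 0 2 4 6 8)) (.s 0 2 4 6 8)) (.s 0 1 4 6
  8))))) (.b 17 (.b 25 (.b 37 (.b 36 (.c [3,6,7,8,9] [0,1,2,5,4]) (.b 26 (.c [2,6,5,4,3,7,8,9]
  [0,1]) (.b 47 (.b 58 (.c [3,4,7,6,5,8,9] [0,1,2]) (.b 15 (.c [3,4,7,8,9] [0,6,5,1,2]) (.b 18 (.b
  38 (.b 8 (.b 29 (.c [0,1,8,7,6,5,4,3,2,9] []) (.b 49 (.c [0,1,8,7,6,5,2,3,4,9] []) (.b 69 (.b 27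
  (.c [0,1,8,7,2,3,4,5,6,9] []) (.s 0 2 4 7 9)) (.s 0 2 4 6 9)))) (.b 28 (.b 48 (.b 29 (.c [2,8,9]
  [0,1,7,6,5,4,3]) (.b 49 (.c [4,8,9] [0,1,2,3,7,6,5]) (.b 69 (.c [3,7,8,4,5,6,9] [0,1,2]) (.s 0 2
  4 6 9)))) (.s 0 2 4 6 8)) (.s 0 2 4 6 8))) (.s 1 3 5 6 8)) (.s 1 3 5 6 8)))) (.b 27 (.b 48 (.c
  [2,3,7,6,5,4,8,9] [0,1]) (.b 8 (.b 28 (.b 29 (.c [2,8,9] [0,1,7,6,5,4,3]) (.b 49 (.b 15 (.c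
  [7,8,2,3,4,9] [0,1,5,6]) (.b 18 (.c [0,1,8,7,6,5,2,3,4,9] []) (.b 58 (.c [5,8,2,3,4,9]
  [0,1,7,6]) (.s 1 3 5 6 8)))) (.s 0 2 4 7 9))) (.s 0 2 4 6 8)) (.s 0 2 4 6 8))) (.s 0 2 4 5
  7))))) (.b 27 (.b 47 (.b 39 (.b 59 (.b 58 (.c [5,8,9] [0,1,2,3,4,7,6]) (.b 38 (.c [3,8,9]
  [0,1,2,7,6,5,4]) (.s 0 3 5 7 8))) (.s 0 3 5 7 9)) (.s 0 3 5 7 9)) (.s 0 3 4 5 7)) (.s 0 2 3 5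
  7))) (.b 27 (.b 37 (.b 47 (.b 48 (.c [2,3,7,6,5,4,8,9] [0,1]) (.b 58 (.c [3,4,7,6,5,8,9]
  [0,1,2]) (.b 26 (.c [4,3,7,8,9] [0,1,2,6,5]) (.b 15 (.c [3,4,7,8,9] [0,6,5,1,2]) (.b 28 (.b 29
  (.c [2,8,9] [0,1,7,6,5,4,3]) (.b 69 (.c [7,3,4,5,6,9] [0,1,2,8]) (.b 49 (.b 59 (.b 38 (.c
  [5,4,9] [0,1,2,3,8,7,6]) (.b 18 (.c [8,1,2,3,4,5,9] [0,6,7]) (.s 0 1 3 5 8))) (.s 0 2 5 7 9))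
  (.s 0 2 4 6 9)))) (.s 0 2 4 5 8)))))) (.s 0 2 4 5 7)) (.s 0 2 3 5 7)) (.s 0 2 3 5 7))) (.b 15
  (.b 37 (.b 47 (.c [3,4,7,8,9] [0,6,5,1,2]) (.b 27 (.b 26 (.c [2,6,7,8,9] [0,1,5,4,3]) (.b 48 (.c
  [2,3,7,6,5,4,8,9] [0,1]) (.b 14 (.c [5,1,4,3,2,7,8,9] [0,6]) (.b 28 (.b 18 (.b 49 (.c
  [7,8,2,3,4,9] [0,1,5,6]) (.b 19 (.c [8,1,9] [0,6,5,4,3,2,7]) (.s 0 1 4 7 9))) (.s 1 2 4 6 8))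
  (.s 0 2 4 6 8))))) (.s 0 2 4 5 7))) (.s 0 1 3 5 7)) (.s 0 1 3 5 7))))) (.b 26 (.b 37 (.b 16 (.c
  [1,2,6,5,4,3,7,8,9] [0]) (.b 25 (.c [2,6,5,4,3,7,8,9] [0,1]) (.b 47 (.c [4,3,7,8,9] [0,1,2,6,5])
  (.b 7 (.b 27 (.b 15 (.c [2,6,7,8,9] [0,1,5,4,3]) (.b 48 (.c [2,3,7,6,5,4,8,9] [0,1]) (.b 36 (.b
  8 (.b 28 (.b 19 (.c [0,8,7,6,5,4,3,2,1,9] []) (.b 17 (.c [0,1,7,6,5,4,3,2,8,9] []) (.b 49 (.c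
  [7,3,6,5,4,9] [0,1,2,8]) (.b 14 (.c [6,7,3,2,8,9] [0,1,4,5]) (.s 1 4 5 7 9))))) (.s 0 2 4 6 8))
  (.s 0 2 4 6 8)) (.s 0 1 3 5 6)))) (.s 0 2 4 5 7)) (.s 0 2 4 5 7))))) (.b 15 (.b 14 (.c
  [1,5,4,3,2,6,7,8,9] [0]) (.b 27 (.c [2,6,7,8,9] [0,1,5,4,3]) (.b 7 (.b 25 (.b 36 (.c
  [1,2,5,4,3,6,7,8,9] [0]) (.b 48 (.c [5,1,2,3,4,8,9] [0,7,6]) (.b 16 (.b 8 (.b 38 (.b 49 (.c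
  [5,1,2,3,4,9] [0,8,7,6]) (.b 69 (.c [1,2,5,4,3,8,7,6,9] [0]) (.b 29 (.c [0,8,7,6,1,5,4,3,2,9]
  []) (.s 0 2 4 6 9)))) (.s 0 3 4 6 8)) (.s 0 2 4 6 8)) (.s 0 1 3 4 6)))) (.s 0 2 3 5 7)) (.s 0 2
  3 5 7)))) (.b 7 (.b 17 (.b 28 (.c [0,1,7,6,5,4,3,2,8,9] []) (.b 8 (.b 48 (.b 19 (.c
  [0,8,7,6,5,4,3,2,1,9] []) (.b 25 (.c [6,5,2,3,4,8,9] [0,1,7]) (.b 27 (.b 39 (.c [7,1,2,3,9]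
  [0,8,4,5,6]) (.s 1 3 5 7 9)) (.s 0 2 3 5 7)))) (.s 0 2 4 6 8)) (.s 0 2 4 6 8))) (.s 0 1 3 5 7))
  (.s 0 1 3 5 7)))) (.b 36 (.b 25 (.b 28 (.b 15 (.c [1,2,5,4,3,6,7,8,9] [0]) (.b 37 (.c
  [3,6,7,8,9] [0,1,2,5,4]) (.b 7 (.b 17 (.c [0,1,7,6,5,4,3,2,8,9] []) (.s 0 1 3 5 7)) (.s 0 1 3 5
  7)))) (.s 0 2 4 6 8)) (.s 0 2 4 5 6)) (.s 0 2 3 4 6))))))))))))))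

set_option maxRecDepth 100000 in
theorem cert_cyc5_ok : check 9 (lfc 5) cert_cyc5
    (ins (ins (ins (ins (ins (ins (ins (ins (ins 0 1) 12) 23) 34) 45) 56) 67) 78) 8) 0 = true := by
  decide +kernel

set_option maxRecDepth 100000 in
theorem cert_cyc7_ok : check 9 (lfc 7) cert_cyc7
    (ins (ins (ins (ins (ins (ins (ins (ins (ins 0 1) 12) 23) 34) 45) 56) 67) 78) 8) 0 = true := by
  decide +kernel

set_option maxRecDepth 100000 in
theorem cert_cyc9_ok : check 9 (lfc 9) cert_cyc9
    (ins (ins (ins (ins (ins (ins (ins (ins (ins 0 1) 12) 23) 34) 45) 56) 67) 78) 8) 0 = true := by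
  decide +kernel

set_option maxRecDepth 100000 in
theorem cert_win10_ok : check 10 lfw cert_win10
    (ins (ins (ins (ins (ins (ins (ins (ins (ins 0 1) 12) 23) 34) 45) 56) 67) 78) 89) 0 = true := by
  decide +kernel

theorem getD_inj (l : List V) (v0 : V) (h : l.Nodup) (i j : ℕ) (hi : i < l.length)
    (hj : j < l.length) (he : l.getD i v0 = l.getD j v0) : i = j := by
  rw [List.getD_eq_getElem _ _ hi, List.getD_eq_getElem _ _ hj] at he
  exact (List.Nodup.getElem_inj_iff h).1 he

theorem nine_good (G : SimpleGraph V) (h5 : FiveI G) (h : CycN G 9) :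
    GoodCyc G 5 ∧ GoodCyc G 7 ∧ GoodCyc G 9 := by
  obtain ⟨x0, T, hp, hn, hl⟩ := h
  obtain ⟨x1, x2, x3, x4, x5, x6, x7, x8, rfl⟩ : ∃ x1 x2 x3 x4 x5 x6 x7 x8,
      T = [x1, x2, x3, x4, x5, x6, x7, x8] := by
    rcases T with _ | ⟨x1, _ | ⟨x2, _ | ⟨x3, _ | ⟨x4, _ | ⟨x5, _ | ⟨x6, _ | ⟨x7, _ | ⟨x8, _ | ⟨x9, T⟩⟩⟩⟩⟩⟩⟩⟩⟩ <;>
      simp at hl ⊢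
  simp only [pth_cons, pth_nil] at hp
  obtain ⟨a0, a1, a2, a3, a4, a5, a6, a7, a8⟩ := hp
  have hf : ∀ i j, i < 9 → j < 9 → [x0, x1, x2, x3, x4, x5, x6, x7, x8].getD i x0 =
      [x0, x1, x2, x3, x4, x5, x6, x7, x8].getD j x0 → i = j :=
    fun i j hi hj => getD_inj _ x0 hn i j (by simpa using hi) (by simpa using hj)
  have hP : Kn G.Adj (fun i => [x0, x1, x2, x3, x4, x5, x6, x7, x8].getD i x0)
      (ins (ins (ins (ins (ins (ins (ins (ins (ins 0 1) 12) 23) 34) 45) 56) 67) 78) 8) := by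
    refine (((((((((Kn.zero _ _).ins 1 ?_).ins 12 ?_).ins 23 ?_).ins 34 ?_).ins 45 ?_).ins 56 ?_).ins
      67 ?_).ins 78 ?_).ins 8 ?_
    exacts [a0, a1, a2, a3, a4, a5, a6, a7, a8.symm]
  refine ⟨?_, ?_, ?_⟩
  · exact check_sound G h5 9 _ hf (lfc 5) _ (fun P X Y => lfc_sound G _ hf 5 P X Y) _ _ _ hP
      (Kn.zero _ _) cert_cyc5_ok
  · exact check_sound G h5 9 _ hf (lfc 7) _ (fun P X Y => lfc_sound G _ hf 7 P X Y) _ _ _ hP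
      (Kn.zero _ _) cert_cyc7_ok
  · exact check_sound G h5 9 _ hf (lfc 9) _ (fun P X Y => lfc_sound G _ hf 9 P X Y) _ _ _ hP
      (Kn.zero _ _) cert_cyc9_ok

theorem ten_good (G : SimpleGraph V) (h5 : FiveI G) (q : ℕ) (h : CycN G (q + 10)) :
    GoodCyc G (q + 10) := by
  obtain ⟨x0, T, hp, hn, hl⟩ := h
  obtain ⟨x1, x2, x3, x4, x5, x6, x7, x8, x9, rest, rfl⟩ : ∃ x1 x2 x3 x4 x5 x6 x7 x8 x9 rest,
      T = x1 :: x2 :: x3 :: x4 :: x5 :: x6 :: x7 :: x8 :: x9 :: rest := by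
    rcases T with _ | ⟨x1, _ | ⟨x2, _ | ⟨x3, _ | ⟨x4, _ | ⟨x5, _ | ⟨x6, _ | ⟨x7, _ | ⟨x8, _ | ⟨x9, T⟩⟩⟩⟩⟩⟩⟩⟩⟩ <;>
      simp at hl ⊢
  simp only [pth_cons] at hp
  obtain ⟨a0, a1, a2, a3, a4, a5, a6, a7, a8, hr⟩ := hp
  have hn' : ([x0, x1, x2, x3, x4, x5, x6, x7, x8, x9] ++ rest).Nodup := by simpa using hn
  obtain ⟨n1, n2, n3⟩ := List.nodup_append.1 hn'
  have hf : ∀ i j, i < 10 → j < 10 → [x0, x1, x2, x3, x4, x5, x6, x7, x8, x9].getD i x0 =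
      [x0, x1, x2, x3, x4, x5, x6, x7, x8, x9].getD j x0 → i = j :=
    fun i j hi hj => getD_inj _ x0 n1 i j (by simpa using hi) (by simpa using hj)
  have hP : Kn G.Adj (fun i => [x0, x1, x2, x3, x4, x5, x6, x7, x8, x9].getD i x0)
      (ins (ins (ins (ins (ins (ins (ins (ins (ins 0 1) 12) 23) 34) 45) 56) 67) 78) 89) := by
    refine (((((((((Kn.zero _ _).ins 1 ?_).ins 12 ?_).ins 23 ?_).ins 34 ?_).ins 45 ?_).ins 56 ?_).ins
      67 ?_).ins 78 ?_).ins 89 ?_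
    exacts [a0, a1, a2, a3, a4, a5, a6, a7, a8]
  have hd : ∀ i, i < 10 → [x0, x1, x2, x3, x4, x5, x6, x7, x8, x9].getD i x0 ∉ rest := by
    intro i hi hm
    have hi' : i < [x0, x1, x2, x3, x4, x5, x6, x7, x8, x9].length := by simpa using hi
    rw [List.getD_eq_getElem _ _ hi'] at hm
    exact n3 _ (List.getElem_mem hi') _ hm rfl
  have hq : rest.length = q := by simp at hl; omega
  rw [← hq]
  exact check_sound G h5 10 _ hf lfw _ (fun P X Y => lfw_sound G _ hf rest hr n2 hd P X Y) _ _ _ hP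
    (Kn.zero _ _) cert_win10_ok

theorem cyc_good (G : SimpleGraph V) (h5 : FiveI G) (q : ℕ) (hq : 9 ≤ q) (h : CycN G q) :
    GoodCyc G q := by
  rcases Nat.eq_or_lt_of_le hq with rfl | hq
  · exact (nine_good G h5 h).2.2
  · obtain ⟨r, rfl⟩ : ∃ r, q = r + 10 := ⟨q - 10, by omega⟩
    exact ten_good G h5 r h

theorem cyc_down (G : SimpleGraph V) (h5 : FiveI G) (k q : ℕ) (hq : 9 ≤ q) (h : CycN G (q + k)) :
    CycN G q := by
  induction k with
  | zero => exact h
  | succ k ih => exact ih (cyc_good G h5 (q + (k + 1)) (by omega) h).down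

/-- a Hamiltonian `[5,3]`-graph has all the good cycles we need -/
theorem good_all (G : SimpleGraph V) (h5 : FiveI G) (n : ℕ) (hn : 9 ≤ n) (h : CycN G n) (m : ℕ)
    (hm : 4 ≤ m) (hmn : m < n) : GoodCyc G (m + 1) ∨ GoodCyc G (m + 2) := by
  have h9 := nine_good G h5 (cyc_down G h5 (n - 9) 9 le_rfl (by rwa [show 9 + (n - 9) = n by omega]))
  by_cases hm8 : 8 ≤ m
  · left
    exact cyc_good G h5 _ (by omega)
      (cyc_down G h5 (n - (m + 1)) (m + 1) (by omega) (by rwa [show m + 1 + (n - (m + 1)) = n by omega]))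
  · have : m = 4 ∨ m = 5 ∨ m = 6 ∨ m = 7 := by omega
    rcases this with rfl | rfl | rfl | rfl
    · exact Or.inl h9.1
    · exact Or.inr h9.2.1
    · exact Or.inl h9.2.1
    · exact Or.inr h9.2.2

/-! ### Hamiltonicity -/

/-- `c, T` is a cycle through all of `S`, with `p` vertices -/
def OnC (G : SimpleGraph V) (S : V → Prop) (p : ℕ) (c : V) (T : List V) : Prop :=
  Pth G c T c ∧ (c :: T).Nodup ∧ (∀ v, S v ↔ v ∈ c :: T) ∧ T.length + 1 = p

/-- a path from `c` to `d` with interior `Q` outside `S` -/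
def RP (G : SimpleGraph V) (S : V → Prop) (c : V) (Q : List V) (d : V) : Prop :=
  Pth G c Q d ∧ Q.Nodup ∧ ∀ q ∈ Q, ¬ S q

/-- standing assumptions: no cycle is longer than `p` -/
structure Ctx (G : SimpleGraph V) (p : ℕ) : Prop where
  five : FiveI G
  mx : ∀ c T, Pth G c T c → (c :: T).Nodup → T.length + 1 ≤ p

section Ham

variable {G : SimpleGraph V} {S : V → Prop} {p : ℕ}

theorem OnC.rot {c d : V} {A B : List V} (h : OnC G S p c (A ++ d :: B)) :
    OnC G S p d (B ++ c :: A) := by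
  obtain ⟨h1, h2, h3, h4⟩ := h
  have hp : (d :: (B ++ c :: A)).Perm (c :: (A ++ d :: B)) := by
    have := List.perm_append_comm (l₁ := d :: B) (l₂ := c :: A)
    simpa using this
  refine ⟨?_, hp.nodup_iff.2 h2, ?_, ?_⟩
  · rw [pth_append] at h1 ⊢; exact h1.symm
  · intro v; rw [h3, hp.mem_iff]
  · simp at h4 ⊢; omega

theorem OnC.rev {c : V} {T : List V} (h : OnC G S p c T) :
    OnC G S p c T.reverse := by
  obtain ⟨h1, h2, h3, h4⟩ := h
  refine ⟨pth_rev _ _ _ _ h1, ?_, ?_, ?_⟩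
  · simpa using h2
  · intro v; rw [h3]; simp
  · simpa using h4

theorem OnC.exists_start {c d : V} {T : List V} (h : OnC G S p c T) (hd : S d) :
    ∃ T', OnC G S p d T' := by
  rcases List.mem_cons.1 ((h.2.2.1 d).1 hd) with rfl | hm
  · exact ⟨T, h⟩
  · obtain ⟨A, B, rfl⟩ := List.append_of_mem hm
    exact ⟨_, h.rot⟩

theorem OnC.exists_split {c d e : V} {T : List V} (h : OnC G S p e T) (hc : S c) (hd : S d)
    (hne : c ≠ d) : ∃ A B, OnC G S p c (A ++ d :: B) := by
  obtain ⟨T', h'⟩ := h.exists_start hc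
  rcases List.mem_cons.1 ((h'.2.2.1 d).1 hd) with rfl | hm
  · exact absurd rfl hne
  · obtain ⟨A, B, rfl⟩ := List.append_of_mem hm
    exact ⟨A, B, h'⟩

theorem RP.rev {c d : V} {Q : List V} (h : RP G S c Q d) : RP G S d Q.reverse c :=
  ⟨pth_rev _ _ _ _ h.1, by simpa using h.2.1, by simpa using h.2.2⟩

open Classical in
theorem Ctx.contra (H : Ctx G p) {c c' : V} {T T' Q : List V} (h : OnC G S p c T)
    (hQ : Q.Nodup) (hQS : ∀ q ∈ Q, ¬ S q) (hP : Pth G c' T' c')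
    (hcount : ∀ a, List.count a (c' :: T') ≤ List.count a (Q ++ c :: T))
    (hl : p ≤ T'.length) : False := by
  have hn : (Q ++ c :: T).Nodup := by
    rw [List.nodup_append]
    refine ⟨hQ, h.2.1, ?_⟩
    rintro a ha b hb rfl
    exact hQS a ha ((h.2.2.1 a).2 hb)
  have := H.mx c' T' hP (by
    rw [List.nodup_iff_count_le_one] at hn ⊢
    exact fun a => (hcount a).trans (hn a))
  omega

theorem Ctx.gap (H : Ctx G p) {c d : V} {A B Q : List V} (h : OnC G S p c (A ++ d :: B))
    (hQ : RP G S c Q d) : Q.length ≤ A.length := by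
  classical
  by_contra hlt
  have h1 := (pth_append _ _ _ _ _ _).1 h.1
  refine H.contra h hQ.2.1 hQ.2.2 (c' := c) (T' := Q ++ d :: B)
    ((pth_append _ _ _ _ _ _).2 ⟨hQ.1, h1.2⟩) ?_ ?_
  · intro a
    simp only [List.count_append, List.count_cons]
    omega
  · have := h.2.2.2
    simp at this ⊢; omega

/-- no outside path joins consecutive vertices -/
theorem Ctx.gap0 (H : Ctx G p) {c d : V} {B : List V} (h : OnC G S p c (d :: B)) (Q : List V)
    (hQ0 : Q ≠ []) (hQ : RP G S c Q d) : False := by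
  have := H.gap (A := []) h hQ
  simp at this
  exact hQ0 this

theorem Ctx.noSucc (H : Ctx G p) {c d s1 s2 : V} {A B Q : List V}
    (h : OnC G S p c (s1 :: A ++ d :: s2 :: B)) (hQ0 : Q ≠ [])
    (hQ : RP G S c Q d) : ¬ G.Adj s1 s2 := by
  classical
  intro hs
  have h1 := h.1
  simp at h1
  have hl := List.length_pos_iff.2 hQ0
  refine H.contra h hQ.2.1 hQ.2.2 (c' := c) (T' := Q ++ d :: (A.reverse ++ s1 :: s2 :: B)) ?_ ?_ ?_
  · simp only [pth_append, pth_cons]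
    exact ⟨hQ.1, pth_rev _ _ _ _ h1.2.1, hs, h1.2.2.2⟩
  · intro a
    simp only [List.count_append, List.count_cons, List.count_reverse]
    omega
  · have := h.2.2.2
    simp at this ⊢; omega

theorem Ctx.cross (H : Ctx G p) {c d s1 s2 t t' : V} {A B Q : List V}
    (h : OnC G S p c (s1 :: t :: t' :: A ++ d :: s2 :: B)) (hQ0 : Q ≠ [])
    (hQ : RP G S c Q d) (ht : G.Adj t s2) (ht' : G.Adj t' s1) : False := by
  classical
  have h1 := h.1
  simp at h1
  have hl := List.length_pos_iff.2 hQ0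
  refine H.contra h hQ.2.1 hQ.2.2 (c' := c)
    (T' := Q ++ d :: (A.reverse ++ t' :: s1 :: t :: s2 :: B)) ?_ ?_ ?_
  · simp only [pth_append, pth_cons]
    exact ⟨hQ.1, pth_rev _ _ _ _ h1.2.2.2.1, ht', h1.2.1, ht, h1.2.2.2.2.2⟩
  · intro a
    simp only [List.count_append, List.count_cons, List.count_reverse]
    omega
  · have := h.2.2.2
    simp at this ⊢; omega

theorem Ctx.noThird (H : Ctx G p) {c d s1 s2 z : V} {A B Q : List V}
    (h : OnC G S p c (s1 :: A ++ d :: s2 :: B)) (hQ0 : Q ≠ [])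
    (hQ : RP G S c Q d) (hz : ¬ S z) (hzQ : z ∉ Q) (h1z : G.Adj z s1) (h2z : G.Adj z s2) :
    False := by
  classical
  have h1 := h.1
  simp at h1
  have hl := List.length_pos_iff.2 hQ0
  refine H.contra h (Q := z :: Q) (List.nodup_cons.2 ⟨hzQ, hQ.2.1⟩) ?_ (c' := c)
    (T' := Q ++ d :: (A.reverse ++ s1 :: z :: s2 :: B)) ?_ ?_ ?_
  · intro q hq
    rcases List.mem_cons.1 hq with rfl | hq
    · exact hz
    · exact hQ.2.2 q hq
  · simp only [pth_append, pth_cons]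
    exact ⟨hQ.1, pth_rev _ _ _ _ h1.2.1, h1z.symm, h2z, h1.2.2.2⟩
  · intro a
    simp only [List.count_append, List.count_cons, List.count_reverse]
    omega
  · have := h.2.2.2
    simp at this ⊢; omega

theorem ind_zero {a b : V} (h : ¬ G.Adj a b) : ind G a b = 0 := by simp [ind, h]
theorem ind_le (a b : V) : ind G a b ≤ 1 := by unfold ind; split_ifs <;> simp
theorem ind_pos {a b : V} (h : ind G a b ≠ 0) : G.Adj a b := by
  by_contra hh; exact h (ind_zero hh)

theorem two_of (h5 : FiveI G) {x y s1 s2 u : V} (hn : [x, y, s1, s2, u].Nodup)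
    (a1 : ¬ G.Adj x s1) (a2 : ¬ G.Adj x s2) (a3 : ¬ G.Adj y s1) (a4 : ¬ G.Adj y s2)
    (a5 : ¬ G.Adj s1 s2) : 2 ≤ ind G x u + ind G y u + ind G s1 u + ind G s2 u := by
  have := h5 _ _ _ _ _ hn
  have := ind_le (G := G) x y
  have := ind_zero a1
  have := ind_zero a2
  have := ind_zero a3
  have := ind_zero a4
  have := ind_zero a5
  omega

theorem three_of (h5 : FiveI G) {x y s1 s2 u : V} (hn : [x, y, s1, s2, u].Nodup)
    (a1 : ¬ G.Adj x s1) (a2 : ¬ G.Adj x s2) (a3 : ¬ G.Adj y s1) (a4 : ¬ G.Adj y s2)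
    (a5 : ¬ G.Adj s1 s2) (a6 : ¬ G.Adj x y) :
    3 ≤ ind G x u + ind G y u + ind G s1 u + ind G s2 u := by
  have := h5 _ _ _ _ _ hn
  have := ind_zero a1
  have := ind_zero a2
  have := ind_zero a3
  have := ind_zero a4
  have := ind_zero a5
  have := ind_zero a6
  omega

theorem both_of (h5 : FiveI G) {x y s1 s2 u : V} (hn : [x, y, s1, s2, u].Nodup)
    (a1 : ¬ G.Adj x s1) (a2 : ¬ G.Adj x s2) (a3 : ¬ G.Adj y s1) (a4 : ¬ G.Adj y s2)
    (a5 : ¬ G.Adj s1 s2) (a6 : ¬ G.Adj x u) (a7 : ¬ G.Adj y u) : G.Adj s1 u ∧ G.Adj s2 u := by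
  have := two_of h5 hn a1 a2 a3 a4 a5
  have := ind_zero a6
  have := ind_zero a7
  have := ind_le (G := G) s1 u
  have := ind_le (G := G) s2 u
  exact ⟨ind_pos (by omega), ind_pos (by omega)⟩

theorem rp_one {c d x : V} (hx : ¬ S x) (h1 : G.Adj c x) (h2 : G.Adj x d) : RP G S c [x] d :=
  ⟨⟨h1, h2⟩, by simp, by simpa using hx⟩

theorem rp_two {c d x y : V} (hx : ¬ S x) (hy : ¬ S y) (h1 : G.Adj c x) (h2 : G.Adj x y)
    (h3 : G.Adj y d) : RP G S c [x, y] d :=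
  ⟨⟨h1, h2, h3⟩, by simpa using h2.ne, by simp [hx, hy]⟩

theorem rp_three {c d x y z : V} (hx : ¬ S x) (hy : ¬ S y) (hz : ¬ S z) (hxz : x ≠ z)
    (h1 : G.Adj c x) (h2 : G.Adj x y)
    (h3 : G.Adj y z) (h4 : G.Adj z d) : RP G S c [x, y, z] d :=
  ⟨⟨h1, h2, h3, h4⟩, by simp [h2.ne, h3.ne, hxz], by simp [hx, hy, hz]⟩

theorem exists_not_mem_list [Fintype V] (l : List V) (h : l.length < Fintype.card V) :
    ∃ v, v ∉ l := by
  classical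
  by_contra hh
  push Not at hh
  have h1 : (Finset.univ : Finset V) ⊆ l.toFinset := fun v _ => by simpa using hh v
  have h2 := Finset.card_le_card h1
  have h3 := List.toFinset_card_le l
  rw [Finset.card_univ] at h2
  omega

open Classical in
theorem OnC.nodup {c : V} {T Q l : List V} (h : OnC G S p c T)
    (hQ : Q.Nodup) (hQS : ∀ q ∈ Q, ¬ S q)
    (hcount : ∀ a, List.count a l ≤ List.count a (Q ++ c :: T)) : l.Nodup := by
  have hn : (Q ++ c :: T).Nodup := by
    rw [List.nodup_append]
    refine ⟨hQ, h.2.1, ?_⟩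
    rintro a ha b hb rfl
    exact hQS a ha ((h.2.2.1 a).2 hb)
  rw [List.nodup_iff_count_le_one] at hn ⊢
  exact fun a => (hcount a).trans (hn a)

/-- three neighbours on the cycle: first part of the analysis -/
theorem Ctx.three_gap (H : Ctx G p) {x c1 c2 c3 s1 s2 s3 : V} {A1 A2 A3 : List V}
    (h : OnC G S p c1 (s1 :: A1 ++ c2 :: (s2 :: A2 ++ c3 :: s3 :: A3))) (hx : ¬ S x)
    (x1 : G.Adj x c1) (x2 : G.Adj x c2) (x3 : G.Adj x c3)
    (a12 : ¬ G.Adj s1 s2) (a13 : ¬ G.Adj s1 s3) (a23 : ¬ G.Adj s2 s3)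
    (b1 : ¬ G.Adj x s1) (b2 : ¬ G.Adj x s2) (b3 : ¬ G.Adj x s3) : A1 = [] := by
  classical
  rcases List.eq_nil_or_concat A1 with h0 | ⟨M, q, hM⟩
  · exact h0
  exfalso
  rw [List.concat_eq_append] at hM
  subst hM
  have hP := h.1
  simp at hP
  obtain ⟨e1, e2, e3, e4, e5, e6, e7⟩ := hP
  have hq : ¬ G.Adj x q := by
    intro hxq
    have h' : OnC G S p c1 ((s1 :: M) ++ q :: (c2 :: (s2 :: A2 ++ c3 :: s3 :: A3))) := by
      simpa using h
    exact H.gap0 h'.rot [x] (by simp) (rp_one hx hxq.symm x2)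
  have hx1 : ∀ v ∈ [x], ¬ S v := by simpa using hx
  have n1 : [x, s1, s2, s3, q].Nodup := by
    refine h.nodup (Q := [x]) (by simp) hx1 ?_
    intro a
    simp only [List.count_append, List.count_cons, List.count_nil]
    omega
  have n2 : [x, s1, s2, s3, c2].Nodup := by
    refine h.nodup (Q := [x]) (by simp) hx1 ?_
    intro a
    simp only [List.count_append, List.count_cons, List.count_nil]
    omega
  have t1 := three_of H.five n1 b2 b3 a12 a13 a23 b1
  have t2 := three_of H.five n2 b2 b3 a12 a13 a23 b1
  have z1 := ind_zero hq
  have := ind_le (G := G) s1 q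
  have := ind_le (G := G) s2 q
  have := ind_le (G := G) s3 q
  have := ind_le (G := G) x c2
  have := ind_le (G := G) s2 c2
  have q1 : G.Adj s1 q := ind_pos (by omega)
  have q2 : G.Adj s2 q := ind_pos (by omega)
  have hor : G.Adj s1 c2 ∨ G.Adj s3 c2 := by
    by_contra hh
    rw [not_or] at hh
    have := ind_zero hh.1
    have := ind_zero hh.2
    omega
  have hlen := h.2.2.2
  rcases hor with hc | hc
  · refine H.contra h (Q := [x]) (by simp) hx1 (c' := x)
      (T' := c1 :: (A3.reverse ++ s3 :: c3 :: (A2.reverse ++ s2 :: q :: (M.reverse ++ s1 :: [c2]))))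
      ?_ ?_ ?_
    · simp only [pth_append, pth_cons, pth_nil]
      exact ⟨x1, pth_rev _ _ _ _ e7, e6.symm, pth_rev _ _ _ _ e5, q2, pth_rev _ _ _ _ e2, hc,
        x2.symm⟩
    · intro a
      simp only [List.count_append, List.count_cons, List.count_reverse, List.count_nil]
      omega
    · simp at hlen ⊢; omega
  · refine H.contra h (Q := [x]) (by simp) hx1 (c' := x)
      (T' := c3 :: (A2.reverse ++ s2 :: q :: (M.reverse ++ s1 :: c1 :: (A3.reverse ++ s3 :: [c2]))))
      ?_ ?_ ?_
    · simp only [pth_append, pth_cons, pth_nil]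
      exact ⟨x3, pth_rev _ _ _ _ e5, q2, pth_rev _ _ _ _ e2, e1.symm, pth_rev _ _ _ _ e7, hc,
        x2.symm⟩
    · intro a
      simp only [List.count_append, List.count_cons, List.count_reverse, List.count_nil]
      omega
    · simp at hlen ⊢; omega

/-- no outside vertex has three neighbours on the cycle -/
theorem Ctx.no_three_aux [Fintype V] (hcard : 9 ≤ Fintype.card V) (H : Ctx G p)
    {x c1 c2 c3 : V} {A1 A2 A3 : List V}
    (h : OnC G S p c1 (A1 ++ c2 :: (A2 ++ c3 :: A3))) (hx : ¬ S x)
    (x1 : G.Adj x c1) (x2 : G.Adj x c2) (x3 : G.Adj x c3) : False := by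
  classical
  have h' : OnC G S p c2 (A2 ++ c3 :: (A3 ++ c1 :: A1)) := by simpa using h.rot
  have h'' : OnC G S p c3 (A3 ++ c1 :: (A1 ++ c2 :: A2)) := by simpa using h'.rot
  rcases A1 with _ | ⟨s1, A1⟩
  · exact H.gap0 h [x] (by simp) (rp_one hx x1.symm x2)
  rcases A2 with _ | ⟨s2, A2⟩
  · exact H.gap0 h' [x] (by simp) (rp_one hx x2.symm x3)
  rcases A3 with _ | ⟨s3, A3⟩
  · exact H.gap0 h'' [x] (by simp) (rp_one hx x3.symm x1)
  have b1 : ¬ G.Adj x s1 := fun hh => H.gap0 h [x] (by simp) (rp_one hx x1.symm hh)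
  have b2 : ¬ G.Adj x s2 := fun hh => H.gap0 h' [x] (by simp) (rp_one hx x2.symm hh)
  have b3 : ¬ G.Adj x s3 := fun hh => H.gap0 h'' [x] (by simp) (rp_one hx x3.symm hh)
  have a12 : ¬ G.Adj s1 s2 := H.noSucc h (by simp) (rp_one hx x1.symm x2)
  have a23 : ¬ G.Adj s2 s3 := H.noSucc h' (by simp) (rp_one hx x2.symm x3)
  have a31 : ¬ G.Adj s3 s1 := H.noSucc h'' (by simp) (rp_one hx x3.symm x1)
  have a21 : ¬ G.Adj s2 s1 := fun hh => a12 hh.symm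
  have a32 : ¬ G.Adj s3 s2 := fun hh => a23 hh.symm
  have a13 : ¬ G.Adj s1 s3 := fun hh => a31 hh.symm
  obtain rfl := H.three_gap h hx x1 x2 x3 a12 a13 a23 b1 b2 b3
  obtain rfl := H.three_gap h' hx x2 x3 x1 a23 a21 a31 b2 b3 b1
  obtain rfl := H.three_gap h'' hx x3 x1 x2 a31 a32 a12 b3 b1 b2
  obtain ⟨y, hy⟩ := exists_not_mem_list [x, c1, s1, c2, s2, c3, s3] (by simp; omega)
  have hyS : ¬ S y := by
    intro hh
    have := (h.2.2.1 y).1 hh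
    simp at this hy
    tauto
  have hxy : x ≠ y := by
    rintro rfl
    simp at hy
  have hQ : ∀ v ∈ [x, y], ¬ S v := by simp [hx, hyS]
  have n1 : [x, s1, s2, s3, y].Nodup := by
    refine h.nodup (Q := [x, y]) (by simpa using hxy) hQ ?_
    intro a
    simp only [List.count_append, List.count_cons, List.count_nil]
    omega
  have t1 := three_of H.five n1 b2 b3 a12 a13 a23 b1
  by_cases hadj : G.Adj x y
  · have g1 : ¬ G.Adj s1 y := fun hh =>
      H.gap0 h [x, y] (by simp) (rp_two hx hyS x1.symm hadj hh.symm)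
    have g2 : ¬ G.Adj s2 y := fun hh =>
      H.gap0 h' [x, y] (by simp) (rp_two hx hyS x2.symm hadj hh.symm)
    have := ind_zero g1
    have := ind_zero g2
    have := ind_le (G := G) x y
    have := ind_le (G := G) s3 y
    omega
  · have := ind_zero hadj
    have := ind_le (G := G) s1 y
    have := ind_le (G := G) s2 y
    have := ind_le (G := G) s3 y
    have y1 : G.Adj s1 y := ind_pos (by omega)
    have y3 : G.Adj s3 y := ind_pos (by omega)
    have hP := h.1
    simp at hP
    obtain ⟨e1, e2, e3, e4, e5, e6⟩ := hP
    have hlen := h.2.2.2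
    refine H.contra h (Q := [x, y]) (by simpa using hxy) hQ (c' := x)
      (T' := [c1, s1, y, s3, c3, s2, c2]) ?_ ?_ ?_
    · exact ⟨x1, e1, y1, y3.symm, e5.symm, e4.symm, e3.symm, x2.symm⟩
    · intro a
      simp only [List.count_append, List.count_cons, List.count_nil]
      omega
    · simp at hlen ⊢; omega

theorem Ctx.no_three [Fintype V] (hcard : 9 ≤ Fintype.card V) (H : Ctx G p)
    {x c c1 c2 c3 : V} {T : List V} (h : OnC G S p c T) (hx : ¬ S x)
    (k1 : S c1) (k2 : S c2) (k3 : S c3) (n12 : c1 ≠ c2) (n13 : c1 ≠ c3) (n23 : c2 ≠ c3)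
    (x1 : G.Adj x c1) (x2 : G.Adj x c2) (x3 : G.Adj x c3) : False := by
  obtain ⟨A, B, h'⟩ := h.exists_split k1 k2 n12
  have hm := (h'.2.2.1 c3).1 k3
  simp only [List.mem_cons, List.mem_append] at hm
  rcases hm with hm | hm | hm | hm
  · exact n13 hm.symm
  · obtain ⟨X, Y, rfl⟩ := List.append_of_mem hm
    exact H.no_three_aux hcard (by simpa using h') hx x1 x3 x2
  · exact n23 hm.symm
  · obtain ⟨X, Y, rfl⟩ := List.append_of_mem hm
    exact H.no_three_aux hcard h' hx x1 x2 x3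

/-- an outside vertex of degree at least three has an outside neighbour -/
theorem Ctx.out_nbr [Fintype V] [DecidableRel G.Adj] (hcard : 9 ≤ Fintype.card V) (H : Ctx G p)
    {x c : V} {T : List V} (h : OnC G S p c T) (hx : ¬ S x) (hd : 3 ≤ G.degree x) :
    ∃ y, ¬ S y ∧ G.Adj x y := by
  have h2 : 2 < (G.neighborFinset x).card := by
    rw [SimpleGraph.card_neighborFinset_eq_degree]; omega
  obtain ⟨a, ha, b, hb, c', hc, n1, n2, n3⟩ := Finset.two_lt_card.1 h2
  rw [SimpleGraph.mem_neighborFinset] at ha hb hc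
  by_contra hh
  push Not at hh
  have s1 : S a := by by_contra h'; exact hh a h' ha
  have s2 : S b := by by_contra h'; exact hh b h' hb
  have s3 : S c' := by by_contra h'; exact hh c' h' hc
  exact H.no_three hcard h hx s1 s2 s3 n1 n2 n3 ha hb hc

/-- short gaps -/
theorem Ctx.short (H : Ctx G p) {c d x y : V} {A B Q : List V}
    (h : OnC G S p c (A ++ d :: B)) (hQ0 : Q ≠ []) (hQ : RP G S c Q d)
    (hx : ¬ S x) (hy : ¬ S y) (hxy : x ≠ y)
    (hxn : ∀ v, S v → v ≠ c → v ≠ d → ¬ G.Adj x v)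
    (hyn : ∀ v, S v → v ≠ c → v ≠ d → ¬ G.Adj y v) : A.length ≤ 2 := by
  classical
  by_contra hlt
  rcases A with _ | ⟨s1, _ | ⟨t, _ | ⟨t', A⟩⟩⟩ <;> try simp at hlt
  rcases B with _ | ⟨s2, B⟩
  · exact H.gap0 (by simpa using h.rot) _ (by simpa using hQ0) hQ.rev
  have hs := H.noSucc (A := t :: t' :: A) h hQ0 hQ
  have hQQ : ∀ v ∈ [x, y], ¬ S v := by simp [hx, hy]
  have n0 : [c, d, s1, s2, t, t'].Nodup := by
    refine h.nodup (Q := []) (by simp) (by simp) ?_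
    intro a
    simp only [List.count_append, List.count_cons, List.count_nil]
    omega
  have n1 : [x, y, s1, s2, t].Nodup := by
    refine h.nodup (Q := [x, y]) (by simpa using hxy) hQQ ?_
    intro a
    simp only [List.count_append, List.count_cons, List.count_nil]
    omega
  have n2 : [x, y, s1, s2, t'].Nodup := by
    refine h.nodup (Q := [x, y]) (by simpa using hxy) hQQ ?_
    intro a
    simp only [List.count_append, List.count_cons, List.count_nil]
    omega
  have m : ∀ v ∈ [s1, s2, t, t'], S v ∧ v ≠ c ∧ v ≠ d := by
    intro v hv
    refine ⟨(h.2.2.1 v).2 ?_, ?_, ?_⟩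
    · simp at hv ⊢; tauto
    · rintro rfl; simp at hv n0; tauto
    · rintro rfl; simp at hv n0; tauto
  have k : ∀ v ∈ [s1, s2, t, t'], ¬ G.Adj x v ∧ ¬ G.Adj y v := fun v hv =>
    ⟨hxn v (m v hv).1 (m v hv).2.1 (m v hv).2.2, hyn v (m v hv).1 (m v hv).2.1 (m v hv).2.2⟩
  simp only [List.forall_mem_cons] at k
  obtain ⟨k1, k2, k3, k4, -⟩ := k
  have r1 := both_of H.five n1 k1.1 k2.1 k1.2 k2.2 hs k3.1 k3.2
  have r2 := both_of H.five n2 k1.1 k2.1 k1.2 k2.2 hs k4.1 k4.2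
  exact H.cross h hQ0 hQ r1.2.symm r2.1.symm

theorem Ctx.small (H : Ctx G p) {c d x y : V} {A B Q : List V}
    (h : OnC G S p c (A ++ d :: B)) (hQ0 : Q ≠ []) (hQ : RP G S c Q d)
    (hx : ¬ S x) (hy : ¬ S y) (hxy : x ≠ y)
    (hxn : ∀ v, S v → v ≠ c → v ≠ d → ¬ G.Adj x v)
    (hyn : ∀ v, S v → v ≠ c → v ≠ d → ¬ G.Adj y v) : A.length ≤ 2 ∧ B.length ≤ 2 :=
  ⟨H.short h hQ0 hQ hx hy hxy hxn hyn,
    H.short h.rot (by simpa using hQ0) hQ.rev hx hy hxy (fun v a b c => hxn v a c b)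
      (fun v a b c => hyn v a c b)⟩

/-- another outside vertex -/
theorem OnC.exists_out [Fintype V] (hcard : 9 ≤ Fintype.card V) {c d : V} {A B : List V}
    (h : OnC G S p c (A ++ d :: B)) (hs : A.length ≤ 2 ∧ B.length ≤ 2) (x y : V) :
    ∃ z, ¬ S z ∧ z ≠ x ∧ z ≠ y := by
  obtain ⟨z, hz⟩ := exists_not_mem_list (x :: y :: c :: (A ++ d :: B)) (by simp; omega)
  refine ⟨z, fun hh => hz ?_, ?_, ?_⟩
  · have := (h.2.2.1 z).1 hh
    exact List.mem_cons_of_mem _ (List.mem_cons_of_mem _ this)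
  · rintro rfl; simp at hz
  · rintro rfl; simp at hz

/-- the vertices `x, y` joined, with neighbours `c` of `x` and `d` of `y`, or both of `x` -/
theorem Ctx.third (H : Ctx G p) {c d x y z w : V} {A B : List V}
    (h : OnC G S p c (A ++ d :: B))
    (hx : ¬ S x) (hy : ¬ S y) (hz : ¬ S z) (hzx : z ≠ x) (hzy : z ≠ y) (hxy : G.Adj x y)
    (hcx : G.Adj c x) (hw : w = x ∨ w = y) (hdw : G.Adj d w) :
    G.Adj x z ∧ G.Adj y z := by
  classical
  obtain ⟨Q, hQ0, hQz, hQ⟩ : ∃ Q : List V, Q ≠ [] ∧ z ∉ Q ∧ RP G S c Q d := by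
    rcases hw with rfl | rfl
    · exact ⟨[w], by simp, by simpa using hzx, rp_one hx hcx hdw.symm⟩
    · exact ⟨[x, w], by simp, by simp [hzx, hzy], rp_two hx hy hcx hxy hdw.symm⟩
  rcases A with _ | ⟨s1, A⟩
  · exact (H.gap0 h Q hQ0 hQ).elim
  rcases B with _ | ⟨s2, B⟩
  · exact (H.gap0 (by simpa using h.rot) _ (by simpa using hQ0) hQ.rev).elim
  have h' : OnC G S p d (s2 :: (B ++ c :: s1 :: A)) := h.rot
  have hs := H.noSucc h hQ0 hQ
  have a1 : ¬ G.Adj x s1 := fun hh => H.gap0 h [x] (by simp) (rp_one hx hcx hh)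
  have a2 : ¬ G.Adj y s1 := fun hh => H.gap0 h [x, y] (by simp) (rp_two hx hy hcx hxy hh)
  have a3 : ¬ G.Adj x s2 := fun hh => by
    rcases hw with rfl | rfl
    · exact H.gap0 h' [w] (by simp) (rp_one hx hdw hh)
    · exact H.gap0 h' [w, x] (by simp) (rp_two hy hx hdw hxy.symm hh)
  have a4 : ¬ G.Adj y s2 := fun hh => by
    rcases hw with rfl | rfl
    · exact H.gap0 h' [w, y] (by simp) (rp_two hx hy hdw hxy hh)
    · exact H.gap0 h' [w] (by simp) (rp_one hy hdw hh)
  have n1 : [x, y, s1, s2, z].Nodup := by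
    refine h.nodup (Q := [x, y, z]) (by simp [hxy.ne, hzx.symm, hzy.symm]) (by simp [hx, hy, hz]) ?_
    intro a
    simp only [List.count_append, List.count_cons, List.count_nil]
    omega
  have t := two_of H.five n1 a1 a3 a2 a4 hs
  have l1 := ind_le (G := G) x z
  have l2 := ind_le (G := G) y z
  have l3 := ind_le (G := G) s1 z
  have l4 := ind_le (G := G) s2 z
  by_cases e1 : G.Adj s1 z
  · exfalso
    have b1 : ¬ G.Adj s2 z := fun hh => H.noThird h hQ0 hQ hz hQz e1.symm hh.symm
    have b2 : ¬ G.Adj x z := fun hh =>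
      H.gap0 h [x, z] (by simp) (rp_two hx hz hcx hh e1.symm)
    have b3 : ¬ G.Adj y z := fun hh =>
      H.gap0 h [x, y, z] (by simp) (rp_three hx hy hz hzx.symm hcx hxy hh e1.symm)
    have := ind_zero b1
    have := ind_zero b2
    have := ind_zero b3
    omega
  by_cases e2 : G.Adj s2 z
  · exfalso
    have b2 : ¬ G.Adj x z := fun hh => by
      rcases hw with rfl | rfl
      · exact H.gap0 h' [w, z] (by simp) (rp_two hx hz hdw hh e2.symm)
      · exact H.gap0 h' [w, x, z] (by simp) (rp_three hy hx hz hzy.symm hdw hxy.symm hh e2.symm)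
    have b3 : ¬ G.Adj y z := fun hh => by
      rcases hw with rfl | rfl
      · exact H.gap0 h' [w, y, z] (by simp) (rp_three hx hy hz hzx.symm hdw hxy hh e2.symm)
      · exact H.gap0 h' [w, z] (by simp) (rp_two hy hz hdw hh e2.symm)
    have := ind_zero e1
    have := ind_zero b2
    have := ind_zero b3
    omega
  have := ind_zero e1
  have := ind_zero e2
  exact ⟨ind_pos (by omega), ind_pos (by omega)⟩

/-- adjacent outside vertices cannot attach (in different places) to the cycle -/
theorem Ctx.no_adj [Fintype V] (hcard : 9 ≤ Fintype.card V) (H : Ctx G p) {c d x y : V}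
    {A B : List V} (h : OnC G S p c (A ++ d :: B))
    (hone : ∀ u, ¬ S u → ∀ a b, S a → S b → G.Adj u a → G.Adj u b → a = b)
    (hx : ¬ S x) (hy : ¬ S y) (hxy : G.Adj x y) (hcx : G.Adj c x) (hdy : G.Adj d y) : False := by
  have hc : S c := (h.2.2.1 c).2 (by simp)
  have hd : S d := (h.2.2.1 d).2 (by simp)
  have hs := H.small h (by simp) (rp_two hx hy hcx hxy hdy.symm) hx hy hxy.ne
    (fun v h1 h2 _ h4 => h2 (hone x hx v c h1 hc h4 hcx.symm))
    (fun v h1 _ h3 h4 => h3 (hone y hy v d h1 hd h4 hdy.symm))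
  obtain ⟨z, hz, hzx, hzy⟩ := h.exists_out hcard hs x y
  obtain ⟨r1, r2⟩ := H.third h hx hy hz hzx hzy hxy hcx (Or.inr rfl) hdy
  have := H.gap h (rp_three hx hz hy hxy.ne hcx r1 r2.symm hdy.symm)
  simp at this
  omega

/-- claim (ii): an outside neighbour of `x` sees only `c` and `d`, one gap -/
theorem Ctx.far_aux [Fintype V] (hcard : 9 ≤ Fintype.card V) (H : Ctx G p) {c d x y t : V}
    {A0 A1 B : List V} (h : OnC G S p c ((A0 ++ t :: A1) ++ d :: B))
    (hx : ¬ S x) (hy : ¬ S y) (hxy : G.Adj x y) (hcx : G.Adj c x) (hdx : G.Adj d x)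
    (hyt : G.Adj y t) : False := by
  classical
  have g : OnC G S p c (A0 ++ t :: (A1 ++ d :: B)) := by simpa using h
  have g' : OnC G S p t (A1 ++ d :: (B ++ c :: A0)) := by simpa using g.rot
  have g'' : OnC G S p d (B ++ c :: (A0 ++ t :: A1)) := by simpa using g'.rot
  rcases A0 with _ | ⟨s1, A0⟩
  · exact H.gap0 g [x, y] (by simp) (rp_two hx hy hcx hxy hyt)
  rcases A1 with _ | ⟨u, A1⟩
  · exact H.gap0 g' [y, x] (by simp) (rp_two hy hx hyt.symm hxy.symm hdx.symm)
  rcases B with _ | ⟨s2, B⟩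
  · exact H.gap0 g'' [x] (by simp) (rp_one hx hdx hcx.symm)
  have hc : S c := (h.2.2.1 c).2 (by simp)
  have hd : S d := (h.2.2.1 d).2 (by simp)
  have hu : S u := (h.2.2.1 u).2 (by simp)
  have n0 : [c, d, u].Nodup := by
    refine h.nodup (Q := []) (by simp) (by simp) ?_
    intro a
    simp only [List.count_append, List.count_cons, List.count_nil]
    omega
  have n1 : [x, y, s1, s2, u].Nodup := by
    refine h.nodup (Q := [x, y]) (by simpa using hxy.ne) (by simp [hx, hy]) ?_
    intro a
    simp only [List.count_append, List.count_cons, List.count_nil]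
    omega
  simp at n0
  have hQ := rp_one hx hcx hdx.symm
  have hs := H.noSucc (s1 := s1) (A := A0 ++ t :: u :: A1) (by simpa using h) (by simp) hQ
  have a1 : ¬ G.Adj x s1 := fun hh => H.gap0 g [x] (by simp) (rp_one hx hcx hh)
  have a2 : ¬ G.Adj y s1 := fun hh => H.gap0 g [x, y] (by simp) (rp_two hx hy hcx hxy hh)
  have a3 : ¬ G.Adj x s2 := fun hh => H.gap0 g'' [x] (by simp) (rp_one hx hdx hh)
  have a4 : ¬ G.Adj y s2 := fun hh => H.gap0 g'' [x, y] (by simp) (rp_two hx hy hdx hxy hh)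
  have a5 : ¬ G.Adj y u := fun hh => H.gap0 g' [y] (by simp) (rp_one hy hyt.symm hh)
  have a6 : ¬ G.Adj x u := fun hh =>
    H.no_three hcard h hx hc hd hu n0.1.1 n0.1.2 n0.2 hcx.symm hdx.symm hh
  have r := both_of H.five n1 a1 a3 a2 a4 hs a6 a5
  exact H.noSucc g' (by simp) (rp_two hy hx hyt.symm hxy.symm hdx.symm) r.2.symm

theorem Ctx.far [Fintype V] (hcard : 9 ≤ Fintype.card V) (H : Ctx G p) {c d x y t : V}
    {A B : List V} (h : OnC G S p c (A ++ d :: B))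
    (hx : ¬ S x) (hy : ¬ S y) (hxy : G.Adj x y) (hcx : G.Adj c x) (hdx : G.Adj d x)
    (ht : S t) (htc : t ≠ c) (htd : t ≠ d) : ¬ G.Adj y t := by
  intro hyt
  have hm := (h.2.2.1 t).1 ht
  simp only [List.mem_cons, List.mem_append] at hm
  rcases hm with hm | hm | hm | hm
  · exact htc hm
  · obtain ⟨X, Y, rfl⟩ := List.append_of_mem hm
    exact H.far_aux hcard h hx hy hxy hcx hdx hyt
  · exact htd hm
  · obtain ⟨X, Y, rfl⟩ := List.append_of_mem hm
    exact H.far_aux hcard h.rot hx hy hxy hdx hcx hyt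

/-- boundary edges avoiding a vertex -/
theorem boundary [Fintype V] (h2 : TwoConnected G) (P : V → Prop) (w a b : V)
    (ha : P a) (hb : ¬ P b) (haw : a ≠ w) (hbw : b ≠ w) :
    ∃ u v, P u ∧ ¬ P v ∧ u ≠ w ∧ v ≠ w ∧ G.Adj u v := by
  obtain ⟨q⟩ := (h2.2 w).preconnected ⟨a, haw⟩ ⟨b, hbw⟩
  obtain ⟨e, -, h1, h3⟩ := q.exists_boundary_dart {u | P u.1} ha hb
  exact ⟨e.fst.1, e.snd.1, h1, h3, e.fst.2, e.snd.2, e.adj⟩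

/-- each outside vertex has at most one neighbour on the cycle -/
theorem Ctx.one [Fintype V] [DecidableRel G.Adj] (h2 : TwoConnected G)
    (hδ : ∀ v : V, 3 ≤ G.degree v) (hcard : 9 ≤ Fintype.card V) (H : Ctx G p)
    {e : V} {T : List V} (h0 : OnC G S p e T) :
    ∀ x, ¬ S x → ∀ c d, S c → S d → G.Adj x c → G.Adj x d → c = d := by
  intro x hx c d hc hd hxc hxd
  by_contra hne
  obtain ⟨A, B, h⟩ := h0.exists_split hc hd hne
  have hcx := hxc.symm
  have hdx := hxd.symm
  have hxn : ∀ v, S v → v ≠ c → v ≠ d → ¬ G.Adj x v := fun v hv v1 v2 hh =>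
    H.no_three hcard h hx hc hd hv hne v1.symm v2.symm hxc hxd hh
  obtain ⟨y, hy, hxy⟩ := H.out_nbr hcard h hx (hδ x)
  have hs := H.small h (by simp) (rp_one hx hcx hxd) hx hy hxy.ne hxn
    (fun v => H.far hcard h hx hy hxy hcx hdx)
  have hall : ∀ z, ¬ S z → z ≠ x → G.Adj x z := by
    intro z hz hzx
    by_cases hzy : z = y
    · rw [hzy]; exact hxy
    · exact (H.third h hx hy hz hzx hzy hxy hcx (Or.inl rfl) hdx).1
  obtain ⟨u, v, hu, hv, hux, hvx, huv⟩ := boundary h2 S x c y hc hy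
    (by rintro rfl; exact hx hc) hxy.ne.symm
  have hxv := hall v hv hvx
  obtain ⟨z, hz, hzx, hzv⟩ := h.exists_out hcard hs x v
  obtain ⟨r1, r2⟩ := H.third h hx hv hz hzx hzv hxv hcx (Or.inl rfl) hdx
  by_cases e1 : u = c
  · subst e1
    have := H.gap h (rp_three hv hz hx hvx huv r2 r1.symm hxd)
    simp at this
    omega
  by_cases e2 : u = d
  · subst e2
    have := H.gap h (rp_three hx hz hv hvx.symm hcx r1 r2.symm huv.symm)
    simp at this
    omega
  exact H.far hcard h hx hv hxv hcx hdx hu e1 e2 huv.symm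

/-- the longest cycle is Hamiltonian -/
theorem Ctx.ham [Fintype V] [DecidableRel G.Adj] (h2 : TwoConnected G)
    (hδ : ∀ v : V, 3 ≤ G.degree v) (hcard : 9 ≤ Fintype.card V) (H : Ctx G p) (hp : 4 ≤ p)
    {e : V} {T : List V} (h0 : OnC G S p e T) (r : V) (hr : ¬ S r) : False := by
  classical
  have hone := H.one h2 hδ hcard h0
  have hadj : ∀ x y c d, ¬ S x → ¬ S y → S c → S d → c ≠ d → G.Adj c x → G.Adj d y →
      ¬ G.Adj x y := by
    intro x y c d hx hy hc hd hne hcx hdy hxy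
    obtain ⟨A, B, h⟩ := h0.exists_split hc hd hne
    exact H.no_adj hcard h hone hx hy hxy hcx hdy
  have hlen := h0.2.2.2
  rcases T with _ | ⟨e2, _ | ⟨e3, T⟩⟩
  · simp at hlen; omega
  · simp at hlen; omega
  have he : S e := (h0.2.2.1 e).2 (by simp)
  have he2 : S e2 := (h0.2.2.1 e2).2 (by simp)
  have hee2 : e ≠ e2 := by
    have := h0.2.1
    simp at this
    exact this.1.1
  obtain ⟨c, x, hc, hx, -, -, hcx⟩ := boundary h2 S e e2 r he2 hr hee2.symm
    (by rintro rfl; exact hr he)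
  obtain ⟨c', hc', hcc'⟩ : ∃ c', S c' ∧ c' ≠ c := by
    by_cases h1 : e = c
    · exact ⟨e2, he2, by rw [← h1]; exact hee2.symm⟩
    · exact ⟨e, he, h1⟩
  obtain ⟨d, y, hd, hy, hdc, -, hdy⟩ := boundary h2 S c c' x hc' hx hcc'
    (by rintro rfl; exact hx hc)
  have hxy : x ≠ y := by
    rintro rfl
    exact hdc (hone x hx d c hd hc hdy.symm hcx.symm)
  have nxy := hadj x y c d hx hy hc hd hdc.symm hcx hdy
  obtain ⟨A, B, h⟩ := h0.exists_split hc hd hdc.symm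
  obtain ⟨z, hz, hxz⟩ := H.out_nbr hcard h hx (hδ x)
  have hzn : ∀ f, S f → f ≠ c → ¬ G.Adj z f := fun f hf hfc hzf =>
    hadj x z c f hx hz hc hf hfc.symm hcx hzf.symm hxz
  have hxn : ∀ f, S f → f ≠ c → ¬ G.Adj x f := fun f hf hfc hh =>
    hfc (hone x hx f c hf hc hh hcx.symm)
  have hyn : ∀ f, S f → f ≠ d → ¬ G.Adj y f := fun f hf hfc hh =>
    hfc (hone y hy f d hf hd hh hdy.symm)
  have hzy : z ≠ y := by
    rintro rfl; exact nxy hxz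
  by_cases hzya : G.Adj z y
  · have hQ := rp_three hx hz hy hxy hcx hxz hzya hdy.symm
    have g1 := H.gap h hQ
    have g2 := H.gap h.rot hQ.rev
    rcases A with _ | ⟨s1, _ | ⟨k, A⟩⟩ <;> try simp at g1
    rcases B with _ | ⟨s2, B⟩
    · simp at g2
    have hs := H.noSucc (A := k :: A) h (by simp) hQ
    have n0 : [c, d, s1, s2, k].Nodup := by
      refine h.nodup (Q := []) (by simp) (by simp) ?_
      intro a
      simp only [List.count_append, List.count_cons, List.count_nil]
      omega
    have n1 : [x, y, s1, s2, k].Nodup := by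
      refine h.nodup (Q := [x, y]) (by simpa using hxy) (by simp [hx, hy]) ?_
      intro a
      simp only [List.count_append, List.count_cons, List.count_nil]
      omega
    have m : ∀ v ∈ [s1, s2, k], S v ∧ v ≠ c ∧ v ≠ d := by
      intro v hv
      refine ⟨(h.2.2.1 v).2 ?_, ?_, ?_⟩
      · simp at hv ⊢; tauto
      · rintro rfl; simp at hv n0; tauto
      · rintro rfl; simp at hv n0; tauto
    have k : ∀ v ∈ [s1, s2, k], ¬ G.Adj x v ∧ ¬ G.Adj y v := fun v hv =>
      ⟨hxn v (m v hv).1 (m v hv).2.1, hyn v (m v hv).1 (m v hv).2.2⟩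
    simp only [List.forall_mem_cons] at k
    obtain ⟨k1, k2, k3, -⟩ := k
    have t := three_of H.five n1 k1.1 k2.1 k1.2 k2.2 hs nxy
    have := ind_zero k3.1
    have := ind_zero k3.2
    have := ind_le (G := G) s1 k
    have := ind_le (G := G) s2 k
    omega
  · have hl := h.2.2.2
    obtain ⟨k, k', n0, hk, hk'⟩ : ∃ k k', [c, d, k, k'].Nodup ∧ S k ∧ S k' := by
      have hAB : ∃ k k' L, A ++ B = k :: k' :: L := by
        rcases hAB : A ++ B with _ | ⟨k, _ | ⟨k', L⟩⟩
        · have := congrArg List.length hAB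
          simp only [List.length_append, List.length_cons, List.length_nil] at this hl
          omega
        · have := congrArg List.length hAB
          simp only [List.length_append, List.length_cons, List.length_nil] at this hl
          omega
        · exact ⟨k, k', L, rfl⟩
      obtain ⟨k, k', L, hAB⟩ := hAB
      have hcnt : ∀ a, List.count a A + List.count a B = List.count a (k :: k' :: L) := by
        intro a; rw [← hAB, List.count_append]
      have hmem : ∀ v, v ∈ [k, k'] → S v := by
        intro v hv
        refine (h.2.2.1 v).2 ?_
        have : v ∈ A ++ B := by rw [hAB]; simp at hv ⊢; tauto
        simp at this ⊢; tauto
      refine ⟨k, k', ?_, hmem k (by simp), hmem k' (by simp)⟩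
      refine h.nodup (Q := []) (by simp) (by simp) ?_
      intro a
      have := hcnt a
      simp only [List.count_append, List.count_cons, List.count_nil] at this ⊢
      omega
    simp at n0
    have ne : ∀ f g, ¬ S f → S g → f ≠ g := by
      rintro f g hf hg rfl; exact hf hg
    have n1 : [x, y, z, k, k'].Nodup := by
      simp [hxy, hxz.ne, hzy.symm, ne x k hx hk, ne x k' hx hk', ne y k hy hk, ne y k' hy hk',
        ne z k hz hk, ne z k' hz hk']
      tauto
    have t := H.five _ _ _ _ _ n1
    have := ind_zero nxy
    have := ind_zero (fun hh => hzya (SimpleGraph.Adj.symm hh) : ¬ G.Adj y z)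
    have := ind_zero (hxn k hk (fun hh => by simp [hh] at n0))
    have := ind_zero (hxn k' hk' (fun hh => by simp [hh] at n0))
    have := ind_zero (hyn k hk (fun hh => by simp [hh] at n0))
    have := ind_zero (hyn k' hk' (fun hh => by simp [hh] at n0))
    have := ind_zero (hzn k hk (fun hh => by simp [hh] at n0))
    have := ind_zero (hzn k' hk' (fun hh => by simp [hh] at n0))
    have := ind_le (G := G) x z
    have := ind_le (G := G) k k'
    omega

end Ham

/-- Hamiltonicity -/
theorem cycN_card [Fintype V] (G : SimpleGraph V) [DecidableRel G.Adj] (h2 : TwoConnected G)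
    (h5 : FiveI G) (hcard : 9 ≤ Fintype.card V) (hδ : ∀ v : V, 3 ≤ G.degree v) (q : ℕ)
    (hq : 4 ≤ q) (hc : CycN G q) : CycN G (Fintype.card V) := by
  classical
  have hb : ∀ m, CycN G m → m ≤ Fintype.card V := by
    rintro m ⟨c, T, -, hn, hl⟩
    have := hn.length_le_card
    simp at this; omega
  let p := Nat.findGreatest (CycN G) (Fintype.card V)
  have hp : CycN G p := Nat.findGreatest_spec (hb q hc) hc
  have hqp : q ≤ p := Nat.le_findGreatest (hb q hc) hc
  have hmx : ∀ c T, Pth G c T c → (c :: T).Nodup → T.length + 1 ≤ p := by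
    intro c T h1 h3
    have : CycN G (T.length + 1) := ⟨c, T, h1, h3, rfl⟩
    exact Nat.le_findGreatest (hb _ this) this
  have H : Ctx G p := ⟨h5, hmx⟩
  obtain ⟨c, T, k1, k2, k3⟩ := id hp
  by_cases hall : ∃ r, r ∉ c :: T
  · obtain ⟨r, hr⟩ := hall
    exact (H.ham (S := fun v => v ∈ c :: T) h2 hδ hcard (by omega)
      ⟨k1, k2, fun v => Iff.rfl, k3⟩ r hr).elim
  · have : ¬ (c :: T).length < Fintype.card V := fun hh => hall (exists_not_mem_list _ hh)
    have h4 := hb p hp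
    have : p = Fintype.card V := by simp at this; omega
    rwa [this] at hp

theorem get_of_pth (G : SimpleGraph V) (l : List V) (u v : V) (hP : Pth G u l v) :
    ∀ i (hi : i + 1 < (u :: l ++ [v]).length), G.Adj ((u :: l ++ [v])[i]'(by omega))
      ((u :: l ++ [v])[i + 1]) := by
  induction l generalizing u with
  | nil =>
    intro i hi
    simp at hi
    subst hi
    exact hP
  | cons a l ih =>
    intro i hi
    rcases i with _ | i
    · exact hP.1
    · exact ih a hP.2 i (by simp at hi ⊢; omega)

theorem fin_sub_one {n : ℕ} (hn : 2 ≤ n) (i j : Fin n) :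
    (i - j).val = 1 ↔ (i.1 = j.1 + 1 ∨ (i.1 = 0 ∧ j.1 + 1 = n)) := by
  have hi := i.2
  have hj := j.2
  by_cases h : j ≤ i
  · have h1 := Fin.coe_sub_iff_le.2 h
    have h2 : j.1 ≤ i.1 := h
    omega
  · have h1 := Fin.coe_sub_iff_lt.2 (not_le.1 h)
    have h2 : ¬ j.1 ≤ i.1 := h
    omega

/-- from a copy of `C~ℓ` to a cycle with one more vertex -/
theorem cyc_of_copy (G : SimpleGraph V) (ℓ : ℕ) (hℓ : 3 ≤ ℓ) (h : ContainsCopy (tildeC ℓ) G) :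
    CycN G (ℓ + 1) := by
  obtain ⟨f, hf⟩ := h
  obtain ⟨k, rfl⟩ : ∃ k, ℓ = k + 3 := ⟨ℓ - 3, by omega⟩
  have hadj : ∀ i : ℕ, ∀ hi : i + 1 < k + 3,
      G.Adj (f (Sum.inl ⟨i, by omega⟩)) (f (Sum.inl ⟨i + 1, hi⟩)) := by
    intro i hi
    apply f.map_rel
    rw [tildeC, SimpleGraph.fromRel_adj]
    refine ⟨by simp, Or.inl ?_⟩
    show (SimpleGraph.cycleGraph (k + 3)).Adj _ _
    rw [SimpleGraph.cycleGraph_adj']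
    right
    rw [fin_sub_one (by omega)]
    simp
  have hlast : G.Adj (f (Sum.inl ⟨k + 2, by omega⟩)) (f (Sum.inl ⟨0, by omega⟩)) := by
    apply f.map_rel
    rw [tildeC, SimpleGraph.fromRel_adj]
    refine ⟨by simp, Or.inl ?_⟩
    show (SimpleGraph.cycleGraph (k + 3)).Adj _ _
    rw [SimpleGraph.cycleGraph_adj']
    right
    rw [fin_sub_one (by omega)]
    simp
  have hb : ∀ i : Fin (k + 3), (i : ℕ) = 0 ∨ (i : ℕ) = 1 →
      G.Adj (f (Sum.inl i)) (f (Sum.inr ())) := by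
    intro i hi
    apply f.map_rel
    rw [tildeC, SimpleGraph.fromRel_adj]
    exact ⟨by simp, Or.inl hi⟩
  let g : ℕ → V := fun i => if h : i < k + 3 then f (Sum.inl ⟨i, h⟩) else f (Sum.inr ())
  have hg : ∀ i (h : i < k + 3), g i = f (Sum.inl ⟨i, h⟩) := fun i h => dif_pos h
  have hginj : ∀ i j, i ≤ k + 3 → j ≤ k + 3 → g i = g j → i = j := by
    intro i j hi hj hij
    simp only [g] at hij
    split_ifs at hij with h1 h2 h2
    · simpa using hf hij
    · simpa using hf hij
    · simpa using hf hij
    · omega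
  have hsuc : ∀ i, i < k + 2 → G.Adj (g i) (g (i + 1)) := by
    intro i hi
    rw [hg i (by omega), hg (i + 1) (by omega)]
    exact hadj i (by omega)
  have hpath : ∀ m s, s + m + 1 ≤ k + 2 →
      Pth G (g s) ((List.range' (s + 1) m).map g) (g (s + m + 1)) := by
    intro m
    induction m with
    | zero => intro s hs; exact hsuc s (by omega)
    | succ m ih =>
      intro s hs
      rw [List.range'_succ, List.map_cons]
      refine ⟨hsuc s (by omega), ?_⟩
      have := ih (s + 1) (by omega)
      rwa [show s + 1 + m + 1 = s + (m + 1) + 1 by omega] at this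
  have h1 := hpath k 1 (by omega)
  have e3 : g (k + 3) = f (Sum.inr ()) := dif_neg (by omega)
  refine ⟨g (k + 3), g 1 :: (List.range' 2 k).map g ++ [g (k + 2), g 0], ?_, ?_, by simp⟩
  · refine ⟨?_, ?_⟩
    · rw [e3, hg 1 (by omega)]; exact (hb _ (Or.inr rfl)).symm
    · refine (pth_append _ _ _ _ _ _).2 ⟨by rwa [show 1 + k + 1 = k + 2 by omega] at h1, ?_, ?_⟩
      · rw [hg 0 (by omega), hg (k + 2) (by omega)]; exact hlast
      · rw [e3, hg 0 (by omega)]; exact hb _ (Or.inl rfl)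
  · have : (g (k + 3) :: (g 1 :: (List.range' 2 k).map g ++ [g (k + 2), g 0])) =
        ((k + 3) :: (1 :: List.range' 2 k ++ [k + 2, 0])).map g := by simp
    rw [this, List.nodup_map_iff_inj_on]
    · intro i hi j hj
      apply hginj
      · simp at hi; omega
      · simp at hj; omega
    · have h0 := List.nodup_range' (s := 2) (n := k)
      simp [List.nodup_append, h0]
      exact ⟨by omega, fun a h1 h2 => by omega⟩

/-- from a good cycle to a copy of `C~ℓ` -/
theorem copy_of_good (G : SimpleGraph V) (ℓ : ℕ) (hℓ : 3 ≤ ℓ) (h : GoodCyc G (ℓ + 1)) :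
    ContainsCopy (tildeC ℓ) G := by
  obtain ⟨a, b, c, T, hab, hbc, hac, hP, hN, hlen⟩ := h
  obtain ⟨k, rfl⟩ : ∃ k, ℓ = k + 2 := ⟨ℓ - 2, by omega⟩
  have hT : T.length = k := by omega
  have hPa : Pth G a (c :: T) a := ⟨hac, hP⟩
  have hgt := get_of_pth G (c :: T) a a hPa
  have hl : (a :: c :: T).length = k + 2 := by simp [hT]
  let g : Fin (k + 2) → V := fun i => (a :: c :: T)[i.1]'(by rw [hl]; exact i.2)
  have hN2 : (a :: c :: T).Nodup := hN.sublist (by simp [List.Sublist.cons])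
  have hbn : b ∉ a :: c :: T := by
    simp at hN ⊢
    refine ⟨fun hh => hN.1.1 hh.symm, hN.2.1⟩
  have hginj : Function.Injective g := by
    intro i j hij
    exact Fin.ext ((List.Nodup.getElem_inj_iff hN2).1 hij)
  have hone : ∀ i j : Fin (k + 2), (i - j).val = 1 → G.Adj (g j) (g i) := by
    intro i j hij
    rw [fin_sub_one (by omega)] at hij
    have hi := i.2
    have hj := j.2
    have h1 := hgt j.1 (by simp; omega)
    rw [List.getElem_append_left (by simp; omega)] at h1
    rcases hij with h | h
    · rw [List.getElem_append_left (by simp; omega)] at h1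
      simpa only [g, h] using h1
    · rw [List.getElem_append_right (by simp; omega)] at h1
      simpa [g, h.1] using h1
  have hcyc : ∀ i j : Fin (k + 2), (SimpleGraph.cycleGraph (k + 2)).Adj i j →
      G.Adj (g i) (g j) := by
    intro i j hij
    rw [SimpleGraph.cycleGraph_adj'] at hij
    rcases hij with h | h
    · exact (hone _ _ h).symm
    · exact hone _ _ h
  have hbadj : ∀ i : Fin (k + 2), (i : ℕ) = 0 ∨ (i : ℕ) = 1 → G.Adj (g i) b := by
    intro i hi
    rcases hi with h | h
    · simp only [g, h]; exact hab
    · simp only [g, h]; exact hbc.symm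
  refine ⟨⟨Sum.elim g (fun _ => b), ?_⟩, ?_⟩
  · intro u v huv
    rw [tildeC, SimpleGraph.fromRel_adj] at huv
    obtain ⟨hne, huv⟩ := huv
    rcases u with i | u <;> rcases v with j | v
    · rcases huv with h | h
      · exact hcyc _ _ h
      · exact (hcyc _ _ h).symm
    · rcases huv with h | h
      · exact hbadj _ h
      · exact h.elim
    · rcases huv with h | h
      · exact h.elim
      · exact (hbadj _ h).symm
    · rcases huv with h | h <;> exact h.elim
  · rintro (i | u) (j | v) h
    · exact congrArg _ (hginj h)
    · have h' : g i = b := h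
      exact absurd (h' ▸ List.getElem_mem _) hbn
    · have h' : b = g j := h
      exact absurd (h' ▸ List.getElem_mem _) hbn
    · rfl

end StmtFour

/-- If a 2-connected [5,3]-graph of order `n ≥ 9` with minimum degree at least 3 contains
a `C~ℓ` with `ℓ < n - 1`, then it contains a `C~(ℓ+1)` or a `C~(ℓ+2)`. -/
theorem stmt4 {V : Type*} [Fintype V] [DecidableEq V] (G : SimpleGraph V) [DecidableRel G.Adj]
    (h2 : TwoConnected G) (hst : IsSTGraph G 5 3) (hn : 9 ≤ Fintype.card V)
    (hδ : ∀ v : V, 3 ≤ G.degree v) (ℓ : ℕ) (hℓ : 3 ≤ ℓ) (hsmall : ℓ + 1 < Fintype.card V)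
    (hcontain : ContainsCopy (tildeC ℓ) G) :
    ContainsCopy (tildeC (ℓ + 1)) G ∨ ContainsCopy (tildeC (ℓ + 2)) G := by
  have h5 := StmtFour.fiveI_of G hst
  have hc := StmtFour.cyc_of_copy G ℓ hℓ hcontain
  have hH := StmtFour.cycN_card G h2 h5 hn hδ (ℓ + 1) (by omega) hc
  rcases StmtFour.good_all G h5 _ hn hH (ℓ + 1) (by omega) hsmall with h | h
  · exact Or.inl (StmtFour.copy_of_good G (ℓ + 1) (by omega) h)
  · exact Or.inr (StmtFour.copy_of_good G (ℓ + 2) (by omega) h)
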